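/- arXiv:math/9905136 — 5 statements merged into one kernel-verified Lean document; each statement's English description precedes it below -/
import Mathlib

section
/- Let H be a real Hilbert space and K : H → H a compact self-adjoint bounded linear operator. Then the continuous symmetric bilinear form B(x, y) = ⟪x, y⟫ + ⟪K x, y⟫ has finite index: ind(B, H) < ∞. -/
/-- The index of a (not necessarily bilinear) form `B` on the set `K`: the supremum of the
dimensions of the finite-dimensional subspaces contained in `K` on which `B` is negative
definite, as an element of `ℕ∞`. -/
noncomputable def indexOn {X : Type*} [AddCommGroup X] [Module ℝ X]
    (B : X → X → ℝ) (K : Set X) : ℕ∞ :=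
  ⨆ (U : Submodule ℝ X) (_ : (U : Set X) ⊆ K ∧ FiniteDimensional ℝ U ∧
      ∀ v ∈ U, v ≠ 0 → B v v < 0), (Module.finrank ℝ U : ℕ∞)

/-- A compact operator sends, up to an error less than `‖v‖`, every nonzero vector `v` into a fixed
finite-dimensional subspace. -/
theorem IsCompactOperator.exists_finiteDimensional_norm_sub_lt
    {E F : Type*} [NormedAddCommGroup E] [NormedSpace ℝ E] [NormedAddCommGroup F] [NormedSpace ℝ F]
    {T : E →L[ℝ] F} (hT : IsCompactOperator T) :
    ∃ W : Submodule ℝ F, FiniteDimensional ℝ W ∧ ∀ v : E, v ≠ 0 → ∃ w ∈ W, ‖T v - w‖ < ‖v‖ := by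
  have hcompact : IsCompact (closure (T '' Metric.closedBall 0 1)) :=
    IsCompactOperator.isCompact_closure_image_closedBall (f := (T : E →ₗ[ℝ] F)) hT 1
  obtain ⟨t, ht, hcover⟩ :=
    Metric.totallyBounded_iff.1 (hcompact.totallyBounded.subset subset_closure) 1 one_pos
  refine ⟨Submodule.span ℝ t, FiniteDimensional.span_of_finite ℝ ht, fun v hv => ?_⟩
  have hpos : 0 < ‖v‖ := norm_pos_iff.2 hv
  have hmem : T (‖v‖⁻¹ • v) ∈ T '' Metric.closedBall 0 1 :=
    Set.mem_image_of_mem T (by simp [norm_smul, hpos.ne'])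
  obtain ⟨w, hw, hdist⟩ := Set.mem_iUnion₂.1 (hcover hmem)
  refine ⟨‖v‖ • w, Submodule.smul_mem _ _ (Submodule.subset_span hw), ?_⟩
  have hscale : T v - ‖v‖ • w = ‖v‖ • (T (‖v‖⁻¹ • v) - w) := by
    rw [smul_sub, map_smul, smul_inv_smul₀ hpos.ne']
  rw [Metric.mem_ball, dist_eq_norm] at hdist
  rw [hscale, norm_smul, norm_norm]
  exact mul_lt_of_lt_one_right hpos hdist

/-- A subspace meeting the orthogonal complement of a finite-dimensional subspace `W` trivially has
dimension at most that of `W`. -/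
theorem Submodule.finrank_le_of_forall_mem_orthogonal_eq_zero
    {H : Type*} [NormedAddCommGroup H] [InnerProductSpace ℝ H]
    (U W : Submodule ℝ H) [FiniteDimensional ℝ W] (h : ∀ v ∈ U, v ∈ Wᗮ → v = 0) :
    Module.finrank ℝ U ≤ Module.finrank ℝ W := by
  refine LinearMap.finrank_le_finrank_of_injective
    (f := (W.orthogonalProjectionOnto : H →ₗ[ℝ] W) ∘ₗ U.subtype) ?_
  rw [← LinearMap.ker_eq_bot, LinearMap.ker_eq_bot']
  intro v hv
  exact Subtype.ext (h v v.2 (W.orthogonalProjectionOnto_eq_zero_iff.1 hv))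

/-- If `K` is a compact self-adjoint bounded operator on a real Hilbert space `H`, then the
continuous symmetric bilinear form `B (x, y) = ⟪x, y⟫ + ⟪K x, y⟫` has finite index. -/
theorem index_lt_top_of_compact_perturbation_of_identity
    {H : Type*} [NormedAddCommGroup H] [InnerProductSpace ℝ H] [CompleteSpace H]
    (K : H →L[ℝ] H) (hK : IsCompactOperator K)
    (hKsa : ∀ x y : H, (inner ℝ (K x) y : ℝ) = inner ℝ x (K y)) :
    indexOn (fun x y : H => (inner ℝ x y : ℝ) + (inner ℝ (K x) y : ℝ)) Set.univ < ⊤ := by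
  obtain ⟨W, hW, happrox⟩ := hK.exists_finiteDimensional_norm_sub_lt
  refine lt_of_le_of_lt (iSup₂_le fun U hU => ?_) (ENat.natCast_lt_top (Module.finrank ℝ W))
  obtain ⟨-, -, hneg⟩ := hU
  refine Nat.cast_le.2 (U.finrank_le_of_forall_mem_orthogonal_eq_zero W fun v hvU hvW => ?_)
  by_contra hv
  obtain ⟨w, hw, hlt⟩ := happrox v hv
  have hinner : inner ℝ (K v) v = inner ℝ (K v - w) v := by
    rw [inner_sub_left, (W.mem_orthogonal v).1 hvW w hw, sub_zero]
  have hB : inner ℝ v v + inner ℝ (K v) v < 0 := hneg v hvU hv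
  rw [hinner, real_inner_self_eq_norm_sq] at hB
  have hcs := neg_le_of_abs_le (abs_real_inner_le_norm (K v - w) v)
  nlinarith [norm_pos_iff.2 hv]
end

section
/- Let J₁, …, J_k be P-Jacobi fields (not necessarily linearly independent) and let φ₁, …, φ_k, ψ₁, …, ψ_k : [a,b] → ℝ be piecewise C¹ real functions. Then I^P(∑_{i=1}^k φ_i·J_i, ∑_{j=1}^k ψ_j·J_j) = ∫_a^b ⟪∑_{i=1}^k φ_i'(t) J_i(t), ∑_{j=1}^k ψ_j'(t) J_j(t)⟫ dt + ⟪∑_{i=1}^k φ_i(b) J_i'(b), ∑_{j=1}^k ψ_j(b) J_j(b)⟫. -/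
open Set

/-- `J` is a Jacobi field (in the ODE model) with derivative `J'`:
`J` is twice differentiable and `J'' = S J`. -/
def IsJacobiPair {n : ℕ} (S : ℝ → EuclideanSpace ℝ (Fin n) →L[ℝ] EuclideanSpace ℝ (Fin n))
    (J J' : ℝ → EuclideanSpace ℝ (Fin n)) : Prop :=
  (∀ t, HasDerivAt J (J' t) t) ∧ ∀ t, HasDerivAt J' (S t (J t)) t

/-- `J` is a `P`-Jacobi field with derivative `J'`: a Jacobi field with `J a ∈ W` and
`⟪J' a, w⟫ + σ (J a) w = 0` for all `w ∈ W`. -/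
def IsPJacobiPair {n : ℕ} (S : ℝ → EuclideanSpace ℝ (Fin n) →L[ℝ] EuclideanSpace ℝ (Fin n))
    (σ : EuclideanSpace ℝ (Fin n) →ₗ[ℝ] EuclideanSpace ℝ (Fin n) →ₗ[ℝ] ℝ)
    (W : Submodule ℝ (EuclideanSpace ℝ (Fin n))) (a : ℝ)
    (J J' : ℝ → EuclideanSpace ℝ (Fin n)) : Prop :=
  IsJacobiPair S J J' ∧ J a ∈ W ∧ ∀ w ∈ W, (inner ℝ (J' a) w : ℝ) + σ (J a) w = 0

/-- `V` is piecewise `C¹` on `[a, b]`: continuous on `[a, b]` and `C¹` on each of the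
closed subintervals of some partition `a = s₀ < s₁ < … < s_k = b`. -/
def PiecewiseC1On {F : Type*} [NormedAddCommGroup F] [NormedSpace ℝ F]
    (a b : ℝ) (V : ℝ → F) : Prop :=
  ContinuousOn V (Icc a b) ∧
  ∃ (k : ℕ) (s : Fin (k + 1) → ℝ), s 0 = a ∧ s (Fin.last k) = b ∧ StrictMono s ∧
    ∀ i : Fin k, ContDiffOn ℝ 1 V (Icc (s i.castSucc) (s i.succ))

/-- The index form `I^P` on `[a, b]`. -/
noncomputable def indexForm {n : ℕ}
    (S : ℝ → EuclideanSpace ℝ (Fin n) →L[ℝ] EuclideanSpace ℝ (Fin n))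
    (σ : EuclideanSpace ℝ (Fin n) →ₗ[ℝ] EuclideanSpace ℝ (Fin n) →ₗ[ℝ] ℝ)
    (a b : ℝ) (V U : ℝ → EuclideanSpace ℝ (Fin n)) : ℝ :=
  (∫ t in a..b, ((inner ℝ (deriv V t) (deriv U t) : ℝ) + (inner ℝ (S t (V t)) (U t) : ℝ))) -
    σ (V a) (U a)

open MeasureTheory
open scoped ENNReal

/-- A point between the ends of a strictly monotone finite sequence is either a node or lies in one
of the open intervals between consecutive nodes. -/
theorem exists_mem_Ioo_of_notMem_range {k : ℕ} {s : Fin (k + 1) → ℝ} {t : ℝ}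
    (h0 : s 0 ≤ t) (hk : t ≤ s (Fin.last k)) (ht : t ∉ range s) :
    ∃ i : Fin k, t ∈ Ioo (s i.castSucc) (s i.succ) := by
  by_contra! hcon
  have key : ∀ m : Fin (k + 1), s m < t := by
    intro m
    induction m using Fin.induction with
    | zero => exact h0.lt_of_ne fun h => ht ⟨0, h⟩
    | succ i ih =>
      by_contra! hle
      exact hcon i ⟨ih, hle.lt_of_ne fun h => ht ⟨_, h.symm⟩⟩
  exact (key (Fin.last k)).not_ge hk

/-- Off finitely many points, a piecewise `C¹` map is differentiable with bounded derivative. -/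
theorem PiecewiseC1On.exists_finite_bound {F : Type*} [NormedAddCommGroup F] [NormedSpace ℝ F]
    {a b : ℝ} {V : ℝ → F} (hV : PiecewiseC1On a b V) :
    ∃ (T : Set ℝ) (C : ℝ), T.Finite ∧
      ∀ t ∈ Icc a b \ T, DifferentiableAt ℝ V t ∧ ‖deriv V t‖ ≤ C := by
  obtain ⟨-, k, s, rfl, rfl, hs, hC⟩ := hV
  have hbound : ∀ i : Fin k, ∃ C, ∀ t ∈ Icc (s i.castSucc) (s i.succ),
      ‖derivWithin V (Icc (s i.castSucc) (s i.succ)) t‖ ≤ C := fun i =>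
    isCompact_Icc.exists_bound_of_continuousOn <|
      (hC i).continuousOn_derivWithin (uniqueDiffOn_Icc (hs i.castSucc_lt_succ)) le_rfl
  choose C hCb using hbound
  obtain ⟨M, hM⟩ := (finite_range C).bddAbove
  refine ⟨range s, M, finite_range s, fun t ht => ?_⟩
  obtain ⟨i, hi⟩ := exists_mem_Ioo_of_notMem_range ht.1.1 ht.1.2 ht.2
  have hnhds := Icc_mem_nhds hi.1 hi.2
  refine ⟨((hC i).differentiableOn one_ne_zero).differentiableAt hnhds, ?_⟩
  rw [← derivWithin_of_mem_nhds hnhds]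
  exact (hCb i t (Ioo_subset_Icc_self hi)).trans (hM ⟨i, rfl⟩)

/-- The derivative of a piecewise `C¹` map is essentially bounded. -/
theorem PiecewiseC1On.memLp_top_deriv {F : Type*} [NormedAddCommGroup F] [NormedSpace ℝ F]
    [CompleteSpace F] [SecondCountableTopology F]
    {a b : ℝ} {V : ℝ → F} (hV : PiecewiseC1On a b V) :
    MemLp (deriv V) ∞ (volume.restrict (Ioc a b)) := by
  obtain ⟨T, C, hT, h⟩ := hV.exists_finite_bound
  refine memLp_top_of_bound (stronglyMeasurable_deriv V).aestronglyMeasurable C ?_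
  rw [ae_restrict_iff' measurableSet_Ioc]
  filter_upwards [compl_mem_ae_iff.2 (hT.measure_zero volume)] with t htT ht
  exact (h t ⟨Ioc_subset_Icc_self ht, htT⟩).2

theorem ContinuousOn.memLp_top_Ioc {F : Type*} [NormedAddCommGroup F] {a b : ℝ} {V : ℝ → F}
    (hV : ContinuousOn V (Icc a b)) : MemLp V ∞ (volume.restrict (Ioc a b)) := by
  obtain ⟨C, hC⟩ := isCompact_Icc.exists_bound_of_continuousOn hV
  refine memLp_top_of_bound
    (hV.aestronglyMeasurable_of_subset_isCompact isCompact_Icc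
      measurableSet_Ioc Ioc_subset_Icc_self) C ?_
  rw [ae_restrict_iff' measurableSet_Ioc]
  exact .of_forall fun t ht => hC t (Ioc_subset_Icc_self ht)

theorem intervalIntegrable_inner_of_memLp_top {F : Type*} [NormedAddCommGroup F]
    [InnerProductSpace ℝ F] {a b : ℝ} (hab : a ≤ b) {X Y : ℝ → F}
    (hX : MemLp X ∞ (volume.restrict (Ioc a b))) (hY : MemLp Y ∞ (volume.restrict (Ioc a b))) :
    IntervalIntegrable (fun t => (inner ℝ (X t) (Y t) : ℝ)) volume a b := by
  rw [intervalIntegrable_iff_integrableOn_Ioc_of_le hab]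
  have h : MemLp (fun t => innerSL ℝ (X t) (Y t)) ∞ (volume.restrict (Ioc a b)) :=
    (innerSL ℝ).memLp_of_bilin ∞ hX hY
  simpa [IntegrableOn] using h.integrable le_top

/-- The Wronskian of two `P`-Jacobi fields vanishes. -/
theorem IsPJacobiPair.inner_deriv_comm {n : ℕ}
    {S : ℝ → EuclideanSpace ℝ (Fin n) →L[ℝ] EuclideanSpace ℝ (Fin n)}
    {σ : EuclideanSpace ℝ (Fin n) →ₗ[ℝ] EuclideanSpace ℝ (Fin n) →ₗ[ℝ] ℝ}
    {W : Submodule ℝ (EuclideanSpace ℝ (Fin n))} {a : ℝ}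
    {J J' K K' : ℝ → EuclideanSpace ℝ (Fin n)}
    (hSsa : ∀ (t : ℝ) (x y : EuclideanSpace ℝ (Fin n)),
      (inner ℝ (S t x) y : ℝ) = inner ℝ x (S t y))
    (hσ : ∀ x y, σ x y = σ y x)
    (hJ : IsPJacobiPair S σ W a J J') (hK : IsPJacobiPair S σ W a K K') (t : ℝ) :
    (inner ℝ (J t) (K' t) : ℝ) = inner ℝ (J' t) (K t) := by
  obtain ⟨⟨hJ1, hJ2⟩, hJW, hJa⟩ := hJ
  obtain ⟨⟨hK1, hK2⟩, hKW, hKa⟩ := hK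
  have hd : ∀ t, HasDerivAt
      (fun t => (inner ℝ (J t) (K' t) : ℝ) - inner ℝ (J' t) (K t)) 0 t := fun t => by
    refine (((hJ1 t).inner ℝ (hK2 t)).sub ((hJ2 t).inner ℝ (hK1 t))).congr_deriv ?_
    rw [hSsa]
    ring
  have hconst := is_const_of_deriv_eq_zero (fun t => (hd t).differentiableAt)
    (fun t => (hd t).deriv) t a
  have h1 := hJa _ hKW
  have h2 := hKa _ hJW
  rw [hσ, real_inner_comm] at h2
  linarith

/-- For `P`-Jacobi fields `J₁, …, J_k` and piecewise `C¹` real functions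
`φ₁, …, φ_k, ψ₁, …, ψ_k` one has
`I^P(∑ φᵢ Jᵢ, ∑ ψⱼ Jⱼ) = ∫_a^b ⟪∑ φᵢ' Jᵢ, ∑ ψⱼ' Jⱼ⟫ + ⟪∑ φᵢ(b) Jᵢ'(b), ∑ ψⱼ(b) Jⱼ(b)⟫`. -/
theorem indexForm_of_combination_of_pJacobi {n : ℕ}
    (S : ℝ → EuclideanSpace ℝ (Fin n) →L[ℝ] EuclideanSpace ℝ (Fin n))
    (hS : ContDiff ℝ (⊤ : ℕ∞) S)
    (hSsa : ∀ (t : ℝ) (x y : EuclideanSpace ℝ (Fin n)),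
      (inner ℝ (S t x) y : ℝ) = inner ℝ x (S t y))
    (σ : EuclideanSpace ℝ (Fin n) →ₗ[ℝ] EuclideanSpace ℝ (Fin n) →ₗ[ℝ] ℝ)
    (hσ : ∀ x y, σ x y = σ y x)
    (W : Submodule ℝ (EuclideanSpace ℝ (Fin n)))
    (a b : ℝ) (hab : a < b) (k : ℕ)
    (J J' : Fin k → ℝ → EuclideanSpace ℝ (Fin n))
    (hJ : ∀ i, IsPJacobiPair S σ W a (J i) (J' i))
    (φ ψ : Fin k → ℝ → ℝ)
    (hφ : ∀ i, PiecewiseC1On a b (φ i)) (hψ : ∀ i, PiecewiseC1On a b (ψ i)) :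
    indexForm S σ a b (fun t => ∑ i, φ i t • J i t) (fun t => ∑ j, ψ j t • J j t) =
      (∫ t in a..b,
        (inner ℝ (∑ i, deriv (φ i) t • J i t) (∑ j, deriv (ψ j) t • J j t) : ℝ)) +
      (inner ℝ (∑ i, φ i b • J' i b) (∑ j, ψ j b • J j b) : ℝ) := by
  have hJd : ∀ i t, HasDerivAt (J i) (J' i t) t := fun i => (hJ i).1.1
  have hJ'd : ∀ i t, HasDerivAt (J' i) (S t (J i t)) t := fun i => (hJ i).1.2
  have hJc : ∀ i, Continuous (J i) := fun i =>
    continuous_iff_continuousAt.2 fun t => (hJd i t).continuousAt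
  have hJ'c : ∀ i, Continuous (J' i) := fun i =>
    continuous_iff_continuousAt.2 fun t => (hJ'd i t).continuousAt
  choose Tφ Cφ hTφ hdφ using fun i => (hφ i).exists_finite_bound
  choose Tψ Cψ hTψ hdψ using fun i => (hψ i).exists_finite_bound
  let T : Set ℝ := (⋃ i, Tφ i) ∪ ⋃ i, Tψ i
  have hT : T.Finite := (finite_iUnion hTφ).union (finite_iUnion hTψ)
  let V := fun t => ∑ i, φ i t • J i t
  let U := fun t => ∑ j, ψ j t • J j t
  let A := fun t => ∑ i, φ i t • J' i t
  let B := fun t => ∑ j, ψ j t • J' j t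
  let X := fun t => ∑ i, deriv (φ i) t • J i t
  let X' := fun t => ∑ i, deriv (φ i) t • J' i t
  let Y := fun t => ∑ j, deriv (ψ j) t • J j t
  have hderiv : ∀ (χ : Fin k → ℝ → ℝ) (K K' : Fin k → ℝ → EuclideanSpace ℝ (Fin n)) (t : ℝ),
      (∀ i, DifferentiableAt ℝ (χ i) t) → (∀ i, HasDerivAt (K i) (K' i t) t) →
      HasDerivAt (fun t => ∑ i, χ i t • K i t)
        ((∑ i, deriv (χ i) t • K i t) + ∑ i, χ i t • K' i t) t := by
    intro χ K K' t hχ hK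
    rw [add_comm, ← Finset.sum_add_distrib]
    exact HasDerivAt.fun_sum fun i _ => (hχ i).hasDerivAt.smul (hK i)
  have hφd : ∀ t ∈ Icc a b \ T, ∀ i, DifferentiableAt ℝ (φ i) t := fun t ht i =>
    (hdφ i t ⟨ht.1, fun h => ht.2 (.inl (mem_iUnion_of_mem i h))⟩).1
  have hψd : ∀ t ∈ Icc a b \ T, ∀ i, DifferentiableAt ℝ (ψ i) t := fun t ht i =>
    (hdψ i t ⟨ht.1, fun h => ht.2 (.inr (mem_iUnion_of_mem i h))⟩).1
  have hVd : ∀ t ∈ Icc a b \ T, HasDerivAt V (X t + A t) t := fun t ht =>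
    hderiv φ J J' t (hφd t ht) fun i => hJd i t
  have hUd : ∀ t ∈ Icc a b \ T, HasDerivAt U (Y t + B t) t := fun t ht =>
    hderiv ψ J J' t (hψd t ht) fun i => hJd i t
  have hAd : ∀ t ∈ Icc a b \ T, HasDerivAt A (X' t + S t (V t)) t := fun t ht => by
    simpa [V, X', A] using
      hderiv φ J' (fun i t => S t (J i t)) t (hφd t ht) fun i => hJ'd i t
  have hcont : ∀ (χ : Fin k → ℝ → ℝ) (K : Fin k → ℝ → EuclideanSpace ℝ (Fin n)),
      (∀ i, PiecewiseC1On a b (χ i)) → (∀ i, Continuous (K i)) →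
      ContinuousOn (fun t => ∑ i, χ i t • K i t) (Icc a b) := fun χ K hχ hK =>
    continuousOn_finsetSum _ fun i _ => (hχ i).1.smul (hK i).continuousOn
  have hVc : ContinuousOn V (Icc a b) := hcont φ J hφ hJc
  have hUc : ContinuousOn U (Icc a b) := hcont ψ J hψ hJc
  have hAc : ContinuousOn A (Icc a b) := hcont φ J' hφ hJ'c
  have hBc : ContinuousOn B (Icc a b) := hcont ψ J' hψ hJ'c
  have hSVc : ContinuousOn (fun t => S t (V t)) (Icc a b) :=
    hS.continuous.continuousOn.clm_apply hVc
  have hmem : ∀ (χ : Fin k → ℝ → ℝ) (K : Fin k → ℝ → EuclideanSpace ℝ (Fin n)),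
      (∀ i, PiecewiseC1On a b (χ i)) → (∀ i, Continuous (K i)) →
      MemLp (fun t => ∑ i, deriv (χ i) t • K i t) ∞ (volume.restrict (Ioc a b)) :=
    fun χ K hχ hK => memLp_finsetSum _ fun i _ =>
      (hK i).continuousOn.memLp_top_Ioc.smul (hχ i).memLp_top_deriv
  have hX : MemLp X ∞ (volume.restrict (Ioc a b)) := hmem φ J hφ hJc
  have hX' : MemLp X' ∞ (volume.restrict (Ioc a b)) := hmem φ J' hφ hJ'c
  have hY : MemLp Y ∞ (volume.restrict (Ioc a b)) := hmem ψ J hψ hJc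
  have hXY := intervalIntegrable_inner_of_memLp_top hab.le hX hY
  let g := fun t => (inner ℝ (A t) (Y t + B t) : ℝ) + inner ℝ (X' t + S t (V t)) (U t)
  have hg : IntervalIntegrable g volume a b :=
    (intervalIntegrable_inner_of_memLp_top hab.le hAc.memLp_top_Ioc
      (hY.add hBc.memLp_top_Ioc)).add
    (intervalIntegrable_inner_of_memLp_top hab.le (hX'.add hSVc.memLp_top_Ioc) hUc.memLp_top_Ioc)
  have hFTC : ∫ t in a..b, g t = (inner ℝ (A b) (U b) : ℝ) - inner ℝ (A a) (U a) :=
    integral_eq_of_hasDerivAt_off_countable_of_le (fun t => (inner ℝ (A t) (U t) : ℝ)) g hab.le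
      hT.countable (hAc.inner hUc)
      (fun t ht => (hAd t ⟨Ioo_subset_Icc_self ht.1, ht.2⟩).inner ℝ
        (hUd t ⟨Ioo_subset_Icc_self ht.1, ht.2⟩)) hg
  have hsymm : ∀ t, (inner ℝ (X t) (B t) : ℝ) = inner ℝ (X' t) (U t) := fun t => by
    simp only [X, B, X', U, sum_inner, inner_sum, real_inner_smul_left, real_inner_smul_right,
      IsPJacobiPair.inner_deriv_comm hSsa hσ (hJ _) (hJ _) t]
  have hae : ∫ t in a..b, ((inner ℝ (deriv V t) (deriv U t) : ℝ) + inner ℝ (S t (V t)) (U t)) =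
      ∫ t in a..b, ((inner ℝ (X t) (Y t) : ℝ) + g t) := by
    refine intervalIntegral.integral_congr_ae ?_
    filter_upwards [compl_mem_ae_iff.2 (hT.measure_zero volume)] with t htT ht
    rw [uIoc_of_le hab.le] at ht
    have ht' : t ∈ Icc a b \ T := ⟨Ioc_subset_Icc_self ht, htT⟩
    rw [(hVd t ht').deriv, (hUd t ht').deriv]
    simp only [g, inner_add_left, inner_add_right, hsymm]
    ring
  have hUW : U a ∈ W := W.sum_mem fun j _ => W.smul_mem _ (hJ j).2.1
  have hbdry : (inner ℝ (A a) (U a) : ℝ) + σ (V a) (U a) = 0 := by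
    simp only [A, V, sum_inner, map_sum, LinearMap.sum_apply, real_inner_smul_left, map_smul,
      LinearMap.smul_apply, smul_eq_mul, ← Finset.sum_add_distrib, ← mul_add]
    exact Finset.sum_eq_zero fun i _ => by rw [(hJ i).2.2 _ hUW, mul_zero]
  change (∫ t in a..b, ((inner ℝ (deriv V t) (deriv U t) : ℝ) + inner ℝ (S t (V t)) (U t))) -
      σ (V a) (U a) = (∫ t in a..b, (inner ℝ (X t) (Y t) : ℝ)) + inner ℝ (A b) (U b)
  rw [hae, intervalIntegral.integral_add hXY hg, hFTC]
  linarith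
end

section
/- Assume that no instant t₀ ∈ (a,b] is P-focal. Let J be a P-Jacobi field and let V : [a,b] → E be piecewise C¹ with V(a) ∈ W and V(b) = J(b). Then I^P(V,V) ≥ I^P(J,J), with equality if and only if V(t) = J(t) for all t ∈ [a,b]. -/
open Set

open MeasureTheory Filter Topology

/-- Global existence for a linear ODE with continuous coefficients. -/
theorem exists_hasDerivAt_linear {F : Type*} [NormedAddCommGroup F] [NormedSpace ℝ F]
    [CompleteSpace F] {L : ℝ → F →L[ℝ] F} (hL : Continuous L) (a : ℝ) (x₀ : F) :
    ∃ y : ℝ → F, y a = x₀ ∧ ∀ t, HasDerivAt y (L t (y t)) t := by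
  let next : (ℝ → F) → ℝ → F := fun f t ↦ ∫ s in a..t, L s (f s)
  let p : ℕ → ℝ → F := fun k ↦ next^[k] (fun _ ↦ x₀)
  have hp : ∀ k, p (k + 1) = fun t ↦ ∫ s in a..t, L s (p k s) := fun k ↦
    Function.iterate_succ_apply' next k _
  have hcont : ∀ k, Continuous (p k) := by
    intro k
    induction k with
    | zero => exact continuous_const
    | succ k ih =>
      rw [hp]
      exact intervalIntegral.continuous_primitive
        (fun c d ↦ (hL.clm_apply ih).intervalIntegrable c d) a
  have hder : ∀ k t, HasDerivAt (p (k + 1)) (L t (p k t)) t := by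
    intro k t
    rw [hp]
    exact (hL.clm_apply (hcont k)).integral_hasStrictDerivAt a t |>.hasDerivAt
  have hpa : ∀ k, p (k + 1) a = 0 := fun k ↦ by simp [hp]
  have hbound : ∀ N : ℝ, ∃ M : ℝ, 0 ≤ M ∧ (∀ t ∈ Icc (a - N) (a + N), ‖L t‖ ≤ M) ∧
      ∀ k, ∀ t ∈ Icc (a - N) (a + N), ‖p k t‖ ≤ ‖x₀‖ * ((M * |t - a|) ^ k / k.factorial) := by
    intro N
    obtain ⟨M, hM⟩ := (isCompact_Icc (a := a - N) (b := a + N)).exists_bound_of_continuousOn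
      hL.continuousOn
    refine ⟨max M 0, le_max_right _ _, fun t ht ↦ (hM t ht).trans (le_max_left _ _), fun k ↦ ?_⟩
    induction k with
    | zero => intro t _; simp [p]
    | succ k ih =>
      intro t ht
      have ha : a ∈ Icc (a - N) (a + N) := by constructor <;> linarith [ht.1, ht.2]
      have hsub : uIoc a t ⊆ Icc (a - N) (a + N) :=
        uIoc_subset_uIcc.trans (uIcc_subset_Icc ha ht)
      rw [hp]
      set m := max M 0
      have hm : 0 ≤ m := le_max_right _ _
      calc ‖∫ s in a..t, L s (p k s)‖
          ≤ ∫ s in uIoc a t, m * (‖x₀‖ * ((m * |s - a|) ^ k / k.factorial)) := by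
            rw [intervalIntegral.norm_intervalIntegral_eq]
            refine MeasureTheory.norm_integral_le_of_norm_le ?_ ?_
            · exact Continuous.integrableOn_uIoc (by fun_prop)
            · refine MeasureTheory.ae_restrict_of_forall_mem measurableSet_uIoc fun s hs ↦ ?_
              exact ((L s).le_opNorm _).trans (mul_le_mul
                ((hM s (hsub hs)).trans (le_max_left _ _)) (ih s (hsub hs)) (norm_nonneg _) hm)
        _ = ‖x₀‖ * ((m * |t - a|) ^ (k + 1) / (k + 1).factorial) := by
            have : ∀ s, m * (‖x₀‖ * ((m * |s - a|) ^ k / k.factorial)) =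
                (m * ‖x₀‖ * m ^ k / k.factorial) * |s - a| ^ k := fun s ↦ by
              rw [mul_pow]; ring
            simp_rw [this]
            rw [MeasureTheory.integral_const_mul, integral_pow_abs_sub_uIoc, Nat.factorial_succ]
            push_cast
            field_simp
            ring
  have hsum : ∀ t, Summable fun k ↦ p k t := by
    intro t
    obtain ⟨M, -, -, hM⟩ := hbound |t - a|
    refine .of_norm_bounded ((Real.summable_pow_div_factorial (M * |t - a|)).mul_left ‖x₀‖)
      fun k ↦ hM k t ?_
    constructor <;> linarith [le_abs_self (t - a), neg_abs_le (t - a)]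
  refine ⟨fun t ↦ ∑' k, p k t, ?_, fun t ↦ ?_⟩
  · beta_reduce
    rw [(hsum a).tsum_eq_zero_add]
    simp [hpa, p]
  have hsplit : (fun t ↦ ∑' k, p k t) = fun t ↦ x₀ + ∑' k, p (k + 1) t := by
    ext t
    rw [(hsum t).tsum_eq_zero_add]
    simp [p]
  have hmap : L t (∑' k, p k t) = ∑' k, L t (p k t) := (L t).map_tsum (hsum t)
  rw [hmap, hsplit]
  refine HasDerivAt.const_add x₀ ?_
  set N := |t - a| + 1
  obtain ⟨M, hM0, hML, hM⟩ := hbound N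
  have hN : 0 < N := by positivity
  refine hasDerivAt_tsum_of_isPreconnected (t := Ioo (a - N) (a + N)) (y₀ := a)
    (((Real.summable_pow_div_factorial (M * N)).mul_left ‖x₀‖).mul_left M) isOpen_Ioo
    isPreconnected_Ioo (fun k s _ ↦ hder k s) (fun k s hs ↦ ?_) ?_ ?_ ?_
  · refine ((L s).le_opNorm _).trans (mul_le_mul (hML s (Ioo_subset_Icc_self hs))
      ((hM k s (Ioo_subset_Icc_self hs)).trans ?_) (norm_nonneg _) hM0)
    have : |s - a| ≤ N := abs_le.2 ⟨by linarith [hs.1], by linarith [hs.2]⟩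
    gcongr
  · constructor <;> linarith
  · exact (summable_nat_add_iff 1).2 (hsum a)
  · constructor <;> linarith [le_abs_self (t - a), neg_abs_le (t - a)]

/-- Global existence of operator-valued solutions of the Jacobi equation. -/
theorem exists_jacobi_tensor {E : Type*} [NormedAddCommGroup E] [NormedSpace ℝ E]
    [CompleteSpace E] {S : ℝ → E →L[ℝ] E} (hS : Continuous S) (a : ℝ) (A₀ A₁ : E →L[ℝ] E) :
    ∃ A A' : ℝ → E →L[ℝ] E, A a = A₀ ∧ A' a = A₁ ∧ (∀ t, HasDerivAt A (A' t) t) ∧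
      ∀ t, HasDerivAt A' (S t ∘L A t) t := by
  obtain ⟨y, hya, hy⟩ := exists_hasDerivAt_linear
    (L := fun t ↦ (ContinuousLinearMap.snd ℝ (E →L[ℝ] E) (E →L[ℝ] E)).prod
      ((ContinuousLinearMap.compL ℝ E E E (S t)) ∘L ContinuousLinearMap.fst ℝ _ _))
    (by
      refine (ContinuousLinearMap.prodₗᵢ ℝ).continuous.comp (continuous_const.prodMk ?_)
      exact (((ContinuousLinearMap.compL ℝ E E E).continuous.comp hS)).clm_comp continuous_const)
    a (A₀, A₁)
  exact ⟨fun t ↦ (y t).1, fun t ↦ (y t).2, by simp [hya], by simp [hya],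
    fun t ↦ (hy t).fst, fun t ↦ (hy t).snd⟩


theorem PiecewiseC1On.exists_finite_deriv_bound {F : Type*} [NormedAddCommGroup F]
    [NormedSpace ℝ F] {a b : ℝ} {V : ℝ → F} (hV : PiecewiseC1On a b V) :
    ∃ (Z : Set ℝ) (C : ℝ), Z.Finite ∧
      ∀ t ∈ Ioo a b \ Z, DifferentiableAt ℝ V t ∧ ‖deriv V t‖ ≤ C := by
  obtain ⟨-, k, s, h0, hk, hs, hC⟩ := hV
  have hbd : ∀ i : Fin k, ∃ C, ∀ t ∈ Icc (s i.castSucc) (s i.succ),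
      ‖derivWithin V (Icc (s i.castSucc) (s i.succ)) t‖ ≤ C := fun i ↦
    isCompact_Icc.exists_bound_of_continuousOn ((hC i).continuousOn_derivWithin
      (uniqueDiffOn_Icc (hs i.castSucc_lt_succ)) le_rfl)
  choose C hCb using hbd
  refine ⟨range s, ∑ i, |C i|, finite_range s, fun t ht ↦ ?_⟩
  obtain ⟨i, hi⟩ : ∃ i : Fin k, t ∈ Ioo (s i.castSucc) (s i.succ) := by
    by_contra! hcon
    have : ∀ i, s i < t := by
      intro i
      induction i using Fin.induction with
      | zero => exact h0 ▸ ht.1.1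
      | succ i ih =>
        by_contra! hle
        exact hcon i ⟨ih, hle.lt_of_ne fun h ↦ ht.2 ⟨_, h.symm⟩⟩
    exact absurd (this (Fin.last k)) (by rw [hk]; exact ht.1.2.not_gt)
  have hnhds : Icc (s i.castSucc) (s i.succ) ∈ 𝓝 t := Icc_mem_nhds hi.1 hi.2
  refine ⟨((hC i).differentiableOn one_ne_zero).differentiableAt hnhds, ?_⟩
  rw [← derivWithin_of_mem_nhds hnhds]
  exact ((hCb i t (Ioo_subset_Icc_self hi)).trans (le_abs_self _)).trans
    (Finset.single_le_sum (f := fun i ↦ |C i|) (fun _ _ ↦ abs_nonneg _) (Finset.mem_univ i))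

theorem ae_restrict_Ioc_of_forall_Ioo_diff {c d : ℝ} {Z : Set ℝ} (hZ : Z.Countable)
    {p : ℝ → Prop} (h : ∀ t ∈ Ioo c d \ Z, p t) : ∀ᵐ t ∂volume.restrict (Ioc c d), p t := by
  rw [← Measure.restrict_congr_set Ioo_ae_eq_Ioc, ae_restrict_iff' measurableSet_Ioo]
  filter_upwards [hZ.ae_notMem volume] with t ht hmem using h t ⟨hmem, ht⟩

theorem intervalIntegrable_of_bound_off_countable {F : Type*} [NormedAddCommGroup F]
    {f : ℝ → F} {c d C : ℝ} (hcd : c ≤ d) {Z : Set ℝ} (hZ : Z.Countable)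
    (hf : AEStronglyMeasurable f (volume.restrict (Ioc c d)))
    (hb : ∀ t ∈ Ioo c d \ Z, ‖f t‖ ≤ C) : IntervalIntegrable f volume c d := by
  rw [intervalIntegrable_iff_integrableOn_Ioc_of_le hcd]
  exact ⟨hf, .restrict_of_bounded (C := C) measure_Ioc_lt_top
    (ae_restrict_Ioc_of_forall_Ioo_diff hZ hb)⟩

theorem exists_norm_sub_taylor_le {G : Type*} [NormedAddCommGroup G] [NormedSpace ℝ G]
    {A A' A'' : ℝ → G} (hA : ∀ t, HasDerivAt A (A' t) t) (hA' : ∀ t, HasDerivAt A' (A'' t) t)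
    (hA'' : Continuous A'') (a : ℝ) :
    ∃ M, 0 ≤ M ∧ ∀ t ∈ Icc a (a + 1), ‖A t - A a - (t - a) • A' a‖ ≤ M * (t - a) ^ 2 := by
  obtain ⟨M, hM⟩ := (isCompact_Icc (a := a) (b := a + 1)).exists_bound_of_continuousOn
    hA''.continuousOn
  have hM0 : 0 ≤ M := (norm_nonneg _).trans (hM a ⟨le_rfl, by linarith⟩)
  refine ⟨M, hM0, fun t ht ↦ ?_⟩
  have h1 : ∀ s ∈ Icc a t, ‖A' s - A' a‖ ≤ M * (s - a) :=
    norm_image_sub_le_of_norm_deriv_le_segment' (fun s _ ↦ (hA' s).hasDerivWithinAt)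
      fun s hs ↦ hM s ⟨hs.1, hs.2.le.trans ht.2⟩
  have h2 := norm_image_sub_le_of_norm_deriv_le_segment' (a := a) (b := t)
    (f := fun s ↦ A s - (s - a) • A' a) (f' := fun s ↦ A' s - A' a) (C := M * (t - a))
    (fun s _ ↦ by
      have := (hA s).sub (((hasDerivAt_id s).sub_const a).smul_const (A' a))
      rw [one_smul] at this
      exact this.hasDerivWithinAt)
    (fun s hs ↦ (h1 s ⟨hs.1, hs.2.le⟩).trans (by have := hs.2; gcongr)) t ⟨ht.1, le_rfl⟩
  simp only [sub_self, zero_smul, sub_zero] at h2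
  calc _ = ‖A t - (t - a) • A' a - A a‖ := by congr 1; abel
    _ ≤ _ := h2
    _ = _ := by ring

/-- Lipschitz estimate at the left end point. -/
theorem norm_sub_left_le_of_deriv_bound {F : Type*} [NormedAddCommGroup F] [NormedSpace ℝ F]
    [CompleteSpace F] {Y Y' : ℝ → F} {a b C : ℝ} {Z : Set ℝ} (hZ : Z.Countable)
    (hYc : ContinuousOn Y (Icc a b)) (hYm : AEStronglyMeasurable Y' volume)
    (hd : ∀ t ∈ Ioo a b \ Z, HasDerivAt Y (Y' t) t) (hC : ∀ t ∈ Ioo a b \ Z, ‖Y' t‖ ≤ C)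
    {t : ℝ} (ht : t ∈ Icc a b) : ‖Y t - Y a‖ ≤ C * (t - a) := by
  have hsub : Ioo a t \ Z ⊆ Ioo a b \ Z := sdiff_subset_sdiff_left (Ioo_subset_Ioo_right ht.2)
  rw [← integral_eq_of_hasDerivAt_off_countable_of_le Y Y' ht.1 hZ
    (hYc.mono (Icc_subset_Icc_right ht.2)) (fun s hs ↦ hd s (hsub hs))
    (intervalIntegrable_of_bound_off_countable ht.1 hZ hYm.restrict fun s hs ↦ hC s (hsub hs)),
    ← abs_of_nonneg (sub_nonneg.2 ht.1)]
  refine intervalIntegral.norm_integral_le_of_norm_le_const_ae ?_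
  rw [uIoc_of_le ht.1, ← ae_restrict_iff' measurableSet_Ioc]
  exact ae_restrict_Ioc_of_forall_Ioo_diff hZ fun s hs ↦ hC s (hsub hs)

theorem exists_clm_inner_eq {E : Type*} [NormedAddCommGroup E] [InnerProductSpace ℝ E]
    [FiniteDimensional ℝ E] (σ : E →ₗ[ℝ] E →ₗ[ℝ] ℝ) :
    ∃ B : E →L[ℝ] E, ∀ x y, inner ℝ (B x) y = σ x y := by
  refine ⟨LinearMap.toContinuousLinearMap
    ((InnerProductSpace.toDual ℝ E).symm.toLinearEquiv.toLinearMap ∘ₗ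
      LinearMap.toContinuousLinearMap.toLinearMap ∘ₗ σ), fun x y ↦ ?_⟩
  simp [InnerProductSpace.toDual_symm_apply]

/-- Near the initial instant the Jacobi tensor degenerates at most linearly. -/
theorem eventually_mul_norm_le_of_jacobi_tensor {E : Type*} [NormedAddCommGroup E]
    [InnerProductSpace ℝ E] [FiniteDimensional ℝ E] (W : Submodule ℝ E) (B : E →L[ℝ] E)
    {A A' A'' : ℝ → E →L[ℝ] E} (hA : ∀ t, HasDerivAt A (A' t) t)
    (hA' : ∀ t, HasDerivAt A' (A'' t) t) (hA'' : Continuous A'') {a : ℝ}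
    (hAa : A a = W.starProjection)
    (hA'a : A' a = Wᗮ.starProjection - W.starProjection ∘L B ∘L W.starProjection) :
    ∀ᶠ t in 𝓝[>] a, ∀ ξ, (t - a) / 4 * ‖ξ‖ ≤ ‖A t ξ‖ := by
  obtain ⟨M, hM0, hM⟩ := exists_norm_sub_taylor_le hA hA' hA'' a
  have hlim : Tendsto (fun t : ℝ ↦ t - a) (𝓝[>] a) (𝓝 0) := by
    have : Tendsto (fun t : ℝ ↦ t - a) (𝓝 a) (𝓝 (a - a)) :=
      (continuous_sub_right a).tendsto a
    rw [sub_self] at this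
    exact this.mono_left nhdsWithin_le_nhds
  have e1 : ∀ᶠ t in 𝓝[>] a, (t - a) * (4 * M) < 1 :=
    (by simpa using hlim.mul_const (4 * M) : Tendsto _ _ (𝓝 (0 : ℝ))).eventually_lt_const one_pos
  have e2 : ∀ᶠ t in 𝓝[>] a, (t - a) * (2 * ‖B‖) < 1 :=
    (by simpa using hlim.mul_const (2 * ‖B‖) :
      Tendsto _ _ (𝓝 (0 : ℝ))).eventually_lt_const one_pos
  filter_upwards [e1, e2, hlim.eventually_lt_const (show (0 : ℝ) < 1 / 2 by norm_num),
    self_mem_nhdsWithin] with t h1 h2 h3 hat ξ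
  replace hat : 0 < t - a := sub_pos.2 hat
  have hT := hM t ⟨by linarith, by linarith⟩
  rw [hAa, hA'a] at hT
  set τ := t - a
  set P := W.starProjection
  set Q := Wᗮ.starProjection
  set z := P ξ + τ • (Q ξ - P (B (P ξ))) with hz
  have hPP : ∀ v, P (P v) = P v := fun v ↦
    Submodule.starProjection_eq_self_iff.2 (Submodule.starProjection_apply_mem W v)
  have hQQ : ∀ v, Q (Q v) = Q v := fun v ↦
    Submodule.starProjection_eq_self_iff.2 (Submodule.starProjection_apply_mem Wᗮ v)
  have hQe : ∀ v, Q v = v - P v := fun v ↦ Submodule.starProjection_orthogonal_val v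
  have hPQ : ∀ v, P (Q v) = 0 := fun v ↦ by rw [hQe, map_sub, hPP, sub_self]
  have hQP : ∀ v, Q (P v) = 0 := fun v ↦ by rw [hQe, hPP, sub_self]
  have hPz : P z = P ξ - τ • P (B (P ξ)) := by
    simp [hz, hPP, hPQ, sub_eq_add_neg]
  have hQz : Q z = τ • Q ξ := by simp [hz, hQQ, hQP]
  have hPn : ∀ v, ‖P v‖ ≤ ‖v‖ := Submodule.norm_starProjection_apply_le W
  have hQn : ∀ v, ‖Q v‖ ≤ ‖v‖ := Submodule.norm_starProjection_apply_le Wᗮ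
  have hz1 : τ * ‖Q ξ‖ ≤ ‖z‖ := by
    have := hQn z
    rwa [hQz, norm_smul, Real.norm_of_nonneg hat.le] at this
  have hz2 : τ * ‖P ξ‖ ≤ ‖z‖ := by
    have h4 : ‖P ξ‖ ≤ ‖P z‖ + τ * (‖B‖ * ‖P ξ‖) := by
      calc ‖P ξ‖ = ‖P z + τ • P (B (P ξ))‖ := by rw [hPz]; simp
        _ ≤ ‖P z‖ + ‖τ • P (B (P ξ))‖ := norm_add_le _ _
        _ ≤ _ := by
          rw [norm_smul, Real.norm_of_nonneg hat.le]
          gcongr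
          exact (hPn _).trans (B.le_opNorm _)
    nlinarith [hPn z, norm_nonneg (P ξ)]
  have hξ : ‖ξ‖ ≤ ‖P ξ‖ + ‖Q ξ‖ := by
    calc ‖ξ‖ = ‖P ξ + Q ξ‖ := by rw [hQe]; simp
      _ ≤ _ := norm_add_le _ _
  have hrem : ‖A t ξ - z‖ ≤ M * τ ^ 2 * ‖ξ‖ := by
    have := ContinuousLinearMap.le_of_opNorm_le _ hT ξ
    convert! this using 2
    simp [hz, sub_sub]
  have htri : ‖z‖ ≤ ‖A t ξ‖ + ‖A t ξ - z‖ := by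
    rw [norm_sub_rev]
    calc ‖z‖ = ‖A t ξ + (z - A t ξ)‖ := by congr 1; abel
      _ ≤ _ := norm_add_le _ _
  nlinarith [mul_nonneg hat.le (norm_nonneg ξ)]

theorem hasDerivAt_ringInverse_comp {R : Type*} [NormedRing R] [NormedAlgebra ℝ R]
    [CompleteSpace R] {A : ℝ → R} {A' : R} {t : ℝ} (hA : HasDerivAt A A' t)
    (hu : IsUnit (A t)) :
    HasDerivAt (fun s ↦ Ring.inverse (A s))
      (-(Ring.inverse (A t) * A' * Ring.inverse (A t))) t := by
  obtain ⟨u, hu⟩ := hu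
  have h := hasFDerivAt_ringInverse (𝕜 := ℝ) u
  rw [hu] at h
  have := h.comp_hasDerivAt t hA
  simpa [← hu, Ring.inverse_unit] using! this

section JacobiTensor

variable {E : Type*} [NormedAddCommGroup E] [InnerProductSpace ℝ E]
  {S A A' : ℝ → E →L[ℝ] E} {a b C : ℝ} {Y Y' : ℝ → E} {Z : Set ℝ}

/-- The Wronskian of two Jacobi fields is constant. -/
theorem wronskian_eq (hSsa : ∀ t x y, inner ℝ (S t x) y = inner ℝ x (S t y))
    (hA : ∀ t, HasDerivAt A (A' t) t) (hA' : ∀ t, HasDerivAt A' (S t ∘L A t) t) (u v : E)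
    (t s : ℝ) :
    inner ℝ (A' t u) (A t v) - inner ℝ (A t u) (A' t v) =
      inner ℝ (A' s u) (A s v) - inner ℝ (A s u) (A' s v) := by
  have hd : ∀ r w, HasDerivAt (fun t ↦ A t w) (A' r w) r := fun r w ↦ by
    simpa using (hA r).clm_apply (hasDerivAt_const r w)
  have hd' : ∀ r w, HasDerivAt (fun t ↦ A' t w) (S r (A r w)) r := fun r w ↦ by
    simpa using (hA' r).clm_apply (hasDerivAt_const r w)
  have h : ∀ r, HasDerivAt
      (fun t ↦ inner ℝ (A' t u) (A t v) - inner ℝ (A t u) (A' t v)) 0 r := fun r ↦ by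
    convert! ((hd' r u).inner ℝ (hd r v)).sub ((hd r u).inner ℝ (hd' r v)) using 1
    rw [hSsa]
    ring
  exact is_const_of_deriv_eq_zero (fun r ↦ (h r).differentiableAt) (fun r ↦ (h r).deriv) t s

/-- The boundary term of the Riccati transformation converges at the initial instant. -/
theorem tendsto_inner_riccati [CompleteSpace E]
    (hA : ∀ t, HasDerivAt A (A' t) t) (hA'c : Continuous A')
    (hW : ∀ t u v, inner ℝ (A' t u) (A t v) = inner ℝ (A t u) (A' t v))
    (hlow : ∀ᶠ t in 𝓝[>] a, ∀ ξ, (t - a) / 4 * ‖ξ‖ ≤ ‖A t ξ‖)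
    {x : ℝ → E} (hx : ∀ᶠ t in 𝓝[>] a, A t (x t) = Y t)
    (hYlip : ∀ᶠ t in 𝓝[>] a, ‖Y t - Y a‖ ≤ C * (t - a)) (hYa : A a (Y a) = Y a) :
    Tendsto (fun t ↦ inner ℝ (A' t (x t)) (Y t)) (𝓝[>] a)
      (𝓝 (inner ℝ (A' a (Y a)) (Y a))) := by
  set y := Y a
  have hsub : Tendsto (fun t : ℝ ↦ t - a) (𝓝[>] a) (𝓝 0) := by
    have : Tendsto (fun t : ℝ ↦ t - a) (𝓝 a) (𝓝 (a - a)) := (continuous_sub_right a).tendsto a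
    rw [sub_self] at this
    exact this.mono_left nhdsWithin_le_nhds
  have hY : Tendsto Y (𝓝[>] a) (𝓝 y) := by
    rw [tendsto_iff_norm_sub_tendsto_zero]
    exact squeeze_zero' (.of_forall fun _ ↦ norm_nonneg _) hYlip
      (by simpa using hsub.const_mul C)
  have hd : HasDerivAt (fun t ↦ A t y) (A' a y) a := by
    simpa using (hA a).clm_apply (hasDerivAt_const a y)
  obtain ⟨D, hD⟩ := hd.isBigO_sub.bound
  have hA't : Tendsto A' (𝓝[>] a) (𝓝 (A' a)) := (hA'c.tendsto a).mono_left nhdsWithin_le_nhds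
  have hAy : Tendsto (fun t ↦ A t y) (𝓝[>] a) (𝓝 y) := by
    have := hd.continuousAt.tendsto
    rw [hYa] at this
    exact this.mono_left nhdsWithin_le_nhds
  have hR : Tendsto (fun t ↦ Y t - A t y) (𝓝[>] a) (𝓝 0) := by simpa using hY.sub hAy
  have hA'y : Tendsto (fun t ↦ A' t y) (𝓝[>] a) (𝓝 (A' a y)) :=
    ((hA'c.clm_apply continuous_const).tendsto a).mono_left nhdsWithin_le_nhds
  have hrem : Tendsto (fun t ↦ inner ℝ (A' t (x t - y)) (Y t - A t y)) (𝓝[>] a) (𝓝 0) := by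
    have hlim : Tendsto (fun t ↦ ‖A' t‖ * (4 * (C + D)) * ‖Y t - A t y‖) (𝓝[>] a) (𝓝 0) := by
      simpa using (hA't.norm.mul_const (4 * (C + D))).mul hR.norm
    refine squeeze_zero_norm' ?_ hlim
    filter_upwards [hlow, hx, hYlip, nhdsWithin_le_nhds hD, self_mem_nhdsWithin]
      with t h1 h2 h3 h4 h5
    have hpos : 0 < t - a := sub_pos.2 h5
    rw [hYa, Real.norm_of_nonneg hpos.le] at h4
    have h6 : ‖Y t - A t y‖ ≤ (C + D) * (t - a) := by
      calc ‖Y t - A t y‖ = ‖(Y t - y) - (A t y - y)‖ := by congr 1; abel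
        _ ≤ ‖Y t - y‖ + ‖A t y - y‖ := norm_sub_le _ _
        _ ≤ _ := by linarith
    have h7 : ‖x t - y‖ ≤ 4 * (C + D) := by
      have h8 := h1 (x t - y)
      rw [map_sub, h2] at h8
      have : (t - a) * ‖x t - y‖ ≤ (t - a) * (4 * (C + D)) := by linarith
      exact le_of_mul_le_mul_left this hpos
    calc _ ≤ ‖A' t (x t - y)‖ * ‖Y t - A t y‖ := norm_inner_le_norm _ _
      _ ≤ _ := by
        gcongr
        exact ((A' t).le_opNorm _).trans (by gcongr)
  have hmain : Tendsto (fun t ↦ inner ℝ (A' t y) (Y t) + inner ℝ (Y t - A t y) (A' t y) +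
      inner ℝ (A' t (x t - y)) (Y t - A t y)) (𝓝[>] a) (𝓝 (inner ℝ (A' a y) y)) := by
    simpa using ((hA'y.inner hY).add (hR.inner hA'y)).add hrem
  refine hmain.congr' ?_
  filter_upwards [hx] with t ht
  have : inner ℝ (Y t - A t y) (A' t y) = inner ℝ (A' t (x t - y)) (A t y) := by
    rw [hW, map_sub, ht]
  rw [this, inner_sub_right, map_sub, inner_sub_left, inner_sub_left]
  ring

/-- The Riccati lower bound for the index form of a field vanishing at the final instant. -/
theorem integral_sq_norm_riccati_le [CompleteSpace E]
    (hSc : Continuous S)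
    (hA : ∀ t, HasDerivAt A (A' t) t) (hA' : ∀ t, HasDerivAt A' (S t ∘L A t) t)
    (hW : ∀ t u v, inner ℝ (A' t u) (A t v) = inner ℝ (A t u) (A' t v))
    (hlow : ∀ᶠ t in 𝓝[>] a, ∀ ξ, (t - a) / 4 * ‖ξ‖ ≤ ‖A t ξ‖)
    (hu : ∀ t ∈ Ioc a b, IsUnit (A t))
    (hZ : Z.Countable) (hYc : ContinuousOn Y (Icc a b)) (hYm : AEStronglyMeasurable Y' volume)
    (hd : ∀ t ∈ Ioo a b \ Z, HasDerivAt Y (Y' t) t) (hC : ∀ t ∈ Ioo a b \ Z, ‖Y' t‖ ≤ C)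
    (hYa : A a (Y a) = Y a) (hYb : Y b = 0) {d : ℝ} (hdab : d ∈ Ioo a b) :
    IntervalIntegrable (fun t ↦ ‖Y' t - A' t (Ring.inverse (A t) (Y t))‖ ^ 2) volume d b ∧
    ∫ t in d..b, ‖Y' t - A' t (Ring.inverse (A t) (Y t))‖ ^ 2 ≤
      (∫ t in a..b, (inner ℝ (Y' t) (Y' t) + inner ℝ (S t (Y t)) (Y t))) +
        inner ℝ (A' a (Y a)) (Y a) := by
  set x : ℝ → E := fun t ↦ Ring.inverse (A t) (Y t)
  set q : ℝ → ℝ := fun t ↦ ‖Y' t - A' t (x t)‖ ^ 2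
  set e : ℝ → ℝ := fun t ↦ inner ℝ (Y' t) (Y' t) + inner ℝ (S t (Y t)) (Y t)
  have hab : a < b := hdab.1.trans hdab.2
  have hA'c : Continuous A' := continuous_iff_continuousAt.2 fun t ↦ (hA' t).continuousAt
  have hAx : ∀ t ∈ Ioc a b, A t (x t) = Y t := fun t ht ↦ by
    have := Ring.mul_inverse_cancel _ (hu t ht)
    exact congrArg (fun T : E →L[ℝ] E ↦ T (Y t)) this
  have hxc : ContinuousOn x (Ioc a b) := by
    refine ContinuousOn.clm_apply (fun t ht ↦ ?_) (hYc.mono Ioc_subset_Icc_self)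
    exact (hasDerivAt_ringInverse_comp (hA t) (hu t ht)).continuousAt.continuousWithinAt
  have hhc : ContinuousOn (fun t ↦ A' t (x t)) (Ioc a b) := hA'c.continuousOn.clm_apply hxc
  have hSY : ContinuousOn (fun t ↦ inner ℝ (S t (Y t)) (Y t)) (Icc a b) :=
    (hSc.continuousOn.clm_apply hYc).inner hYc
  have hei : IntervalIntegrable e volume a b := by
    refine IntervalIntegrable.add ?_ (hSY.intervalIntegrable_of_Icc hab.le)
    refine intervalIntegrable_of_bound_off_countable (C := C * C) hab.le hZ
      (hYm.inner hYm).restrict fun t ht ↦ (norm_inner_le_norm _ _).trans ?_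
    have := hC t ht
    have := (norm_nonneg _).trans this
    gcongr
  have hsub : ∀ {c}, c ∈ Ioo a b → Icc c b ⊆ Ioc a b := fun hc t ht ↦
    ⟨hc.1.trans_le ht.1, ht.2⟩
  have hsubo : ∀ {c}, c ∈ Ioo a b → Ioo c b \ Z ⊆ Ioo a b \ Z := fun hc ↦
    sdiff_subset_sdiff_left (Ioo_subset_Ioo_left hc.1.le)
  have hqi : ∀ c ∈ Ioo a b, IntervalIntegrable q volume c b := by
    intro c hc
    have hcont := hhc.mono (hsub hc)
    obtain ⟨D, hD⟩ := isCompact_Icc.exists_bound_of_continuousOn hcont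
    refine intervalIntegrable_of_bound_off_countable (C := (C + D) ^ 2) hc.2.le hZ
      ((hYm.restrict.sub ((hcont.mono Ioc_subset_Icc_self).aestronglyMeasurable
        measurableSet_Ioc)).norm.pow 2) fun t ht ↦ ?_
    have h1 := hC t (hsubo hc ht)
    have h2 := hD t (Ioo_subset_Icc_self ht.1)
    rw [norm_pow, norm_norm]
    gcongr
    exact (norm_sub_le _ _).trans (add_le_add h1 h2)
  have hparts : ∀ c ∈ Ioo a b, ∫ t in c..b, q t =
      (∫ t in c..b, e t) + inner ℝ (A' c (x c)) (Y c) := by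
    intro c hc
    have heic : IntervalIntegrable e volume c b :=
      hei.mono_set (by
        rw [uIcc_of_le hc.2.le, uIcc_of_le hab.le]
        exact Icc_subset_Icc_left hc.1.le)
    have hftc := integral_eq_of_hasDerivAt_off_countable_of_le
      (fun t ↦ inner ℝ (A' t (x t)) (Y t)) (fun t ↦ e t - q t) hc.2.le hZ
      ((hhc.mono (hsub hc)).inner (hYc.mono (Icc_subset_Icc_left hc.1.le))) ?_
      (heic.sub (hqi c hc))
    · rw [intervalIntegral.integral_sub heic (hqi c hc)] at hftc
      simp only [hYb, inner_zero_right] at hftc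
      linarith
    intro t ht
    have ht' : t ∈ Ioc a b := hsub hc (Ioo_subset_Icc_self ht.1)
    have hY := hd t (hsubo hc ht)
    have hx : HasDerivAt x _ t := (hasDerivAt_ringInverse_comp (hA t) (hu t ht')).clm_apply hY
    set x' := -(Ring.inverse (A t) * A' t * Ring.inverse (A t)) (Y t) +
      Ring.inverse (A t) (Y' t) with hx'
    have hAx' : A t x' = Y' t - A' t (x t) := by
      have h1 : ∀ v, A t (Ring.inverse (A t) v) = v := fun v ↦
        congrArg (fun T : E →L[ℝ] E ↦ T v) (Ring.mul_inverse_cancel _ (hu t ht'))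
      rw [hx']
      simp only [map_add, map_neg, mul_apply_eq_comp, h1]
      abel
    convert! (((hA' t).clm_apply hx).inner ℝ hY) using 1
    simp only [e, q, ContinuousLinearMap.comp_apply, hAx t ht']
    change _ = inner ℝ (A' t (x t)) (Y' t) + inner ℝ (S t (Y t) + A' t x') (Y t)
    have h2 : inner ℝ (A' t x') (Y t) = inner ℝ (Y' t - A' t (x t)) (A' t (x t)) := by
      rw [← hAx', ← hW, hAx t ht']
    rw [inner_add_left, h2, ← real_inner_self_eq_norm_sq]
    simp only [inner_sub_left, inner_sub_right, real_inner_comm (A' t (x t)) (Y' t)]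
    ring
  refine ⟨hqi d hdab, ?_⟩
  have hmemd : ∀ᶠ c in 𝓝[>] a, c ∈ Ioo a d := Ioo_mem_nhdsGT hdab.1
  have hlim1 : Tendsto (fun c ↦ ∫ t in c..b, e t) (𝓝[>] a) (𝓝 (∫ t in a..b, e t)) := by
    have hcont : ContinuousOn (fun c ↦ ∫ t in c..b, e t) (uIcc a b) :=
      intervalIntegral.continuousOn_primitive_interval_left
        (by rwa [intervalIntegrable_iff'] at hei)
    have := hcont a left_mem_uIcc
    refine this.tendsto.mono_left (nhdsWithin_le_iff.2 ?_)
    rw [uIcc_of_le hab.le]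
    exact Icc_mem_nhdsGT hab
  have hlim2 := tendsto_inner_riccati (Y := Y) (x := x) (C := C) hA hA'c hW hlow
    (by filter_upwards [hmemd] with t ht using hAx t ⟨ht.1, (ht.2.trans hdab.2).le⟩)
    (by
      filter_upwards [hmemd] with t ht using norm_sub_left_le_of_deriv_bound hZ hYc hYm hd hC
        ⟨ht.1.le, (ht.2.trans hdab.2).le⟩) hYa
  refine ge_of_tendsto (hlim1.add hlim2) ?_
  filter_upwards [hmemd] with c hc
  have hcab : c ∈ Ioo a b := ⟨hc.1, hc.2.trans hdab.2⟩
  rw [← hparts c hcab]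
  exact intervalIntegral.integral_mono_interval hc.2.le hdab.2.le le_rfl
    (.of_forall fun t ↦ sq_nonneg _) (hqi c hcab)

/-- A field vanishing at the final instant and satisfying the Riccati equation almost
everywhere vanishes. -/
theorem eq_zero_of_ae_riccati [CompleteSpace E]
    (hA : ∀ t, HasDerivAt A (A' t) t) (hu : ∀ t ∈ Ioc a b, IsUnit (A t))
    (hZ : Z.Countable) (hYc : ContinuousOn Y (Icc a b))
    (hd : ∀ t ∈ Ioo a b \ Z, HasDerivAt Y (Y' t) t) (hYb : Y b = 0) {d : ℝ}
    (hdab : d ∈ Ioo a b)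
    (hae : ∀ᵐ t ∂volume.restrict (Ioc d b), Y' t - A' t (Ring.inverse (A t) (Y t)) = 0) :
    Y d = 0 := by
  set x : ℝ → E := fun t ↦ Ring.inverse (A t) (Y t)
  set x' : ℝ → E := fun t ↦ Ring.inverse (A t) (Y' t - A' t (x t))
  have hx'0 : x' =ᵐ[volume.restrict (Ioc d b)] 0 := by
    filter_upwards [hae] with t ht
    simp only [x', x, ht, map_zero, Pi.zero_apply]
  have hsub : Icc d b ⊆ Ioc a b := fun t ht ↦ ⟨hdab.1.trans_le ht.1, ht.2⟩
  have hxc : ContinuousOn x (Icc d b) := by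
    refine ContinuousOn.clm_apply (fun t ht ↦ ?_) (hYc.mono (Icc_subset_Icc_left hdab.1.le))
    exact (hasDerivAt_ringInverse_comp (hA t) (hu t (hsub ht))).continuousAt.continuousWithinAt
  have hftc := integral_eq_of_hasDerivAt_off_countable_of_le x x' hdab.2.le hZ hxc
    (fun t ht ↦ by
      have ht' := hsub (Ioo_subset_Icc_self ht.1)
      convert! (hasDerivAt_ringInverse_comp (hA t) (hu t ht')).clm_apply
        (hd t ⟨⟨hdab.1.trans ht.1.1, ht.1.2⟩, ht.2⟩) using 1
      simp only [x', x, map_sub, mul_apply_eq_comp, neg_apply]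
      abel)
    (by
      rw [intervalIntegrable_iff_integrableOn_Ioc_of_le hdab.2.le]
      exact (integrable_zero _ _ _).congr hx'0.symm)
  rw [intervalIntegral.integral_of_le hdab.2.le, integral_congr_ae hx'0] at hftc
  have hxd : x d = 0 := by simpa [x, hYb] using hftc
  have hAx := congrArg (fun T : E →L[ℝ] E ↦ T (Y d))
    (Ring.mul_inverse_cancel _ (hu d ⟨hdab.1, hdab.2.le⟩))
  change A d (x d) = Y d at hAx
  rw [← hAx, hxd, map_zero]

end JacobiTensor

/-- If there are no `P`-focal instants in `(a, b]`, then for every `P`-Jacobi field `J` and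
every piecewise `C¹` map `V` with `V a ∈ W` and `V b = J b` one has
`I^P(V, V) ≥ I^P(J, J)`, with equality if and only if `V = J` on `[a, b]`. -/
theorem indexForm_jacobi_minimizes {n : ℕ}
    (S : ℝ → EuclideanSpace ℝ (Fin n) →L[ℝ] EuclideanSpace ℝ (Fin n))
    (hS : ContDiff ℝ (⊤ : ℕ∞) S)
    (hSsa : ∀ (t : ℝ) (x y : EuclideanSpace ℝ (Fin n)),
      (inner ℝ (S t x) y : ℝ) = inner ℝ x (S t y))
    (σ : EuclideanSpace ℝ (Fin n) →ₗ[ℝ] EuclideanSpace ℝ (Fin n) →ₗ[ℝ] ℝ)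
    (hσ : ∀ x y, σ x y = σ y x)
    (W : Submodule ℝ (EuclideanSpace ℝ (Fin n)))
    (a b : ℝ) (hab : a < b)
    (hfocal : ∀ t₀ ∈ Ioc a b, ∀ J J' : ℝ → EuclideanSpace ℝ (Fin n),
      IsPJacobiPair S σ W a J J' → J t₀ = 0 → ∀ s, J s = 0)
    (J J' : ℝ → EuclideanSpace ℝ (Fin n)) (hJ : IsPJacobiPair S σ W a J J')
    (V : ℝ → EuclideanSpace ℝ (Fin n)) (hV : PiecewiseC1On a b V)
    (hVa : V a ∈ W) (hVb : V b = J b) :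
    indexForm S σ a b J J ≤ indexForm S σ a b V V ∧
      (indexForm S σ a b V V = indexForm S σ a b J J ↔ ∀ t ∈ Icc a b, V t = J t) := by
  obtain ⟨B, hB⟩ := exists_clm_inner_eq σ
  obtain ⟨A, A', hAa, hA'a, hA, hA'⟩ := exists_jacobi_tensor hS.continuous a W.starProjection
    (Wᗮ.starProjection - W.starProjection ∘L B ∘L W.starProjection)
  have hAc : Continuous A := continuous_iff_continuousAt.2 fun t ↦ (hA t).continuousAt
  have hinit : ∀ x, ∀ w ∈ W, inner ℝ (A' a x) w = -σ (A a x) w := by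
    intro x w hw
    have hPw : W.starProjection w = w := Submodule.starProjection_eq_self_iff.2 hw
    simp [hAa, hA'a, inner_sub_left, Submodule.inner_starProjection_left_eq_right, hPw, hB]
  have hAaW : ∀ x, A a x ∈ W := fun x ↦ hAa ▸ Submodule.starProjection_apply_mem W x
  have hW : ∀ t u v, inner ℝ (A' t u) (A t v) = inner ℝ (A t u) (A' t v) := by
    intro t u v
    have h := wronskian_eq hSsa hA hA' u v t a
    rw [hinit u _ (hAaW v), real_inner_comm (A' a v), hinit v _ (hAaW u), hσ (A a v), sub_self] at h
    exact sub_eq_zero.1 h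
  have hlow := eventually_mul_norm_le_of_jacobi_tensor W B hA hA'
    (hS.continuous.clm_comp hAc) hAa hA'a
  have hu : ∀ t ∈ Ioc a b, IsUnit (A t) := by
    intro t ht
    have hinj : Function.Injective (A t) := by
      refine (injective_iff_map_eq_zero _).2 fun ξ hξ ↦ ?_
      have hzero := hfocal t ht (fun s ↦ A s ξ) (fun s ↦ A' s ξ)
        ⟨⟨fun s ↦ by simpa using (hA s).clm_apply (hasDerivAt_const s ξ),
          fun s ↦ by simpa using (hA' s).clm_apply (hasDerivAt_const s ξ)⟩, hAaW ξ,
          fun w hw ↦ by rw [hinit ξ w hw]; ring⟩ hξ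
      obtain ⟨s, hs, has⟩ := (hlow.and self_mem_nhdsWithin).exists
      have hs := hs ξ
      rw [hzero s, norm_zero] at hs
      have has : 0 < s - a := sub_pos.2 has
      exact norm_le_zero_iff.1 (nonpos_of_mul_nonpos_right hs (by positivity))
    exact ContinuousLinearMap.isUnit_iff_bijective.2
      ⟨hinj, LinearMap.injective_iff_surjective (f := (A t).toLinearMap).1 hinj⟩
  obtain ⟨Z, C, hZ, hVd⟩ := hV.exists_finite_deriv_bound
  obtain ⟨⟨hJd, hJd'⟩, hJaW, hJa⟩ := hJ
  have hJc : Continuous J := continuous_iff_continuousAt.2 fun t ↦ (hJd t).continuousAt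
  have hJ'c : Continuous J' := continuous_iff_continuousAt.2 fun t ↦ (hJd' t).continuousAt
  have hJderiv : deriv J = J' := funext fun t ↦ (hJd t).deriv
  obtain ⟨D, hD⟩ := (isCompact_Icc (a := a) (b := b)).exists_bound_of_continuousOn
    hJ'c.continuousOn
  set Y : ℝ → EuclideanSpace ℝ (Fin n) := fun t ↦ V t - J t with hYdef
  set Y' : ℝ → EuclideanSpace ℝ (Fin n) := fun t ↦ deriv V t - J' t with hY'def
  have hYc : ContinuousOn Y (Icc a b) := hV.1.sub hJc.continuousOn
  have hVm : AEStronglyMeasurable (deriv V) volume := aestronglyMeasurable_deriv V _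
  have hYm : AEStronglyMeasurable Y' volume := hVm.sub hJ'c.aestronglyMeasurable
  have hYd : ∀ t ∈ Ioo a b \ Z, HasDerivAt Y (Y' t) t := fun t ht ↦
    (hVd t ht).1.hasDerivAt.sub (hJd t)
  have hYC : ∀ t ∈ Ioo a b \ Z, ‖Y' t‖ ≤ C + D := fun t ht ↦
    (norm_sub_le _ _).trans (add_le_add (hVd t ht).2 (hD t (Ioo_subset_Icc_self ht.1)))
  have hYa : Y a ∈ W := W.sub_mem hVa hJaW
  have hYb : Y b = 0 := sub_eq_zero.2 hVb
  have hAYa : A a (Y a) = Y a := by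
    rw [hAa]
    exact Submodule.starProjection_eq_self_iff.2 hYa
  have hSY : ContinuousOn (fun t ↦ inner ℝ (S t (Y t)) (Y t)) (Icc a b) :=
    (hS.continuous.continuousOn.clm_apply hYc).inner hYc
  have hEY : IntervalIntegrable
      (fun t ↦ inner ℝ (Y' t) (Y' t) + inner ℝ (S t (Y t)) (Y t)) volume a b := by
    refine IntervalIntegrable.add ?_ (hSY.intervalIntegrable_of_Icc hab.le)
    refine intervalIntegrable_of_bound_off_countable (C := (C + D) * (C + D)) hab.le
      hZ.countable (hYm.inner hYm).restrict fun t ht ↦ (norm_inner_le_norm _ _).trans ?_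
    have h := hYC t ht
    have := (norm_nonneg _).trans h
    gcongr
  have hEJ : IntervalIntegrable
      (fun t ↦ inner ℝ (J' t) (J' t) + inner ℝ (S t (J t)) (J t)) volume a b :=
    Continuous.intervalIntegrable
      ((hJ'c.inner hJ'c).add ((hS.continuous.clm_apply hJc).inner hJc)) a b
  have hEX : IntervalIntegrable
      (fun t ↦ inner ℝ (J' t) (Y' t) + inner ℝ (S t (J t)) (Y t)) volume a b := by
    refine IntervalIntegrable.add ?_ (ContinuousOn.intervalIntegrable_of_Icc hab.le
      ((hS.continuous.clm_apply hJc).continuousOn.inner hYc))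
    refine intervalIntegrable_of_bound_off_countable (C := D * (C + D)) hab.le
      hZ.countable (hJ'c.aestronglyMeasurable.inner hYm).restrict
      fun t ht ↦ (norm_inner_le_norm _ _).trans ?_
    have h := hYC t ht
    have h' := hD t (Ioo_subset_Icc_self ht.1)
    have := (norm_nonneg _).trans h'
    gcongr
  have hcross : ∫ t in a..b, (inner ℝ (J' t) (Y' t) + inner ℝ (S t (J t)) (Y t)) =
      σ (J a) (Y a) := by
    rw [integral_eq_of_hasDerivAt_off_countable_of_le (fun t ↦ inner ℝ (J' t) (Y t)) _ hab.le
      hZ.countable (hJ'c.continuousOn.inner hYc)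
      (fun t ht ↦ (hJd' t).inner ℝ (hYd t ht)) hEX, hYb, inner_zero_right]
    linarith [hJa _ hYa]
  have hdecomp : indexForm S σ a b V V = indexForm S σ a b J J +
      ((∫ t in a..b, (inner ℝ (Y' t) (Y' t) + inner ℝ (S t (Y t)) (Y t))) +
        inner ℝ (A' a (Y a)) (Y a)) := by
    have hpt : ∀ t, (inner ℝ (deriv V t) (deriv V t) : ℝ) + inner ℝ (S t (V t)) (V t) =
        (inner ℝ (J' t) (J' t) + inner ℝ (S t (J t)) (J t)) +
          2 * (inner ℝ (J' t) (Y' t) + inner ℝ (S t (J t)) (Y t)) +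
          (inner ℝ (Y' t) (Y' t) + inner ℝ (S t (Y t)) (Y t)) := by
      intro t
      have hV' : deriv V t = J' t + Y' t := by simp [hY'def]
      have hVt : V t = J t + Y t := by simp [hYdef]
      have hsymm : (inner ℝ (S t (Y t)) (J t) : ℝ) = inner ℝ (S t (J t)) (Y t) := by
        rw [hSsa, real_inner_comm]
      rw [hV', hVt, map_add]
      simp only [inner_add_left, inner_add_right, hsymm, real_inner_comm (J' t) (Y' t)]
      ring
    have hVa' : V a = J a + Y a := by simp [hYdef]
    rw [hinit _ _ hYa, hAYa]
    unfold indexForm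
    simp only [hpt, hJderiv]
    rw [intervalIntegral.integral_add (hEJ.add (hEX.const_mul 2)) hEY,
      intervalIntegral.integral_add hEJ (hEX.const_mul 2), intervalIntegral.integral_const_mul,
      hcross, hVa']
    simp only [map_add, LinearMap.add_apply, hσ (Y a) (J a)]
    ring
  have hbound := fun d hd ↦ integral_sq_norm_riccati_le hS.continuous hA hA' hW hlow hu
    hZ.countable hYc hYm hYd hYC hAYa hYb (d := d) hd
  have hq0 : ∀ d ∈ Ioo a b,
      0 ≤ ∫ t in d..b, ‖Y' t - A' t (Ring.inverse (A t) (Y t))‖ ^ 2 := fun d hd ↦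
    intervalIntegral.integral_nonneg hd.2.le fun t _ ↦ sq_nonneg _
  refine ⟨?_, fun heq ↦ ?_, fun hVJ ↦ ?_⟩
  · obtain ⟨d, hd⟩ := nonempty_Ioo.2 hab
    linarith [hq0 d hd, (hbound d hd).2]
  · have hYzero : EqOn Y 0 (Ioo a b) := by
      intro d hd
      refine eq_zero_of_ae_riccati hA hu hZ.countable hYc hYd hYb hd ?_
      have hint : ∫ t in d..b, ‖Y' t - A' t (Ring.inverse (A t) (Y t))‖ ^ 2 = 0 :=
        le_antisymm (by linarith [(hbound d hd).2]) (hq0 d hd)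
      rw [intervalIntegral.integral_eq_zero_iff_of_le_of_nonneg_ae hd.2.le
        (.of_forall fun t ↦ sq_nonneg _) (hbound d hd).1] at hint
      filter_upwards [hint] with t ht
      simpa using ht
    have hclos : EqOn Y 0 (Icc a b) := by
      refine hYzero.of_subset_closure hYc continuousOn_const Ioo_subset_Icc_self ?_
      rw [closure_Ioo hab.ne]
    exact fun t ht ↦ sub_eq_zero.1 (hclos ht)
  · unfold indexForm
    rw [hVJ a (left_mem_Icc.2 hab.le), intervalIntegral.integral_of_le hab.le,
      intervalIntegral.integral_of_le hab.le]
    congr 1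
    refine integral_congr_ae (ae_restrict_Ioc_of_forall_Ioo_diff countable_empty fun t ht ↦ ?_)
    have hev : V =ᶠ[𝓝 t] J := by
      filter_upwards [Icc_mem_nhds ht.1.1 ht.1.2] with s hs using hVJ s hs
    simp only [hev.deriv_eq, hev.eq_of_nhds]
end

section
/- The kernel of the restriction of I^P to H^P, i.e. the set {V ∈ H^P : I^P(V, U) = 0 for all U ∈ H^P}, is exactly the set of restrictions to [a,b] of P-Jacobi fields J with J(b) = 0. -/
open Set

/-- The space `H^P` of piecewise `C¹` maps `V` on `[a, b]` with `V a ∈ W` and `V b = 0`. -/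
def HP {n : ℕ} (W : Submodule ℝ (EuclideanSpace ℝ (Fin n))) (a b : ℝ) :
    Set (ℝ → EuclideanSpace ℝ (Fin n)) :=
  {V | PiecewiseC1On a b V ∧ V a ∈ W ∧ V b = 0}

section LinearODE

variable {X : Type*} [NormedAddCommGroup X] [NormedSpace ℝ X]

/-- A function vanishing at `t₀` whose derivative is `O(|t - t₀| ^ k)` is
`O(|t - t₀| ^ (k + 1))`, with explicit constants. -/
lemma norm_le_mul_abs_sub_pow_succ_of_hasDerivAt {f f' : ℝ → X} {t₀ C T : ℝ} {k : ℕ}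
    (hf : ∀ t, HasDerivAt f (f' t) t) (h₀ : f t₀ = 0)
    (hf' : ∀ t, |t - t₀| ≤ T → ‖f' t‖ ≤ C * |t - t₀| ^ k) {t : ℝ} (ht : |t - t₀| ≤ T) :
    ‖f t‖ ≤ C * (|t - t₀| ^ (k + 1) / (k + 1)) := by
  have key : ∀ g g' : ℝ → X, (∀ s, HasDerivAt g (g' s) s) → g 0 = 0 →
      (∀ s, 0 ≤ s → s ≤ T → ‖g' s‖ ≤ C * s ^ k) → ∀ s, 0 ≤ s → s ≤ T →
        ‖g s‖ ≤ C * (s ^ (k + 1) / (k + 1)) := by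
    intro g g' hg hg0 hg' s hs hsT
    refine image_norm_le_of_norm_deriv_right_le_deriv_boundary (a := 0) (b := T)
      (f' := g') (B := fun s => C * (s ^ (k + 1) / (k + 1))) (B' := fun s => C * s ^ k)
      (fun x _ => (hg x).continuousAt.continuousWithinAt) (fun x _ => (hg x).hasDerivWithinAt)
      (by simp [hg0]) (fun x => ?_) (fun x hx => hg' x hx.1 hx.2.le) ⟨hs, hsT⟩
    have hk : (k + 1 : ℝ) ≠ 0 := by positivity
    have := ((hasDerivAt_pow (k + 1) x).div_const (k + 1 : ℝ)).const_mul C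
    rwa [Nat.add_sub_cancel, Nat.cast_succ, mul_div_cancel_left₀ _ hk] at this
  rcases le_total t₀ t with h | h
  · rw [abs_of_nonneg (sub_nonneg.2 h)] at ht ⊢
    have := key (fun s => f (t₀ + s)) (fun s => f' (t₀ + s))
      (fun s => (hf (t₀ + s)).comp_const_add t₀ s) (by simpa using h₀)
      (fun s hs hsT => by
        simpa [abs_of_nonneg hs] using hf' (t₀ + s) (by simpa [abs_of_nonneg hs] using hsT))
      (t - t₀) (sub_nonneg.2 h) ht
    simpa using this
  · rw [abs_of_nonpos (sub_nonpos.2 h)] at ht ⊢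
    have := key (fun s => f (t₀ - s)) (fun s => -f' (t₀ - s))
      (fun s => (hf (t₀ - s)).comp_const_sub t₀ s) (by simpa using h₀)
      (fun s hs hsT => by
        simpa [abs_of_nonneg hs] using hf' (t₀ - s) (by simpa [abs_of_nonneg hs] using hsT))
      (-(t - t₀)) (by linarith) ht
    simpa using this

/-- The terms of the Picard (Dyson) series of the linear equation `x' = A x`, `x t₀ = x₀`. -/
noncomputable def picardTerm (A : ℝ → X →L[ℝ] X) (t₀ : ℝ) (x₀ : X) : ℕ → ℝ → X
  | 0 => fun _ => x₀
  | k + 1 => fun t => ∫ s in t₀..t, A s (picardTerm A t₀ x₀ k s)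

variable {A : ℝ → X →L[ℝ] X} {t₀ : ℝ} {x₀ : X}

lemma hasDerivAt_picardTerm_succ [CompleteSpace X] (hA : Continuous A) (k : ℕ) (t : ℝ) :
    HasDerivAt (picardTerm A t₀ x₀ (k + 1)) (A t (picardTerm A t₀ x₀ k t)) t := by
  have hc : Continuous (picardTerm A t₀ x₀ k) := by
    induction k with
    | zero => exact continuous_const
    | succ k ih =>
      exact continuous_iff_continuousAt.2 fun t =>
        ((hA.clm_apply ih).integral_hasStrictDerivAt t₀ t).hasDerivAt.continuousAt
  exact ((hA.clm_apply hc).integral_hasStrictDerivAt t₀ t).hasDerivAt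

lemma norm_picardTerm_le [CompleteSpace X] (hA : Continuous A) {K T : ℝ} (hK : 0 ≤ K)
    (hKT : ∀ t, |t - t₀| ≤ T → ‖A t‖ ≤ K) (k : ℕ) {t : ℝ} (ht : |t - t₀| ≤ T) :
    ‖picardTerm A t₀ x₀ k t‖ ≤ ‖x₀‖ * K ^ k / k.factorial * |t - t₀| ^ k := by
  induction k generalizing t with
  | zero => simp [picardTerm]
  | succ k ih =>
    have := norm_le_mul_abs_sub_pow_succ_of_hasDerivAt (k := k)
      (C := K * (‖x₀‖ * K ^ k / k.factorial))
      (hasDerivAt_picardTerm_succ (t₀ := t₀) (x₀ := x₀) hA k)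
      (by simp [picardTerm])
      (fun s hs => ((A s).le_opNorm _).trans (by
        rw [mul_assoc]
        exact mul_le_mul (hKT s hs) (ih hs) (norm_nonneg _) hK)) ht
    refine this.trans_eq ?_
    rw [Nat.factorial_succ]
    push_cast
    field_simp
    ring

/-- Global existence of solutions of linear differential equations with continuous coefficients. -/
theorem exists_forall_hasDerivAt_clm_apply [CompleteSpace X] (hA : Continuous A)
    (t₀ : ℝ) (x₀ : X) :
    ∃ x : ℝ → X, x t₀ = x₀ ∧ ∀ t, HasDerivAt x (A t (x t)) t := by
  have bound : ∀ T : ℝ, 0 ≤ T → ∃ u : ℕ → ℝ, Summable u ∧ ∃ K, 0 ≤ K ∧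
      (∀ t, |t - t₀| ≤ T → ‖A t‖ ≤ K) ∧
      ∀ k t, |t - t₀| ≤ T → ‖picardTerm A t₀ x₀ k t‖ ≤ u k := by
    intro T hT
    obtain ⟨K, hK⟩ := (isCompact_closedBall t₀ T).exists_bound_of_continuousOn hA.continuousOn
    have hK' : ∀ t, |t - t₀| ≤ T → ‖A t‖ ≤ K := fun t ht => hK t (by simpa [Real.dist_eq] using ht)
    have hK0 : 0 ≤ K := (norm_nonneg _).trans (hK' t₀ (by simpa using hT))
    refine ⟨fun k => ‖x₀‖ * ((K * T) ^ k / k.factorial),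
      (Real.summable_pow_div_factorial (K * T)).mul_left _, K, hK0, hK', fun k t ht => ?_⟩
    refine (norm_picardTerm_le hA hK0 hK' k ht).trans ?_
    calc ‖x₀‖ * K ^ k / k.factorial * |t - t₀| ^ k
        ≤ ‖x₀‖ * K ^ k / k.factorial * T ^ k := by gcongr
      _ = ‖x₀‖ * ((K * T) ^ k / k.factorial) := by rw [mul_pow]; ring
  have hsum : ∀ t, Summable fun k => picardTerm A t₀ x₀ k t := fun t => by
    obtain ⟨u, hu, -, -, -, h⟩ := bound |t - t₀| (abs_nonneg _)
    exact .of_norm_bounded hu fun k => h k t le_rfl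
  refine ⟨fun t => ∑' k, picardTerm A t₀ x₀ k t, ?_, fun t => ?_⟩
  · simp [(hsum t₀).tsum_eq_zero_add, picardTerm]
  · obtain ⟨u, hu, K, hK, hAK, h⟩ := bound (|t - t₀| + 1) (by positivity)
    have hmem : ∀ s ∈ Metric.ball t₀ (|t - t₀| + 1), |s - t₀| ≤ |t - t₀| + 1 := fun s hs => by
      simpa [Real.dist_eq] using (Metric.mem_ball.1 hs).le
    have hd := hasDerivAt_tsum_of_isPreconnected (hu.mul_left K) Metric.isOpen_ball
      (convex_ball t₀ (|t - t₀| + 1)).isPreconnected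
      (fun k s _ => hasDerivAt_picardTerm_succ (t₀ := t₀) (x₀ := x₀) hA k s)
      (fun k s hs => ((A s).le_opNorm _).trans
        (mul_le_mul (hAK s (hmem s hs)) (h k s (hmem s hs)) (norm_nonneg _) hK))
      (Metric.mem_ball_self (by positivity)) ((summable_nat_add_iff 1).2 (hsum t₀))
      (y := t) (by simp [Real.dist_eq])
    rw [(A t).map_tsum (hsum t)]
    convert hd.const_add x₀ using 1
    ext s
    rw [(hsum s).tsum_eq_zero_add]
    rfl

end LinearODE

section PiecewiseC1

variable {F : Type*} [NormedAddCommGroup F] [NormedSpace ℝ F] {a b : ℝ} {V : ℝ → F}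

lemma ContDiff.piecewiseC1On (hab : a < b) (hV : ContDiff ℝ 1 V) : PiecewiseC1On a b V := by
  refine ⟨hV.continuous.continuousOn, 1, ![a, b], rfl, rfl, ?_, fun i => hV.contDiffOn⟩
  rw [Fin.strictMono_iff_lt_succ]
  intro i
  fin_cases i
  simpa using hab

lemma PiecewiseC1On.sub_contDiff (hV : PiecewiseC1On a b V) {H : ℝ → F} (hH : ContDiff ℝ 1 H) :
    PiecewiseC1On a b (fun t => V t - H t) := by
  obtain ⟨hc, k, s, h0, hk, hs, hd⟩ := hV
  exact ⟨hc.sub hH.continuous.continuousOn, k, s, h0, hk, hs, fun i => (hd i).sub hH.contDiffOn⟩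

/-- A piecewise `C¹` map is differentiable in the interior of `[a, b]`, off a countable set. -/
lemma PiecewiseC1On.exists_countable_differentiableAt (hV : PiecewiseC1On a b V) :
    ∃ N : Set ℝ, N.Countable ∧ ∀ t ∈ Ioo a b \ N, DifferentiableAt ℝ V t := by
  obtain ⟨-, k, s, rfl, rfl, -, hd⟩ := hV
  refine ⟨range s, countable_range s, ?_⟩
  suffices h : ∀ i, ∀ t ∈ Ioo (s 0) (s i) \ range s, DifferentiableAt ℝ V t from h _
  intro i
  induction i using Fin.induction with
  | zero => simp
  | succ i ih =>
    rintro t ⟨⟨h1, h2⟩, ht⟩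
    rcases lt_trichotomy t (s i.castSucc) with h | h | h
    · exact ih t ⟨⟨h1, h⟩, ht⟩
    · exact absurd ⟨_, h.symm⟩ ht
    · exact ((hd i).differentiableOn one_ne_zero).differentiableAt (Icc_mem_nhds h h2)

/-- A continuous function of the derivative of a piecewise `C¹` map is integrable. -/
lemma PiecewiseC1On.intervalIntegrable_comp_deriv (hV : PiecewiseC1On a b V)
    {G : Type*} [NormedAddCommGroup G] {g : F → G} (hg : Continuous g) :
    IntervalIntegrable (fun t => g (deriv V t)) MeasureTheory.volume a b := by
  obtain ⟨-, k, s, rfl, rfl, hs, hd⟩ := hV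
  suffices h : ∀ i, IntervalIntegrable (fun t => g (deriv V t)) MeasureTheory.volume (s 0) (s i)
    from h _
  intro i
  induction i using Fin.induction with
  | zero => exact IntervalIntegrable.refl
  | succ i ih =>
    refine ih.trans ?_
    have hlt : s i.castSucc < s i.succ := hs i.castSucc_lt_succ
    have hc : ContinuousOn (fun t => g (derivWithin V (Icc (s i.castSucc) (s i.succ)) t))
        (Icc (s i.castSucc) (s i.succ)) :=
      hg.comp_continuousOn ((hd i).continuousOn_derivWithin (uniqueDiffOn_Icc hlt) le_rfl)
    refine (hc.intervalIntegrable_of_Icc hlt.le).congr_ae ?_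
    rw [uIoc_of_le hlt.le, ← MeasureTheory.restrict_Ioo_eq_restrict_Ioc]
    filter_upwards [MeasureTheory.ae_restrict_mem measurableSet_Ioo] with t ht
    rw [derivWithin_of_mem_nhds (Icc_mem_nhds ht.1 ht.2)]

end PiecewiseC1

section IntegrationByParts

variable {F : Type*} [NormedAddCommGroup F] [InnerProductSpace ℝ F] {a b : ℝ} {U : ℝ → F}

lemma PiecewiseC1On.intervalIntegrable_inner_deriv_add (hab : a ≤ b) (hU : PiecewiseC1On a b U)
    {P Q : ℝ → F} (hP : Continuous P) (hQ : Continuous Q) :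
    IntervalIntegrable (fun t => (inner ℝ (P t) (deriv U t) : ℝ) + inner ℝ (Q t) (U t))
      MeasureTheory.volume a b := by
  refine .add ?_ (ContinuousOn.intervalIntegrable_of_Icc hab (hQ.continuousOn.inner hU.1))
  obtain ⟨C, hC⟩ := (isCompact_Icc (a := a) (b := b)).exists_bound_of_continuousOn hP.continuousOn
  have hU' := hU.intervalIntegrable_comp_deriv continuous_id
  refine (hU'.norm.const_mul C).mono_fun'
    (hP.aestronglyMeasurable.inner hU'.aestronglyMeasurable_restrict_uIoc) ?_
  filter_upwards [MeasureTheory.ae_restrict_mem measurableSet_uIoc] with t ht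
  rw [uIoc_of_le hab] at ht
  exact (norm_inner_le_norm _ _).trans
    (mul_le_mul_of_nonneg_right (hC t (Ioc_subset_Icc_self ht)) (norm_nonneg _))

/-- Integration by parts against a piecewise `C¹` map. -/
lemma PiecewiseC1On.integral_inner_deriv_add (hab : a ≤ b) (hU : PiecewiseC1On a b U)
    {P Q : ℝ → F} (hP : ∀ t, HasDerivAt P (Q t) t) (hQ : Continuous Q) :
    ∫ t in a..b, ((inner ℝ (P t) (deriv U t) : ℝ) + inner ℝ (Q t) (U t)) =
      inner ℝ (P b) (U b) - inner ℝ (P a) (U a) := by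
  have hPc : Continuous P := continuous_iff_continuousAt.2 fun t => (hP t).continuousAt
  obtain ⟨N, hN, hd⟩ := hU.exists_countable_differentiableAt
  exact MeasureTheory.integral_eq_of_hasDerivAt_off_countable_of_le
    (fun t => (inner ℝ (P t) (U t) : ℝ)) _ hab hN (hPc.continuousOn.inner hU.1)
    (fun t ht => (hP t).inner ℝ (hd t ht).hasDerivAt)
    (hU.intervalIntegrable_inner_deriv_add hab hPc hQ)

/-- A piecewise `C¹` map vanishing at `a` whose derivative has zero energy vanishes. -/
lemma PiecewiseC1On.eq_zero_of_integral_norm_deriv_sq_eq_zero [CompleteSpace F]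
    (hU : PiecewiseC1On a b U) (ha : U a = 0)
    (h : ∫ t in a..b, ‖deriv U t‖ ^ 2 = 0) {t : ℝ} (ht : t ∈ Icc a b) : U t = 0 := by
  have hab : a ≤ b := ht.1.trans ht.2
  rw [intervalIntegral.integral_eq_zero_iff_of_le_of_nonneg_ae hab
    (Filter.Eventually.of_forall fun t => by positivity)
    (hU.intervalIntegrable_comp_deriv (g := fun x => ‖x‖ ^ 2) (by fun_prop))] at h
  obtain ⟨N, hN, hd⟩ := hU.exists_countable_differentiableAt
  have hint := hU.intervalIntegrable_comp_deriv continuous_id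
  have hsub : Icc a t ⊆ Icc a b := Icc_subset_Icc_right ht.2
  have hftc := MeasureTheory.integral_eq_of_hasDerivAt_off_countable_of_le U (deriv U) ht.1 hN
    (hU.1.mono hsub)
    (fun s hs => (hd s ⟨⟨hs.1.1, hs.1.2.trans_le ht.2⟩, hs.2⟩).hasDerivAt)
    (hint.mono_set (by rwa [uIcc_of_le ht.1, uIcc_of_le hab]))
  rw [ha, sub_zero] at hftc
  rw [← hftc, intervalIntegral.integral_of_le ht.1]
  refine MeasureTheory.integral_eq_zero_of_ae ?_
  filter_upwards [MeasureTheory.ae_restrict_of_ae_restrict_of_subset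
    (Ioc_subset_Ioc_right ht.2) h] with s hs
  simpa using hs

end IntegrationByParts

section Jacobi

variable {n : ℕ} {S : ℝ → EuclideanSpace ℝ (Fin n) →L[ℝ] EuclideanSpace ℝ (Fin n)}
  {σ : EuclideanSpace ℝ (Fin n) →ₗ[ℝ] EuclideanSpace ℝ (Fin n) →ₗ[ℝ] ℝ} {a b : ℝ}

/-- The Jacobi equation has global solutions with arbitrary initial data. -/
lemma exists_isJacobiPair (hS : Continuous S) (t₀ : ℝ) (x v : EuclideanSpace ℝ (Fin n)) :
    ∃ J J', IsJacobiPair S J J' ∧ J t₀ = x ∧ J' t₀ = v := by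
  let E := EuclideanSpace ℝ (Fin n)
  obtain ⟨z, hz₀, hz⟩ := exists_forall_hasDerivAt_clm_apply
    (A := fun t => (ContinuousLinearMap.snd ℝ E E).prod ((S t).comp (.fst ℝ E E)))
    ((ContinuousLinearMap.prodₗᵢ ℝ).continuous.comp
      (continuous_const.prodMk (hS.clm_comp continuous_const))) t₀ (x, v)
  exact ⟨fun t => (z t).1, fun t => (z t).2,
    ⟨fun t => (hz t).fst, fun t => (hz t).snd⟩, by simp [hz₀], by simp [hz₀]⟩

/-- Uniqueness for the Jacobi equation on `[a, b]`. -/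
lemma IsJacobiPair.eqOn_Icc (hS : Continuous S) {J J' H H' : ℝ → EuclideanSpace ℝ (Fin n)}
    (hJ : IsJacobiPair S J J') (hH : ∀ t, HasDerivAt H (H' t) t)
    (hH' : ∀ t ∈ Icc a b, HasDerivAt H' (S t (H t)) t) (h : J a = H a) (h' : J' a = H' a) :
    EqOn J H (Icc a b) := by
  obtain ⟨K, hK⟩ := (isCompact_Icc (a := a) (b := b)).exists_bound_of_continuousOn hS.continuousOn
  have hz : ∀ t ∈ Icc a b, HasDerivAt (fun t => (J t - H t, J' t - H' t))
      (J' t - H' t, S t (J t) - S t (H t)) t := fun t ht =>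
    ((hJ.1 t).sub (hH t)).prodMk ((hJ.2 t).sub (hH' t ht))
  have key := eq_zero_of_abs_deriv_le_mul_abs_self_of_eq_zero_right (K := max 1 K)
    (fun t ht => (hz t ht).continuousAt.continuousWithinAt)
    (fun t ht => (hz t (Ico_subset_Icc_self ht)).hasDerivWithinAt)
    (by simp [h, h']) (fun t ht => ?_)
  · exact fun t ht => sub_eq_zero.1 (congrArg Prod.fst (key t ht))
  · rw [← map_sub, Prod.norm_def, max_le_iff]
    have h1 : (1 : ℝ) ≤ max 1 K := le_max_left _ _
    constructor
    · exact (norm_snd_le (J t - H t, J' t - H' t)).trans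
        (le_mul_of_one_le_left (norm_nonneg _) h1)
    · refine ((S t).le_opNorm _).trans (mul_le_mul ?_ (norm_fst_le (J t - H t, J' t - H' t))
        (norm_nonneg _) (by positivity))
      exact (hK t (Ico_subset_Icc_self ht)).trans (le_max_right _ _)

/-- The index form of a Jacobi field and a piecewise `C¹` map vanishing at `b` is a boundary
term at `a`. -/
lemma IsJacobiPair.indexForm_eq (hab : a ≤ b) (hS : Continuous S)
    {V J J' U : ℝ → EuclideanSpace ℝ (Fin n)} (hJ : IsJacobiPair S J J')
    (hV : ∀ t ∈ Icc a b, V t = J t) (hU : PiecewiseC1On a b U) (hUb : U b = 0) :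
    indexForm S σ a b V U = -(inner ℝ (J' a) (U a) + σ (J a) (U a)) := by
  have hJc : Continuous J := continuous_iff_continuousAt.2 fun t => (hJ.1 t).continuousAt
  have hint : ∫ t in a..b, ((inner ℝ (deriv V t) (deriv U t) : ℝ) + inner ℝ (S t (V t)) (U t)) =
      ∫ t in a..b, ((inner ℝ (J' t) (deriv U t) : ℝ) + inner ℝ (S t (J t)) (U t)) := by
    refine intervalIntegral.integral_congr_Ioo_of_le hab fun t ht => ?_
    have hd : deriv V t = J' t := by
      rw [← (hJ.1 t).deriv]
      exact Filter.EventuallyEq.deriv_eq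
        (Filter.eventually_of_mem (Icc_mem_nhds ht.1 ht.2) hV)
    simp only [hd, hV t (Ioo_subset_Icc_self ht)]
  rw [indexForm, hint, hU.integral_inner_deriv_add hab hJ.2 (hS.clm_apply hJc), hUb,
    hV a (left_mem_Icc.2 hab), inner_zero_right]
  ring

/-- A piecewise `C¹` map which is orthogonal, for the index form, to all
piecewise `C¹` maps vanishing at `a` and `b` is the restriction of a Jacobi field. -/
lemma exists_isJacobiPair_of_indexForm_eq_zero (hab : a < b) (hS : Continuous S)
    {V : ℝ → EuclideanSpace ℝ (Fin n)} (hV : PiecewiseC1On a b V)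
    (h : ∀ U, PiecewiseC1On a b U → U a = 0 → U b = 0 → indexForm S σ a b V U = 0) :
    ∃ J J', IsJacobiPair S J J' ∧ ∀ t ∈ Icc a b, V t = J t := by
  set V₁ : ℝ → EuclideanSpace ℝ (Fin n) := IccExtend hab.le ((Icc a b).domRestrict V) with hV₁
  have hV₁c : Continuous V₁ := hV.1.domRestrict.Icc_extend'
  have hV₁V : ∀ t ∈ Icc a b, V₁ t = V t := fun t ht => by
    rw [hV₁, IccExtend_of_mem _ _ ht, domRestrict_apply]
  have hQ : Continuous fun t => S t (V₁ t) := hS.clm_apply hV₁c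
  have hG : ∀ t, HasDerivAt (fun t => ∫ s in a..t, S s (V₁ s)) (S t (V₁ t)) t := fun t =>
    (hQ.integral_hasStrictDerivAt a t).hasDerivAt
  set G : ℝ → EuclideanSpace ℝ (Fin n) := fun t => ∫ s in a..t, S s (V₁ s)
  have hGc : Continuous G := continuous_iff_continuousAt.2 fun t => (hG t).continuousAt
  -- `H` is the solution of `H'' = S V` with the same boundary values as `V`.
  set c : EuclideanSpace ℝ (Fin n) := (b - a)⁻¹ • (V b - V a - ∫ s in a..b, G s) with hc
  set H : ℝ → EuclideanSpace ℝ (Fin n) := fun t => V a + (∫ s in a..t, G s) + (t - a) • c with hHdef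
  have hH : ∀ t, HasDerivAt H (G t + c) t := fun t => by
    simpa [hHdef, Pi.add_def] using (((hGc.integral_hasStrictDerivAt a t).hasDerivAt.const_add (V a)).add
      (((hasDerivAt_id t).sub_const a).smul_const c))
  have hH' : ∀ t, HasDerivAt (fun t => G t + c) (S t (V₁ t)) t := fun t => (hG t).add_const c
  have hHC1 : ContDiff ℝ 1 H := by
    refine contDiff_one_iff_deriv.2 ⟨fun t => (hH t).differentiableAt, ?_⟩
    rw [show deriv H = fun t => G t + c from funext fun t => (hH t).deriv]
    fun_prop
  have hHa : H a = V a := by simp [hHdef]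
  have hHb : H b = V b := by
    simp only [hHdef, hc]
    rw [smul_inv_smul₀ (sub_ne_zero.2 hab.ne')]
    abel
  have hU := hV.sub_contDiff hHC1
  set U : ℝ → EuclideanSpace ℝ (Fin n) := fun t => V t - H t
  have hUa : U a = 0 := sub_eq_zero.2 hHa.symm
  have hUb : U b = 0 := sub_eq_zero.2 hHb.symm
  have hzero := h U hU hUa hUb
  have hparts := hU.integral_inner_deriv_add hab.le hH' hQ
  rw [hUa, hUb, inner_zero_right, inner_zero_right, sub_zero] at hparts
  rw [indexForm, hUa, map_zero, sub_zero] at hzero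
  obtain ⟨N, hN, hd⟩ := hV.exists_countable_differentiableAt
  have henergy : ∫ t in a..b, ‖deriv U t‖ ^ 2 = 0 := by
    have hadd := intervalIntegral.integral_add
      (hU.intervalIntegrable_comp_deriv (g := fun x => ‖x‖ ^ 2) (by fun_prop))
      (hU.intervalIntegrable_inner_deriv_add hab.le (P := fun t => G t + c) (by fun_prop) hQ)
    rw [hparts, add_zero] at hadd
    rw [← hadd, ← hzero, intervalIntegral.integral_of_le hab.le, intervalIntegral.integral_of_le hab.le,
      MeasureTheory.integral_Ioc_eq_integral_Ioo, MeasureTheory.integral_Ioc_eq_integral_Ioo]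
    refine MeasureTheory.setIntegral_congr_ae measurableSet_Ioo ?_
    filter_upwards [hN.ae_notMem MeasureTheory.volume] with t htN ht
    have hdU : deriv U t = deriv V t - (G t + c) :=
      ((hd t ⟨ht, htN⟩).hasDerivAt.sub (hH t)).deriv
    have hdV : deriv V t = deriv U t + (G t + c) := by rw [hdU]; abel
    rw [hdV, hV₁V t (Ioo_subset_Icc_self ht), inner_add_left (deriv U t),
      real_inner_self_eq_norm_sq, add_assoc]
  have hVH : ∀ t ∈ Icc a b, V t = H t := fun t ht =>
    sub_eq_zero.1 (hU.eq_zero_of_integral_norm_deriv_sq_eq_zero hUa henergy ht)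
  obtain ⟨J, J', hJ, hJa, hJ'a⟩ := exists_isJacobiPair hS a (H a) (G a + c)
  refine ⟨J, J', hJ, fun t ht =>
    (hVH t ht).trans (hJ.eqOn_Icc hS hH (fun s hs => ?_) hJa hJ'a ht).symm⟩
  rw [← hVH s hs, ← hV₁V s hs]
  exact hH' s

end Jacobi

/-- The kernel of the restriction of `I^P` to `H^P` consists exactly of those elements of
`H^P` which agree on `[a, b]` with a `P`-Jacobi field `J` satisfying `J b = 0`. -/
theorem kernel_of_indexForm_on_HP {n : ℕ}
    (S : ℝ → EuclideanSpace ℝ (Fin n) →L[ℝ] EuclideanSpace ℝ (Fin n))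
    (hS : ContDiff ℝ (⊤ : ℕ∞) S)
    (hSsa : ∀ (t : ℝ) (x y : EuclideanSpace ℝ (Fin n)),
      (inner ℝ (S t x) y : ℝ) = inner ℝ x (S t y))
    (σ : EuclideanSpace ℝ (Fin n) →ₗ[ℝ] EuclideanSpace ℝ (Fin n) →ₗ[ℝ] ℝ)
    (hσ : ∀ x y, σ x y = σ y x)
    (W : Submodule ℝ (EuclideanSpace ℝ (Fin n)))
    (a b : ℝ) (hab : a < b) :
    {V ∈ HP W a b | ∀ U ∈ HP W a b, indexForm S σ a b V U = 0} =
      {V ∈ HP W a b | ∃ J J' : ℝ → EuclideanSpace ℝ (Fin n),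
        IsPJacobiPair S σ W a J J' ∧ J b = 0 ∧ ∀ t ∈ Icc a b, V t = J t} := by
  have hSc : Continuous S := hS.continuous
  ext V
  refine and_congr_right fun hV => ⟨fun h => ?_, ?_⟩
  · obtain ⟨J, J', hJ, hVJ⟩ := exists_isJacobiPair_of_indexForm_eq_zero hab hSc hV.1
      fun U hU hUa hUb => h U ⟨hU, hUa ▸ W.zero_mem, hUb⟩
    refine ⟨J, J', ⟨hJ, hVJ a (left_mem_Icc.2 hab.le) ▸ hV.2.1, fun w hw => ?_⟩,
      hVJ b (right_mem_Icc.2 hab.le) ▸ hV.2.2, hVJ⟩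
    have hU : PiecewiseC1On a b fun t => ((b - t) / (b - a)) • w :=
      ContDiff.piecewiseC1On hab (by fun_prop)
    have hUa : ((b - a) / (b - a)) • w = w := by rw [div_self (sub_ne_zero.2 hab.ne'), one_smul]
    have hUb : ((b - b) / (b - a)) • w = 0 := by simp
    have := hJ.indexForm_eq (σ := σ) hab.le hSc hVJ hU hUb
    rw [h _ ⟨hU, hUa.symm ▸ hw, hUb⟩, hUa] at this
    linarith
  · rintro ⟨J, J', ⟨hJ, -, hJσ⟩, -, hVJ⟩ U ⟨hU, hUa, hUb⟩
    rw [hJ.indexForm_eq hab.le hSc hVJ hU hUb, hJσ _ hUa, neg_zero]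
end

section
/- (Morse Index Theorem, ODE model with variable initial endpoint.) The set of P-focal instants in (a,b] is finite, and ind(I^P, H^P) = ∑_{t ∈ (a,b)} μ^P(t); in particular the index of I^P on H^P is finite. -/
open Set

/-- The space of `P`-Jacobi fields (encoded as pairs `(J, J')`) vanishing at the instant `t`. -/
def pJacobiVanishingAt {n : ℕ}
    (S : ℝ → EuclideanSpace ℝ (Fin n) →L[ℝ] EuclideanSpace ℝ (Fin n))
    (σ : EuclideanSpace ℝ (Fin n) →ₗ[ℝ] EuclideanSpace ℝ (Fin n) →ₗ[ℝ] ℝ)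
    (W : Submodule ℝ (EuclideanSpace ℝ (Fin n))) (a t : ℝ) :
    Submodule ℝ ((ℝ → EuclideanSpace ℝ (Fin n)) × (ℝ → EuclideanSpace ℝ (Fin n))) where
  carrier := {p | IsPJacobiPair S σ W a p.1 p.2 ∧ p.1 t = 0}
  zero_mem' := by
    refine ⟨⟨⟨fun s => ?_, fun s => ?_⟩, W.zero_mem, fun w hw => by simp⟩, rfl⟩
    · exact hasDerivAt_const s 0
    · simpa using hasDerivAt_const s (0 : EuclideanSpace ℝ (Fin n))
  add_mem' := by
    rintro p q ⟨⟨⟨hp1, hp2⟩, hpa, hpσ⟩, hpt⟩ ⟨⟨⟨hq1, hq2⟩, hqa, hqσ⟩, hqt⟩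
    refine ⟨⟨⟨fun s => ?_, fun s => ?_⟩, W.add_mem hpa hqa, fun w hw => ?_⟩, ?_⟩
    · exact (hp1 s).add (hq1 s)
    · simpa using (hp2 s).add (hq2 s)
    · have h1 := hpσ w hw
      have h2 := hqσ w hw
      simp only [Prod.fst_add, Prod.snd_add, Pi.add_apply, inner_add_left, map_add,
        LinearMap.add_apply] at *
      linarith
    · simp [Prod.fst_add, Pi.add_apply, hpt, hqt]
  smul_mem' := by
    rintro c p ⟨⟨⟨hp1, hp2⟩, hpa, hpσ⟩, hpt⟩
    refine ⟨⟨⟨fun s => ?_, fun s => ?_⟩, W.smul_mem c hpa, fun w hw => ?_⟩, ?_⟩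
    · exact (hp1 s).const_smul c
    · simpa using (hp2 s).const_smul c
    · have h1 := hpσ w hw
      simp only [Prod.smul_fst, Prod.smul_snd, Pi.smul_apply, real_inner_smul_left, map_smul,
        LinearMap.smul_apply, smul_eq_mul] at *
      linear_combination c * h1
    · simp [Prod.smul_fst, Pi.smul_apply, hpt]

/-- The multiplicity `μ^P t` of the instant `t`: the dimension of the space of `P`-Jacobi
fields vanishing at `t` (which is `0` if `t` is not `P`-focal). -/
noncomputable def focalMultiplicity {n : ℕ}
    (S : ℝ → EuclideanSpace ℝ (Fin n) →L[ℝ] EuclideanSpace ℝ (Fin n))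
    (σ : EuclideanSpace ℝ (Fin n) →ₗ[ℝ] EuclideanSpace ℝ (Fin n) →ₗ[ℝ] ℝ)
    (W : Submodule ℝ (EuclideanSpace ℝ (Fin n))) (a t : ℝ) : ℕ :=
  Module.finrank ℝ (pJacobiVanishingAt S σ W a t)

open Filter Topology

/-- The Picard iterates (iterated integrals) of the linear equation `Z' = M Z`. -/
noncomputable def linearPicardIterate {X : Type*} [NormedAddCommGroup X] [NormedSpace ℝ X]
    (M : ℝ → X →L[ℝ] X) (t₀ : ℝ) (x₀ : X) : ℕ → ℝ → X
  | 0 => fun _ => x₀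
  | k + 1 => fun t => ∫ s in t₀..t, M s (linearPicardIterate M t₀ x₀ k s)

section LinearODE

variable {X : Type*} [NormedAddCommGroup X] [NormedSpace ℝ X]
  {M : ℝ → X →L[ℝ] X} {t₀ : ℝ} {x₀ : X}

theorem continuous_linearPicardIterate (hM : Continuous M) (k : ℕ) :
    Continuous (linearPicardIterate M t₀ x₀ k) := by
  induction k with
  | zero => exact continuous_const
  | succ k ih =>
    exact intervalIntegral.continuous_primitive
      (fun _ _ => (hM.clm_apply ih).intervalIntegrable _ _) _

theorem hasDerivAt_linearPicardIterate_succ [CompleteSpace X] (hM : Continuous M) (k : ℕ) (t : ℝ) :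
    HasDerivAt (linearPicardIterate M t₀ x₀ (k + 1)) (M t (linearPicardIterate M t₀ x₀ k t)) t :=
  (hM.clm_apply (continuous_linearPicardIterate hM k)).integral_hasStrictDerivAt t₀ t
    |>.hasDerivAt

theorem norm_linearPicardIterate_le {C R : ℝ} (hC : 0 ≤ C)
    (hMC : ∀ t ∈ Metric.ball t₀ R, ‖M t‖ ≤ C) (k : ℕ) :
    ∀ t ∈ Metric.ball t₀ R,
      ‖linearPicardIterate M t₀ x₀ k t‖ ≤ ‖x₀‖ * C ^ k * |t - t₀| ^ k / k.factorial := by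
  induction k with
  | zero => intro t _; simp [linearPicardIterate]
  | succ k ih =>
    intro t ht
    have hsub : uIoc t₀ t ⊆ Metric.ball t₀ R := by
      intro s hs
      have h1 := Set.abs_sub_left_of_mem_uIcc (Set.uIoc_subset_uIcc hs)
      rw [Metric.mem_ball, Real.dist_eq] at *
      exact h1.trans_lt ht
    have hbound : ∀ s ∈ uIoc t₀ t, ‖M s (linearPicardIterate M t₀ x₀ k s)‖ ≤
        ‖x₀‖ * C ^ (k + 1) / k.factorial * |s - t₀| ^ k := by
      intro s hs
      calc _ ≤ ‖M s‖ * ‖linearPicardIterate M t₀ x₀ k s‖ := (M s).le_opNorm _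
        _ ≤ C * (‖x₀‖ * C ^ k * |s - t₀| ^ k / k.factorial) := by
            gcongr
            · exact hMC s (hsub hs)
            · exact ih s (hsub hs)
        _ = _ := by ring
    have hle := intervalIntegral.norm_integral_le_abs_of_norm_le
      (μ := MeasureTheory.volume)
      (MeasureTheory.ae_restrict_of_forall_mem measurableSet_uIoc hbound)
      (Continuous.intervalIntegrable (by fun_prop) _ _)
    refine hle.trans ?_
    rw [intervalIntegral.abs_intervalIntegral_eq, MeasureTheory.integral_const_mul,
      integral_pow_abs_sub_uIoc, abs_of_nonneg (by positivity), Nat.factorial_succ]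
    push_cast
    apply le_of_eq
    field_simp

theorem exists_linear_ode_solution [CompleteSpace X] (hM : Continuous M) (t₀ : ℝ) (x₀ : X) :
    ∃ Z : ℝ → X, Z t₀ = x₀ ∧ ∀ t, HasDerivAt Z (M t (Z t)) t := by
  have hbdd : ∀ R : ℝ, ∃ C, 0 ≤ C ∧ ∀ t ∈ Metric.ball t₀ R, ‖M t‖ ≤ C := by
    intro R
    obtain ⟨C, hC⟩ := (isCompact_closedBall t₀ R).exists_bound_of_continuousOn hM.continuousOn
    exact ⟨max C 0, le_max_right _ _, fun t ht =>
      (hC t (Metric.ball_subset_closedBall ht)).trans (le_max_left _ _)⟩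
  have hkey : ∀ R : ℝ, ∃ u : ℕ → ℝ, Summable u ∧ ∀ k, ∀ t ∈ Metric.ball t₀ R,
      ‖linearPicardIterate M t₀ x₀ k t‖ ≤ u k := by
    intro R
    obtain ⟨C, hC0, hC⟩ := hbdd R
    refine ⟨fun k => ‖x₀‖ * ((C * R) ^ k / k.factorial),
      (Real.summable_pow_div_factorial _).mul_left _, fun k t ht => ?_⟩
    refine (norm_linearPicardIterate_le hC0 hC k t ht).trans ?_
    dsimp only
    rw [mul_pow, mul_assoc, mul_div_assoc]
    rw [Metric.mem_ball, Real.dist_eq] at ht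
    gcongr
  have hsum : ∀ t, Summable fun k => linearPicardIterate M t₀ x₀ k t := by
    intro t
    obtain ⟨u, hu, hle⟩ := hkey (dist t t₀ + 1)
    exact Summable.of_norm_bounded hu fun k => hle k t (by simp)
  refine ⟨fun t => ∑' k, linearPicardIterate M t₀ x₀ k t, ?_, fun t => ?_⟩
  · dsimp only
    rw [(hsum t₀).tsum_eq_zero_add]
    simp [linearPicardIterate]
  · obtain ⟨u, hu, hle⟩ := hkey (dist t t₀ + 1)
    obtain ⟨C, hC0, hC⟩ := hbdd (dist t t₀ + 1)
    have hder := hasDerivAt_tsum_of_isPreconnected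
      (g := fun k => linearPicardIterate M t₀ x₀ (k + 1))
      (g' := fun k s => M s (linearPicardIterate M t₀ x₀ k s)) (hu.mul_left C) Metric.isOpen_ball
      (convex_ball t₀ (dist t t₀ + 1)).isPreconnected
      (fun k s _ => hasDerivAt_linearPicardIterate_succ hM k s)
      (fun k s hs => ((M s).le_opNorm _).trans
        (mul_le_mul (hC s hs) (hle k s hs) (norm_nonneg _) hC0))
      (y₀ := t) (by simp) ((summable_nat_add_iff 1).2 (hsum t)) (y := t) (by simp)
    have heq : (fun t => ∑' k, linearPicardIterate M t₀ x₀ k t) =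
        fun t => x₀ + ∑' k, linearPicardIterate M t₀ x₀ (k + 1) t := by
      funext s
      rw [(hsum s).tsum_eq_zero_add]
      rfl
    rw [(M t).map_tsum (hsum t), heq]
    exact hder.const_add x₀

theorem linear_ode_solution_eq_zero (hM : Continuous M) {Z : ℝ → X}
    (hZ : ∀ t, HasDerivAt Z (M t (Z t)) t) (h0 : Z t₀ = 0) (t : ℝ) : Z t = 0 := by
  obtain ⟨C, hC⟩ := (isCompact_closedBall t₀ (dist t t₀ + 1)).exists_bound_of_continuousOn
    hM.continuousOn
  have hlip : ∀ s ∈ Ioo (t₀ - (dist t t₀ + 1)) (t₀ + (dist t t₀ + 1)),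
      LipschitzOnWith C.toNNReal (fun x => M s x) univ := by
    intro s hs
    rw [← Real.ball_eq_Ioo] at hs
    refine ((M s).lipschitz.weaken ?_).lipschitzOnWith
    exact NNReal.le_toNNReal_of_coe_le (hC s (Metric.ball_subset_closedBall hs))
  have hpos : 0 ≤ dist t t₀ := dist_nonneg
  have := ODE_solution_unique_of_mem_Ioo (t₀ := t₀) (f := Z) (g := fun _ => 0) hlip
    (by constructor <;> linarith)
    (fun s _ => ⟨hZ s, mem_univ _⟩)
    (fun s _ => ⟨by simpa using hasDerivAt_const s (0 : X), mem_univ _⟩)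
    h0
  apply this
  rw [← Real.ball_eq_Ioo]
  simp

theorem exists_second_order_linear_ode_solution [CompleteSpace X] (hM : Continuous M) (t₀ : ℝ)
    (x₀ x₁ : X) : ∃ Y Y' : ℝ → X, Y t₀ = x₀ ∧ Y' t₀ = x₁ ∧
      (∀ t, HasDerivAt Y (Y' t) t) ∧ ∀ t, HasDerivAt Y' (M t (Y t)) t := by
  have hM' : Continuous fun t => ContinuousLinearMap.inl ℝ X X ∘L ContinuousLinearMap.snd ℝ X X +
      ContinuousLinearMap.inr ℝ X X ∘L (M t ∘L ContinuousLinearMap.fst ℝ X X) :=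
    continuous_const.add (continuous_const.clm_comp (hM.clm_comp continuous_const))
  obtain ⟨Z, hZa, hZ⟩ := exists_linear_ode_solution hM' t₀ (x₀, x₁)
  refine ⟨fun t => (Z t).1, fun t => (Z t).2, by simp [hZa], by simp [hZa], fun t => ?_,
    fun t => ?_⟩
  · simpa [Function.comp_def] using
      (ContinuousLinearMap.fst ℝ X X).hasFDerivAt.comp_hasDerivAt t (hZ t)
  · simpa [Function.comp_def] using
      (ContinuousLinearMap.snd ℝ X X).hasFDerivAt.comp_hasDerivAt t (hZ t)

theorem second_order_linear_ode_solution_eq_zero (hM : Continuous M) {Y Y' : ℝ → X}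
    (hY : ∀ t, HasDerivAt Y (Y' t) t) (hY' : ∀ t, HasDerivAt Y' (M t (Y t)) t)
    (h0 : Y t₀ = 0) (h0' : Y' t₀ = 0) (t : ℝ) : Y t = 0 ∧ Y' t = 0 := by
  have hM' : Continuous fun t => ContinuousLinearMap.inl ℝ X X ∘L ContinuousLinearMap.snd ℝ X X +
      ContinuousLinearMap.inr ℝ X X ∘L (M t ∘L ContinuousLinearMap.fst ℝ X X) :=
    continuous_const.add (continuous_const.clm_comp (hM.clm_comp continuous_const))
  have hZ := linear_ode_solution_eq_zero hM' (Z := fun t => (Y t, Y' t)) (t₀ := t₀)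
    (fun t => by simpa using (hY t).prodMk (hY' t)) (by simp [h0, h0']) t
  exact Prod.mk_eq_zero.1 hZ

end LinearODE

section JacobiFrame

variable {E : Type*} [NormedAddCommGroup E] [InnerProductSpace ℝ E]

/-- A Lagrangian frame of solutions of the Jacobi equation: operator-valued functions `A`, `B`
with `A' = B`, `B' = S A`, vanishing Wronskian, and `A t`, `B t` jointly injective. -/
structure IsLagrangianFrame (S A B : ℝ → E →L[ℝ] E) : Prop where
  hasDerivAt_fst : ∀ t, HasDerivAt A (B t) t
  hasDerivAt_snd : ∀ t, HasDerivAt B (S t ∘L A t) t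
  wronskian : ∀ t x y, (inner ℝ (A t x) (B t y) : ℝ) = inner ℝ (B t x) (A t y)
  eq_zero : ∀ t x, A t x = 0 → B t x = 0 → x = 0

theorem exists_eventually_norm_le_of_tendsto [FiniteDimensional ℝ E] {l : Filter ℝ}
    {F : ℝ → E →L[ℝ] E} {F₀ : E →L[ℝ] E} (hF : Tendsto F l (𝓝 F₀))
    (hinj : Function.Injective F₀) : ∃ C : ℝ, 0 ≤ C ∧ ∀ᶠ t in l, ∀ x, ‖x‖ ≤ C * ‖F t x‖ := by
  obtain ⟨K, hK, hanti⟩ := (F₀ : E →ₗ[ℝ] E).exists_antilipschitzWith (LinearMap.ker_eq_bot.2 hinj)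
  have hK' : (0 : ℝ) < K := hK
  refine ⟨2 * K, by positivity, ?_⟩
  filter_upwards [hF (Metric.ball_mem_nhds F₀ (ε := 1 / (2 * K)) (by positivity))] with t ht x
  have h1 : ‖x‖ ≤ K * ‖F₀ x‖ := by simpa using hanti.le_mul_dist x 0
  have h2 : ‖F₀ x‖ ≤ ‖F t x‖ + ‖(F t - F₀) x‖ := by
    have := norm_sub_le (F t x) ((F t - F₀) x)
    simpa using this
  have h3 : ‖(F t - F₀) x‖ ≤ 1 / (2 * K) * ‖x‖ := by
    refine (F t - F₀).le_of_opNorm_le ?_ x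
    rw [mem_preimage, Metric.mem_ball, dist_eq_norm] at ht
    exact ht.le
  have h4 : (K : ℝ) * (1 / (2 * K) * ‖x‖) = ‖x‖ / 2 := by field_simp
  nlinarith

namespace IsLagrangianFrame

variable {S A B : ℝ → E →L[ℝ] E}

theorem continuous_fst (h : IsLagrangianFrame S A B) : Continuous A :=
  continuous_iff_continuousAt.2 fun t => (h.hasDerivAt_fst t).continuousAt

theorem continuous_snd (h : IsLagrangianFrame S A B) : Continuous B :=
  continuous_iff_continuousAt.2 fun t => (h.hasDerivAt_snd t).continuousAt

theorem hasDerivAt_fst_apply (h : IsLagrangianFrame S A B) (x : E) (t : ℝ) :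
    HasDerivAt (fun t => A t x) (B t x) t := by
  simpa using (h.hasDerivAt_fst t).clm_apply (hasDerivAt_const t x)

theorem hasDerivAt_snd_apply (h : IsLagrangianFrame S A B) (x : E) (t : ℝ) :
    HasDerivAt (fun t => B t x) (S t (A t x)) t := by
  simpa using (h.hasDerivAt_snd t).clm_apply (hasDerivAt_const t x)

theorem inner_expansion (h : IsLagrangianFrame S A B) (t : ℝ) (y c : E) :
    (inner ℝ (B t y) (A t y) : ℝ) = inner ℝ (B t c) (A t y) + inner ℝ (A t y - A t c) (B t c) +
      inner ℝ (B t (y - c)) (A t y - A t c) := by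
  have h1 := h.wronskian t y c
  have h2 := real_inner_comm (A t c) (B t c)
  simp only [map_sub, inner_sub_left, inner_sub_right]
  linarith

variable [FiniteDimensional ℝ E]

theorem exists_eventually_mul_norm_le (h : IsLagrangianFrame S A B) (t₀ : ℝ) :
    ∃ C : ℝ, 0 ≤ C ∧ ∀ᶠ t in 𝓝[≠] t₀, ∀ x, |t - t₀| * ‖x‖ ≤ C * ‖A t x‖ := by
  set π : E →L[ℝ] E := (LinearMap.ker (A t₀ : E →ₗ[ℝ] E)).starProjection with hπ
  have hπker : ∀ x, A t₀ (π x) = 0 := fun x =>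
    LinearMap.mem_ker.1 (Submodule.starProjection_apply_mem (LinearMap.ker (A t₀ : E →ₗ[ℝ] E)) x)
  have hπidem : ∀ x, π (π x) = π x := fun x => Submodule.starProjection_eq_self_iff.2
    (Submodule.starProjection_apply_mem (LinearMap.ker (A t₀ : E →ₗ[ℝ] E)) x)
  have hπnorm : ∀ x, ‖π x‖ ≤ ‖x‖ := fun x => Submodule.norm_starProjection_apply_le _ x
  have hπeq : ∀ x, A t₀ x = 0 → π x = x := fun x hx =>
    Submodule.starProjection_eq_self_iff.2 (LinearMap.mem_ker.2 hx)
  have hinj : Function.Injective (B t₀ ∘L π + A t₀ ∘L (1 - π) : E →L[ℝ] E) := by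
    refine (injective_iff_map_eq_zero _).2 fun x hx => ?_
    have hAx : A t₀ x = 0 ∧ B t₀ (π x) = 0 := by
      have hx' : B t₀ (π x) + A t₀ x = 0 := by simpa [hπker] using hx
      have horth : (inner ℝ (B t₀ (π x)) (A t₀ x) : ℝ) = 0 := by
        rw [← h.wronskian, hπker, inner_zero_left]
      have hB := eq_neg_of_add_eq_zero_left hx'
      rw [hB, inner_neg_left, neg_eq_zero, inner_self_eq_zero] at horth
      exact ⟨horth, by rw [hB, horth, neg_zero]⟩
    have hπx := h.eq_zero t₀ (π x) (hπker x) hAx.2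
    rwa [hπeq x hAx.1] at hπx
  have htend : Tendsto (fun t => (t - t₀)⁻¹ • (A t ∘L π) + A t ∘L (1 - π)) (𝓝[≠] t₀)
      (𝓝 (B t₀ ∘L π + A t₀ ∘L (1 - π))) := by
    refine Tendsto.add ?_ ?_
    · have hd : HasDerivAt (fun t => A t ∘L π) (B t₀ ∘L π) t₀ := by
        simpa using (h.hasDerivAt_fst t₀).clm_comp (hasDerivAt_const t₀ π)
      refine (hasDerivAt_iff_tendsto_slope.1 hd).congr fun t => ?_
      have h0 : A t₀ ∘L π = 0 := by ext x; simp [hπker]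
      simp [slope, h0]
    · exact ((h.continuous_fst.clm_comp continuous_const).tendsto t₀).mono_left
        nhdsWithin_le_nhds
  obtain ⟨C, hC0, hC⟩ := exists_eventually_norm_le_of_tendsto htend hinj
  refine ⟨3 * C, by positivity, ?_⟩
  filter_upwards [hC, self_mem_nhdsWithin,
    mem_nhdsWithin_of_mem_nhds (Metric.ball_mem_nhds t₀ one_pos)] with t ht hne hball x
  have hne' : t - t₀ ≠ 0 := sub_ne_zero.2 hne
  have hsmall : |t - t₀| ≤ 1 := by rw [Metric.mem_ball, Real.dist_eq] at hball; exact hball.le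
  set w : E := (t - t₀) • π x + (x - π x) with hw
  have hπw : π w = (t - t₀) • π x := by simp [hw, hπidem]
  have hval : ((t - t₀)⁻¹ • (A t ∘L π) + A t ∘L (1 - π) : E →L[ℝ] E) w = A t x := by
    have h1 : w - π w = x - π x := by rw [hπw, hw]; abel
    have h2 : ((t - t₀)⁻¹ • (A t ∘L π) + A t ∘L (1 - π) : E →L[ℝ] E) w =
        (t - t₀)⁻¹ • A t (π w) + A t (w - π w) := by simp
    rw [h2, h1, hπw, map_smul, inv_smul_smul₀ hne', ← map_add]
    congr 1
    abel
  have hwle := ht w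
  rw [hval] at hwle
  have hx : (t - t₀) • x = π w + (t - t₀) • (w - π w) := by
    have h1 : w - π w = x - π x := by rw [hπw, hw]; abel
    rw [h1, hπw, ← smul_add]
    congr 1
    abel
  calc |t - t₀| * ‖x‖ = ‖π w + (t - t₀) • (w - π w)‖ := by rw [← hx, norm_smul, Real.norm_eq_abs]
    _ ≤ ‖π w‖ + |t - t₀| * ‖w - π w‖ := by
        refine (norm_add_le _ _).trans ?_
        rw [norm_smul, Real.norm_eq_abs]
    _ ≤ ‖w‖ + 1 * (‖w‖ + ‖w‖) := by
        gcongr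
        · exact hπnorm w
        · exact (norm_sub_le _ _).trans (by gcongr; exact hπnorm w)
    _ ≤ 3 * C * ‖A t x‖ := by linarith

theorem eventually_injective (h : IsLagrangianFrame S A B) (t₀ : ℝ) :
    ∀ᶠ t in 𝓝[≠] t₀, Function.Injective (A t) := by
  obtain ⟨C, hC0, hC⟩ := h.exists_eventually_mul_norm_le t₀
  filter_upwards [hC, self_mem_nhdsWithin] with t ht hne
  refine (injective_iff_map_eq_zero _).2 fun x hx => ?_
  have h1 := ht x
  rw [hx, norm_zero, mul_zero] at h1
  have h2 : 0 < |t - t₀| := abs_pos.2 (sub_ne_zero.2 hne)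
  exact norm_le_zero_iff.1 (nonpos_of_mul_nonpos_right h1 h2)

theorem finite_not_injective (h : IsLagrangianFrame S A B) (a b : ℝ) :
    {t ∈ Icc a b | ¬ Function.Injective (A t)}.Finite := by
  by_contra hinf
  obtain ⟨t₀, -, hacc⟩ := Set.Infinite.exists_accPt_of_subset_isCompact hinf isCompact_Icc
    (sep_subset _ _)
  rw [accPt_iff_frequently_nhdsNE] at hacc
  exact hacc ((h.eventually_injective t₀).mono fun t ht hmem => hmem.2 ht)

theorem mem_range_iff (h : IsLagrangianFrame S A B) (t : ℝ) (v : E) :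
    v ∈ LinearMap.range (A t : E →ₗ[ℝ] E) ↔
      ∀ k, A t k = 0 → (inner ℝ (B t k) v : ℝ) = 0 := by
  constructor
  · rintro ⟨y, rfl⟩ k hk
    change inner ℝ (B t k) (A t y) = 0
    rw [← h.wronskian, hk, inner_zero_left]
  · intro hv
    set K := LinearMap.ker (A t : E →ₗ[ℝ] E) with hK
    set N := K.map (B t : E →ₗ[ℝ] E) with hN
    have hle : LinearMap.range (A t : E →ₗ[ℝ] E) ≤ Nᗮ := by
      rintro _ ⟨y, rfl⟩
      rw [Submodule.mem_orthogonal]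
      rintro _ ⟨k, hk, rfl⟩
      change inner ℝ (B t k) (A t y) = 0
      rw [← h.wronskian, show A t k = 0 from hk, inner_zero_left]
    have hfin : Module.finrank ℝ N = Module.finrank ℝ K := by
      have hinj : Function.Injective ((B t : E →ₗ[ℝ] E).domRestrict K) := by
        refine (injective_iff_map_eq_zero _).2 fun k hk => ?_
        exact Subtype.ext (h.eq_zero t k k.2 hk)
      rw [← LinearMap.finrank_range_of_inj hinj, LinearMap.range_domRestrict]
    have heq : LinearMap.range (A t : E →ₗ[ℝ] E) = Nᗮ := by
      refine Submodule.eq_of_le_of_finrank_eq hle ?_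
      have h1 := LinearMap.finrank_range_add_finrank_ker (A t : E →ₗ[ℝ] E)
      have h2 := N.finrank_add_finrank_orthogonal
      rw [← hK] at h1
      omega
    rw [heq, Submodule.mem_orthogonal]
    rintro _ ⟨k, hk, rfl⟩
    exact hv k hk

/-- The boundary term of the Riccati transformation is continuous, even across the instants at
which `A t` degenerates. -/
theorem continuousOn_inner (h : IsLagrangianFrame S A B) {a b L : ℝ} {V y : ℝ → E}
    (hV : ∀ s ∈ Icc a b, ∀ t ∈ Icc a b, ‖V t - V s‖ ≤ L * |t - s|)
    (hy : ∀ t ∈ Icc a b, A t (y t) = V t) :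
    ContinuousOn (fun t => (inner ℝ (B t (y t)) (V t) : ℝ)) (Icc a b) := by
  intro t₀ ht₀
  rw [← continuousWithinAt_sdiff_self]
  set l := 𝓝[Icc a b \ {t₀}] t₀ with hl
  obtain ⟨C, hC0, hC⟩ := h.exists_eventually_mul_norm_le t₀
  have hCl : ∀ᶠ t in l, ∀ x, |t - t₀| * ‖x‖ ≤ C * ‖A t x‖ :=
    hC.filter_mono (nhdsWithin_mono _ fun t ht => ht.2)
  have hmem : ∀ᶠ t in l, t ∈ Icc a b \ {t₀} := self_mem_nhdsWithin
  have hid : Tendsto (fun t : ℝ => t) l (𝓝 t₀) := tendsto_id.mono_left nhdsWithin_le_nhds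
  have hVt : Tendsto V l (𝓝 (V t₀)) := by
    rw [tendsto_iff_norm_sub_tendsto_zero]
    have hlim : Tendsto (fun t => L * |t - t₀|) l (𝓝 0) := by
      have := ((hid.sub_const t₀).abs).const_mul L
      simpa using this
    exact squeeze_zero' (Eventually.of_forall fun t => norm_nonneg _)
      (hmem.mono fun t ht => hV t₀ ht₀ t ht.1) hlim
  have hBt : Tendsto B l (𝓝 (B t₀)) := (h.continuous_snd.tendsto t₀).comp hid
  have hAc : Tendsto (fun t => A t (y t₀)) l (𝓝 (V t₀)) := by
    rw [← hy t₀ ht₀]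
    exact (h.hasDerivAt_fst_apply (y t₀) t₀).continuousAt.tendsto.comp hid
  have hBc : Tendsto (fun t => B t (y t₀)) l (𝓝 (B t₀ (y t₀))) :=
    (h.hasDerivAt_snd_apply (y t₀) t₀).continuousAt.tendsto.comp hid
  have hZ : Tendsto (fun t => V t - A t (y t₀)) l (𝓝 0) := by simpa using hVt.sub hAc
  obtain ⟨D, hD⟩ := ((h.hasDerivAt_fst_apply (y t₀) t₀).isBigO_sub.mono
    (nhdsWithin_le_nhds (s := Icc a b \ {t₀}))).bound
  have herr : Tendsto (fun t => (inner ℝ (B t (y t - y t₀)) (V t - A t (y t₀)) : ℝ)) l (𝓝 0) := by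
    have hlim : Tendsto (fun t => ‖B t‖ * (C * (L + D)) * ‖V t - A t (y t₀)‖) l (𝓝 0) := by
      have := (hBt.norm.mul_const (C * (L + D))).mul hZ.norm
      simpa using this
    refine squeeze_zero_norm' ?_ hlim
    filter_upwards [hCl, hmem, hD] with t htC ht htD
    have hpos : 0 < |t - t₀| := abs_pos.2 (sub_ne_zero.2 ht.2)
    have hz : ‖V t - A t (y t₀)‖ ≤ (L + D) * |t - t₀| := by
      have h1 := hV t₀ ht₀ t ht.1
      have h2 : ‖A t (y t₀) - V t₀‖ ≤ D * |t - t₀| := by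
        rw [← hy t₀ ht₀]; simpa using htD
      calc ‖V t - A t (y t₀)‖ = ‖(V t - V t₀) - (A t (y t₀) - V t₀)‖ := by congr 1; abel
        _ ≤ _ := (norm_sub_le _ _).trans (by linarith)
    have hy1 : ‖y t - y t₀‖ ≤ C * (L + D) := by
      have h1 := htC (y t - y t₀)
      rw [map_sub, hy t ht.1] at h1
      have h2 : |t - t₀| * ‖y t - y t₀‖ ≤ |t - t₀| * (C * (L + D)) := by
        nlinarith [mul_le_mul_of_nonneg_left hz hC0]
      exact le_of_mul_le_mul_left h2 hpos
    calc ‖(inner ℝ (B t (y t - y t₀)) (V t - A t (y t₀)) : ℝ)‖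
        ≤ ‖B t (y t - y t₀)‖ * ‖V t - A t (y t₀)‖ := norm_inner_le_norm _ _
      _ ≤ ‖B t‖ * (C * (L + D)) * ‖V t - A t (y t₀)‖ := by
        gcongr
        exact (B t).le_opNorm_of_le hy1
  have hmain := ((hBc.inner hVt).add (hZ.inner hBc)).add herr
  rw [inner_zero_left, add_zero, add_zero] at hmain
  refine hmain.congr' ?_
  filter_upwards [hmem] with t ht
  have := h.inner_expansion t (y t) (y t₀)
  rw [hy t ht.1] at this
  exact this.symm

/-- Derivative of the boundary term of the Riccati transformation. -/
theorem hasDerivAt_inner (h : IsLagrangianFrame S A B) {t₀ : ℝ} {V y : ℝ → E} {v : E}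
    (hV : HasDerivAt V v t₀) (hy : ∀ᶠ t in 𝓝 t₀, A t (y t) = V t)
    (hinj : Function.Injective (A t₀)) :
    HasDerivAt (fun t => (inner ℝ (B t (y t)) (V t) : ℝ))
      (inner ℝ v v + inner ℝ (S t₀ (V t₀)) (V t₀) - ‖v - B t₀ (y t₀)‖ ^ 2) t₀ := by
  obtain ⟨C, hC0, hC⟩ := exists_eventually_norm_le_of_tendsto (h.continuous_fst.tendsto t₀) hinj
  have hy₀ : A t₀ (y t₀) = V t₀ := hy.self_of_nhds
  have hA := h.hasDerivAt_fst_apply (y t₀) t₀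
  have hB := h.hasDerivAt_snd_apply (y t₀) t₀
  have hZ : HasDerivAt (fun t => V t - A t (y t₀)) (v - B t₀ (y t₀)) t₀ := hV.sub hA
  have hZ₀ : V t₀ - A t₀ (y t₀) = 0 := by rw [hy₀, sub_self]
  have herr : HasDerivAt (fun t => (inner ℝ (B t (y t - y t₀)) (V t - A t (y t₀)) : ℝ)) 0 t₀ := by
    rw [hasDerivAt_iff_isLittleO]
    simp only [smul_zero, sub_zero, hZ₀, inner_zero_right]
    have hZO : (fun t => V t - A t (y t₀)) =O[𝓝 t₀] fun t => t - t₀ := by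
      have := hZ.isBigO_sub
      simpa [hZ₀] using this
    have hZo : (fun t => V t - A t (y t₀)) =o[𝓝 t₀] fun _ => (1 : ℝ) := by
      rw [Asymptotics.isLittleO_one_iff, ← hZ₀]
      exact hZ.continuousAt
    have hyO : (fun t => B t (y t - y t₀)) =O[𝓝 t₀] fun t => V t - A t (y t₀) := by
      have hBO : (fun t => B t) =O[𝓝 t₀] fun _ => (1 : ℝ) :=
        (h.continuous_snd.tendsto t₀).isBigO_one ℝ
      have hyd : (fun t => y t - y t₀) =O[𝓝 t₀] fun t => V t - A t (y t₀) := by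
        refine Asymptotics.IsBigO.of_bound C ?_
        filter_upwards [hC, hy] with t ht hyt
        have := ht (y t - y t₀)
        rwa [map_sub, hyt] at this
      have h1 : (fun t => B t (y t - y t₀)) =O[𝓝 t₀] fun t => ‖B t‖ * ‖y t - y t₀‖ :=
        Asymptotics.IsBigO.of_bound 1 (Eventually.of_forall fun t => by
          simpa using (B t).le_opNorm (y t - y t₀))
      refine h1.trans ?_
      have := hBO.norm_left.mul hyd.norm_norm
      simpa using this
    have h2 : (fun t => (inner ℝ (B t (y t - y t₀)) (V t - A t (y t₀)) : ℝ)) =O[𝓝 t₀]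
        fun t => ‖B t (y t - y t₀)‖ * ‖V t - A t (y t₀)‖ :=
      Asymptotics.IsBigO.of_bound 1 (Eventually.of_forall fun t => by
        simpa using norm_inner_le_norm (𝕜 := ℝ) (B t (y t - y t₀)) (V t - A t (y t₀)))
    refine h2.trans_isLittleO ?_
    have := ((hyO.trans hZO).norm_left.mul_isLittleO hZo.norm_left)
    simpa using this
  have hmain := ((hB.inner ℝ hV).add (hZ.inner ℝ hB)).add herr
  refine (hmain.congr_of_eventuallyEq ?_).congr_deriv ?_
  · filter_upwards [hy] with t ht
    have := h.inner_expansion t (y t) (y t₀)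
    rwa [ht] at this
  · rw [hZ₀, hy₀, inner_zero_left, norm_sub_sq_real, inner_sub_left,
      real_inner_self_eq_norm_sq, real_inner_self_eq_norm_sq, real_inner_comm v]
    ring

end IsLagrangianFrame

end JacobiFrame

section Frame

variable {n : ℕ} {S : ℝ → EuclideanSpace ℝ (Fin n) →L[ℝ] EuclideanSpace ℝ (Fin n)}

theorem IsJacobiPair.eq_zero (hS : Continuous S) {J J' : ℝ → EuclideanSpace ℝ (Fin n)}
    (h : IsJacobiPair S J J') {t₀ : ℝ} (h0 : J t₀ = 0) (h0' : J' t₀ = 0) (t : ℝ) :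
    J t = 0 ∧ J' t = 0 :=
  second_order_linear_ode_solution_eq_zero hS h.1 h.2 h0 h0' t

theorem IsJacobiPair.sub {J J' K K' : ℝ → EuclideanSpace ℝ (Fin n)}
    (hJ : IsJacobiPair S J J') (hK : IsJacobiPair S K K') :
    IsJacobiPair S (fun t => J t - K t) (fun t => J' t - K' t) :=
  ⟨fun t => (hJ.1 t).sub (hK.1 t), fun t =>
    ((hJ.2 t).sub (hK.2 t)).congr_deriv (by simp)⟩

theorem exists_operator_of_bilinear
    (σ : EuclideanSpace ℝ (Fin n) →ₗ[ℝ] EuclideanSpace ℝ (Fin n) →ₗ[ℝ] ℝ) :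
    ∃ T : EuclideanSpace ℝ (Fin n) →L[ℝ] EuclideanSpace ℝ (Fin n),
      ∀ x y, (inner ℝ (T x) y : ℝ) = σ x y := by
  let e := EuclideanSpace.basisFun (Fin n) ℝ
  refine ⟨LinearMap.toContinuousLinearMap (∑ i, (σ.flip (e i)).smulRight (e i)), fun x y => ?_⟩
  conv_rhs => rw [← e.sum_repr' y]
  simp [sum_inner, real_inner_smul_left, mul_comm]

/-- The `P`-Jacobi fields are parametrized by a Lagrangian frame. -/
theorem exists_lagrangianFrame (hS : Continuous S)
    (hSsa : ∀ (t : ℝ) (x y : EuclideanSpace ℝ (Fin n)),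
      (inner ℝ (S t x) y : ℝ) = inner ℝ x (S t y))
    (σ : EuclideanSpace ℝ (Fin n) →ₗ[ℝ] EuclideanSpace ℝ (Fin n) →ₗ[ℝ] ℝ)
    (hσ : ∀ x y, σ x y = σ y x) (W : Submodule ℝ (EuclideanSpace ℝ (Fin n))) (a : ℝ) :
    ∃ A B : ℝ → EuclideanSpace ℝ (Fin n) →L[ℝ] EuclideanSpace ℝ (Fin n),
      IsLagrangianFrame S A B ∧ (∀ w ∈ W, A a w = w) ∧
      (∀ x, IsPJacobiPair S σ W a (fun t => A t x) (fun t => B t x)) ∧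
      ∀ J J', IsPJacobiPair S σ W a J J' → ∃ x, ∀ t, J t = A t x ∧ J' t = B t x := by
  obtain ⟨T, hT⟩ := exists_operator_of_bilinear σ
  set π := W.starProjection with hπ
  obtain ⟨A, B, hAa, hBa, hA, hB⟩ := exists_second_order_linear_ode_solution
    ((ContinuousLinearMap.compL ℝ (EuclideanSpace ℝ (Fin n)) _ _).continuous.comp hS) a π
    (1 - π - T ∘L π)
  have hπmem : ∀ x, π x ∈ W := fun x => Submodule.starProjection_apply_mem W x
  have hπorth : ∀ x, ∀ w ∈ W, (inner ℝ (x - π x) w : ℝ) = 0 := fun x w hw =>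
    Submodule.inner_left_of_mem_orthogonal hw (Submodule.sub_starProjection_mem_orthogonal x)
  have hAx : ∀ x t, HasDerivAt (fun t => A t x) (B t x) t := fun x t => by
    simpa using (hA t).clm_apply (hasDerivAt_const t x)
  have hBx : ∀ x t, HasDerivAt (fun t => B t x) (S t (A t x)) t := fun x t => by
    simpa using (hB t).clm_apply (hasDerivAt_const t x)
  have hjac : ∀ x, IsJacobiPair S (fun t => A t x) (fun t => B t x) := fun x => ⟨hAx x, hBx x⟩
  have hBa' : ∀ x, B a x = x - π x - T (π x) := fun x => by simp [hBa]
  refine ⟨A, B, ⟨hA, hB, fun t x y => ?_, fun t x h0 h0' => ?_⟩, fun w hw => ?_, fun x => ?_,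
    fun J J' hJ => ?_⟩
  · have hd : ∀ s, HasDerivAt
        (fun s => (inner ℝ (A s x) (B s y) : ℝ) - inner ℝ (B s x) (A s y)) 0 s := by
      intro s
      refine (((hAx x s).inner ℝ (hBx y s)).sub ((hBx x s).inner ℝ (hAx y s))).congr_deriv ?_
      rw [hSsa]
      ring
    have hconst := is_const_of_deriv_eq_zero (fun s => (hd s).differentiableAt)
      (fun s => (hd s).deriv) t a
    have ha : (inner ℝ (A a x) (B a y) : ℝ) - inner ℝ (B a x) (A a y) = 0 := by
      have h1 := hπorth y (π x) (hπmem x)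
      have h2 := hπorth x (π y) (hπmem y)
      have h3 := hT (π x) (π y)
      have h4 := hT (π y) (π x)
      have h5 := hσ (π x) (π y)
      rw [hBa', hBa', hAa, real_inner_comm, inner_sub_left (y - π y), inner_sub_left (x - π x),
        h1, h2, h3, h4, h5]
      ring
    linarith
  · obtain ⟨h1, h2⟩ := (hjac x).eq_zero hS h0 h0' a
    rw [hBa'] at h2
    rw [hAa] at h1
    simpa [h1] using h2
  · rw [hAa]
    exact Submodule.starProjection_eq_self_iff.2 hw
  · refine ⟨hjac x, ?_, fun w hw => ?_⟩
    · change A a x ∈ W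
      rw [hAa]
      exact hπmem x
    · change (inner ℝ (B a x) w : ℝ) + σ (A a x) w = 0
      rw [hBa', hAa, inner_sub_left, hπorth x w hw, hT]
      ring
  · obtain ⟨hJJ, hJW, hJσ⟩ := hJ
    have hperp : π (J' a + T (J a)) = 0 := by
      refine (Submodule.starProjection_apply_eq_zero_iff W).2 ?_
      rw [Submodule.mem_orthogonal']
      intro w hw
      rw [inner_add_left, hT]
      exact hJσ w hw
    have hπx : π (J a + (J' a + T (J a))) = J a := by
      rw [map_add, hperp, add_zero]
      exact Submodule.starProjection_eq_self_iff.2 hJW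
    refine ⟨J a + (J' a + T (J a)), fun t => ?_⟩
    have hz := (hJJ.sub (hjac (J a + (J' a + T (J a))))).eq_zero hS (t₀ := a)
      (by rw [hAa, hπx, sub_self]) (by rw [hBa', hπx]; abel) t
    exact ⟨sub_eq_zero.1 hz.1, sub_eq_zero.1 hz.2⟩

/-- The multiplicity of an instant is the nullity of the frame. -/
theorem focalMultiplicity_eq_finrank_ker
    {σ : EuclideanSpace ℝ (Fin n) →ₗ[ℝ] EuclideanSpace ℝ (Fin n) →ₗ[ℝ] ℝ}
    {W : Submodule ℝ (EuclideanSpace ℝ (Fin n))} {a : ℝ}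
    {A B : ℝ → EuclideanSpace ℝ (Fin n) →L[ℝ] EuclideanSpace ℝ (Fin n)}
    (h : IsLagrangianFrame S A B)
    (hP : ∀ x, IsPJacobiPair S σ W a (fun t => A t x) (fun t => B t x))
    (hP' : ∀ J J', IsPJacobiPair S σ W a J J' → ∃ x, ∀ t, J t = A t x ∧ J' t = B t x) (t : ℝ) :
    focalMultiplicity S σ W a t =
      Module.finrank ℝ (LinearMap.ker
        (A t : EuclideanSpace ℝ (Fin n) →ₗ[ℝ] EuclideanSpace ℝ (Fin n))) := by
  let f : LinearMap.ker (A t : EuclideanSpace ℝ (Fin n) →ₗ[ℝ] EuclideanSpace ℝ (Fin n)) →ₗ[ℝ]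
      pJacobiVanishingAt S σ W a t :=
    { toFun := fun x => ⟨(fun s => A s x, fun s => B s x), hP x, x.2⟩
      map_add' := fun x y => by ext <;> simp
      map_smul' := fun c x => by ext <;> simp }
  refine (LinearEquiv.finrank_eq (LinearEquiv.ofBijective f ⟨?_, ?_⟩)).symm
  · refine (injective_iff_map_eq_zero _).2 fun x hx => ?_
    have h1 : (fun s => A s x, fun s => B s x) =
      (0 : (ℝ → EuclideanSpace ℝ (Fin n)) × (ℝ → EuclideanSpace ℝ (Fin n))) :=
      congrArg Subtype.val hx
    exact Subtype.ext (h.eq_zero t x (congrFun (congrArg Prod.fst h1) t)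
      (congrFun (congrArg Prod.snd h1) t))
  · rintro ⟨⟨J, J'⟩, hJ, hJt⟩
    obtain ⟨x, hx⟩ := hP' J J' hJ
    refine ⟨⟨x, ?_⟩, ?_⟩
    · rw [LinearMap.mem_ker]
      exact ((hx t).1).symm.trans hJt
    · exact Subtype.ext (Prod.ext (funext fun s => ((hx s).1).symm)
        (funext fun s => ((hx s).2).symm))

end Frame

section Piecewise

variable {F : Type*} [NormedAddCommGroup F] [NormedSpace ℝ F]

/-- Away from finitely many points, a piecewise `C¹` map is differentiable with a continuous
and bounded derivative. -/
theorem PiecewiseC1On.exists_finset {a b : ℝ} {V : ℝ → F} (h : PiecewiseC1On a b V) :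
    ∃ (T : Finset ℝ) (C : ℝ), 0 ≤ C ∧ ∀ t ∈ Ioo a b, t ∉ T →
      DifferentiableAt ℝ V t ∧ ContinuousAt (deriv V) t ∧ ‖deriv V t‖ ≤ C := by
  obtain ⟨-, k, s, hs0, hsk, hsmono, hs⟩ := h
  have hbound : ∀ i : Fin k, ∃ C, ∀ t ∈ Icc (s i.castSucc) (s i.succ),
      ‖derivWithin V (Icc (s i.castSucc) (s i.succ)) t‖ ≤ C := fun i =>
    isCompact_Icc.exists_bound_of_continuousOn ((hs i).continuousOn_derivWithin
      (uniqueDiffOn_Icc (hsmono i.castSucc_lt_succ)) le_rfl)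
  choose C hC using hbound
  refine ⟨Finset.univ.image s, ∑ i, |C i|, Finset.sum_nonneg fun i _ => abs_nonneg _,
    fun t ht htT => ?_⟩
  have hne : ∀ j, s j ≠ t := fun j hj =>
    htT (Finset.mem_image.2 ⟨j, Finset.mem_univ j, hj⟩)
  obtain ⟨i, hi⟩ : ∃ i : Fin k, t ∈ Ioo (s i.castSucc) (s i.succ) := by
    by_contra! hcon
    have hlt : ∀ j : Fin (k + 1), s j < t := by
      intro j
      induction j using Fin.induction with
      | zero => rw [hs0]; exact ht.1
      | succ i ih =>
        by_contra hge
        exact hcon i ⟨ih, lt_of_le_of_ne (not_lt.1 hge) (hne _).symm⟩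
    exact absurd (hlt (Fin.last k)) (by rw [hsk]; exact ht.2.le.not_gt)
  have hcd : ContDiffOn ℝ 1 V (Ioo (s i.castSucc) (s i.succ)) := (hs i).mono Ioo_subset_Icc_self
  have hnhds : Icc (s i.castSucc) (s i.succ) ∈ 𝓝 t := Icc_mem_nhds hi.1 hi.2
  refine ⟨(hcd.differentiableOn one_ne_zero).differentiableAt (isOpen_Ioo.mem_nhds hi),
    (hcd.continuousOn_deriv_of_isOpen isOpen_Ioo le_rfl).continuousAt (isOpen_Ioo.mem_nhds hi), ?_⟩
  rw [← derivWithin_of_mem_nhds hnhds]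
  exact (hC i t (Ioo_subset_Icc_self hi)).trans ((le_abs_self _).trans
    (Finset.single_le_sum (f := fun i => |C i|) (fun i _ => abs_nonneg _) (Finset.mem_univ i)))

theorem intervalIntegrable_of_continuousAt_off_finset {G : Type*} [NormedAddCommGroup G]
    {a b C : ℝ} (hab : a ≤ b) {f : ℝ → G} {T : Finset ℝ}
    (hc : ∀ t ∈ Ioo a b, t ∉ T → ContinuousAt f t)
    (hC : ∀ t ∈ Ioo a b, t ∉ T → ‖f t‖ ≤ C) : IntervalIntegrable f MeasureTheory.volume a b := by
  rw [intervalIntegrable_iff_integrableOn_Ioo_of_le hab]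
  have hmeas : MeasurableSet (Ioo a b \ (T : Set ℝ)) :=
    measurableSet_Ioo.diff T.finite_toSet.measurableSet
  have hint : MeasureTheory.IntegrableOn f (Ioo a b \ (T : Set ℝ)) := by
    refine MeasureTheory.IntegrableOn.of_bound (C := C)
      ((MeasureTheory.measure_mono sdiff_subset).trans_lt (measure_Ioo_lt_top (a := a) (b := b)))
      (ContinuousOn.aestronglyMeasurable (fun t ht => ?_) hmeas) ?_
    · exact (hc t ht.1 (fun h => ht.2 h)).continuousWithinAt
    · filter_upwards [MeasureTheory.ae_restrict_mem hmeas] with t ht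
      exact hC t ht.1 (fun h => ht.2 h)
  refine hint.congr_set_ae ?_
  exact (MeasureTheory.sdiff_null_ae_eq_self (T.finite_toSet.measure_zero _)).symm

theorem exists_lipschitz_bound [CompleteSpace F] {a b C : ℝ} {V : ℝ → F} {T : Finset ℝ}
    (hV : ContinuousOn V (Icc a b))
    (hd : ∀ t ∈ Ioo a b, t ∉ T →
      DifferentiableAt ℝ V t ∧ ContinuousAt (deriv V) t ∧ ‖deriv V t‖ ≤ C) :
    ∀ s ∈ Icc a b, ∀ t ∈ Icc a b, ‖V t - V s‖ ≤ C * |t - s| := by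
  have key : ∀ s ∈ Icc a b, ∀ t ∈ Icc a b, s ≤ t → ‖V t - V s‖ ≤ C * |t - s| := by
    intro s hs t ht hst
    have hsub : Ioo s t ⊆ Ioo a b := Ioo_subset_Ioo hs.1 ht.2
    have hFTC := MeasureTheory.integral_eq_of_hasDerivAt_off_countable_of_le V (deriv V) hst
      T.countable_toSet (hV.mono (Icc_subset_Icc hs.1 ht.2))
      (fun x hx => (hd x (hsub hx.1) (fun h => hx.2 h)).1.hasDerivAt)
      (intervalIntegrable_of_continuousAt_off_finset hst
        (fun x hx hxT => (hd x (hsub hx) hxT).2.1) (fun x hx hxT => (hd x (hsub hx) hxT).2.2))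
    rw [← hFTC]
    refine intervalIntegral.norm_integral_le_of_norm_le_const_ae ?_
    have hnull : ∀ᵐ x, x ∉ ((insert t T : Finset ℝ) : Set ℝ) :=
      MeasureTheory.measure_eq_zero_iff_ae_notMem.1 ((insert t T).finite_toSet.measure_zero _)
    filter_upwards [hnull] with x hx hxI
    rw [uIoc_of_le hst] at hxI
    simp only [Finset.coe_insert, mem_insert_iff, Finset.mem_coe, not_or] at hx
    exact (hd x (hsub ⟨hxI.1, lt_of_le_of_ne hxI.2 hx.1⟩) hx.2).2.2
  intro s hs t ht
  rcases le_total s t with hst | hst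
  · exact key s hs t ht hst
  · rw [norm_sub_rev, abs_sub_comm]
    exact key t ht s hs hst

/-- A continuous function whose derivative is nonnegative off a finite set is monotone. -/
theorem le_of_hasDerivAt_nonneg_off_finset (T : Finset ℝ) {f f' : ℝ → ℝ} :
    ∀ {a b : ℝ}, a ≤ b → ContinuousOn f (Icc a b) →
      (∀ t ∈ Ioo a b, t ∉ T → HasDerivAt f (f' t) t ∧ 0 ≤ f' t) → f a ≤ f b := by
  induction T using Finset.induction_on with
  | empty =>
    intro a b hab hf hd
    refine monotoneOn_of_deriv_nonneg (convex_Icc a b) hf (fun t ht => ?_) (fun t ht => ?_)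
      (left_mem_Icc.2 hab) (right_mem_Icc.2 hab) hab
    · rw [interior_Icc] at ht
      exact (hd t ht (Finset.notMem_empty t)).1.differentiableAt.differentiableWithinAt
    · rw [interior_Icc] at ht
      rw [(hd t ht (Finset.notMem_empty t)).1.deriv]
      exact (hd t ht (Finset.notMem_empty t)).2
  | insert c T _ ih =>
    intro a b hab hf hd
    by_cases hc : c ∈ Ioo a b
    · refine (ih hc.1.le (hf.mono (Icc_subset_Icc_right hc.2.le)) fun t ht htT => ?_).trans
        (ih hc.2.le (hf.mono (Icc_subset_Icc_left hc.1.le)) fun t ht htT => ?_)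
      · exact hd t ⟨ht.1, ht.2.trans hc.2⟩ (by simp [ht.2.ne, htT])
      · exact hd t ⟨hc.1.trans ht.1, ht.2⟩ (by simp [ht.1.ne', htT])
    · refine ih hab hf fun t ht htT => hd t ht ?_
      have : t ≠ c := fun h => hc (h ▸ ht)
      simp [this, htT]

end Piecewise

section UpperBound

variable {n : ℕ} {S : ℝ → EuclideanSpace ℝ (Fin n) →L[ℝ] EuclideanSpace ℝ (Fin n)}
  {σ : EuclideanSpace ℝ (Fin n) →ₗ[ℝ] EuclideanSpace ℝ (Fin n) →ₗ[ℝ] ℝ}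
  {W : Submodule ℝ (EuclideanSpace ℝ (Fin n))} {a b : ℝ}
  {A B : ℝ → EuclideanSpace ℝ (Fin n) →L[ℝ] EuclideanSpace ℝ (Fin n)}

/-- The integrand of the index form is integrable. -/
theorem PiecewiseC1On.intervalIntegrable_indexForm (hS : Continuous S) (hab : a ≤ b)
    {V U : ℝ → EuclideanSpace ℝ (Fin n)} (hV : PiecewiseC1On a b V) (hU : PiecewiseC1On a b U) :
    IntervalIntegrable
      (fun t => (inner ℝ (deriv V t) (deriv U t) : ℝ) + inner ℝ (S t (V t)) (U t))
      MeasureTheory.volume a b := by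
  obtain ⟨T₁, C₁, hC₁, h₁⟩ := hV.exists_finset
  obtain ⟨T₂, C₂, -, h₂⟩ := hU.exists_finset
  refine IntervalIntegrable.add ?_ (ContinuousOn.intervalIntegrable ?_)
  · refine intervalIntegrable_of_continuousAt_off_finset (T := T₁ ∪ T₂) (C := C₁ * C₂) hab
      (fun t ht htT => ?_) (fun t ht htT => ?_)
    all_goals
      rw [Finset.mem_union, not_or] at htT
      obtain ⟨-, hc₁, hb₁⟩ := h₁ t ht htT.1
      obtain ⟨-, hc₂, hb₂⟩ := h₂ t ht htT.2
    · exact hc₁.inner hc₂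
    · exact (norm_inner_le_norm _ _).trans (mul_le_mul hb₁ hb₂ (norm_nonneg _) hC₁)
  · rw [uIcc_of_le hab]
    exact (hS.continuousOn.clm_apply hV.1).inner hU.1

/-- The index form is nonnegative on the fields taking values in the range of the frame. -/
theorem indexForm_self_nonneg_of_mem_range (h : IsLagrangianFrame S A B) (hS : Continuous S)
    (hab : a ≤ b) (hP : ∀ x, IsPJacobiPair S σ W a (fun t => A t x) (fun t => B t x))
    {T : Finset ℝ} (hT : ∀ t ∈ Ioo a b, t ∉ T → Function.Injective (A t))
    {V : ℝ → EuclideanSpace ℝ (Fin n)} (hV : V ∈ HP W a b)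
    (hrange : ∀ t ∈ Icc a b, ∃ y, A t y = V t) : 0 ≤ indexForm S σ a b V V := by
  obtain ⟨hVp, hVa, hVb⟩ := hV
  choose! y hy using hrange
  obtain ⟨T', C, hC, hd⟩ := hVp.exists_finset
  have hint := hVp.intervalIntegrable_indexForm hS hab hVp
  set f : ℝ → ℝ := fun t => (inner ℝ (deriv V t) (deriv V t) : ℝ) + inner ℝ (S t (V t)) (V t)
    with hf
  have hfc : ∀ t ∈ Ioo a b \ (T' : Set ℝ), ContinuousAt f t := fun t ht => by
    have h1 := hd t ht.1 (fun h => ht.2 h)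
    exact (h1.2.1.inner h1.2.1).add
      ((hS.continuousAt.clm_apply h1.1.continuousAt).inner h1.1.continuousAt)
  have hcont : ContinuousOn (fun t => (∫ s in a..t, f s) - inner ℝ (B t (y t)) (V t))
      (Icc a b) := by
    refine ContinuousOn.sub ?_ (h.continuousOn_inner (exists_lipschitz_bound hVp.1 hd) hy)
    have := intervalIntegral.continuousOn_primitive_interval' hint left_mem_uIcc
    rwa [uIcc_of_le hab] at this
  have hmono := le_of_hasDerivAt_nonneg_off_finset (T ∪ T')
    (f' := fun t => ‖deriv V t - B t (y t)‖ ^ 2) hab hcont (fun t ht htT => ?_)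
  · have hGa : (inner ℝ (B a (y a)) (V a) : ℝ) = -σ (V a) (V a) := by
      have h1 := (hP (y a)).2.2 (V a) hVa
      simp only [hy a (left_mem_Icc.2 hab)] at h1
      linarith
    simp only [hGa, hVb, intervalIntegral.integral_same, inner_zero_right] at hmono
    change 0 ≤ (∫ t in a..b, f t) - σ (V a) (V a)
    linarith
  · rw [Finset.mem_union, not_or] at htT
    refine ⟨?_, by positivity⟩
    have h1 := (hd t ht htT.2).1.hasDerivAt
    have hyt : ∀ᶠ s in 𝓝 t, A s (y s) = V s := by
      filter_upwards [Icc_mem_nhds ht.1 ht.2] with s hs using hy s hs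
    have h2 := h.hasDerivAt_inner h1 hyt (hT t ht htT.1)
    have hopen : IsOpen (Ioo a b \ (T' : Set ℝ)) :=
      isOpen_Ioo.sdiff T'.finite_toSet.isClosed
    have hmem : t ∈ Ioo a b \ (T' : Set ℝ) := ⟨ht, fun h => htT.2 h⟩
    have h3 : HasDerivAt (fun t => ∫ s in a..t, f s) (f t) t :=
      intervalIntegral.integral_hasDerivAt_right
        (hint.mono_set (uIcc_subset_uIcc_left (by rw [uIcc_of_le hab]; exact ⟨ht.1.le, ht.2.le⟩)))
        (ContinuousAt.stronglyMeasurableAtFilter hopen hfc t hmem) (hfc t hmem)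
    refine (h3.sub h2).congr_deriv ?_
    simp only [hf]
    ring

/-- A negative definite subspace has dimension at most the total nullity of the frame. -/
theorem finrank_le_sum_finrank_ker (h : IsLagrangianFrame S A B) (hS : Continuous S)
    (hab : a ≤ b) (hW : ∀ w ∈ W, A a w = w)
    (hP : ∀ x, IsPJacobiPair S σ W a (fun t => A t x) (fun t => B t x))
    {T : Finset ℝ} (hT : ∀ t ∈ Ioo a b, t ∉ T → Function.Injective (A t))
    (U : Submodule ℝ (ℝ → EuclideanSpace ℝ (Fin n))) (hU : (U : Set _) ⊆ HP W a b)
    (hneg : ∀ V ∈ U, V ≠ 0 → indexForm S σ a b V V < 0) :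
    Module.finrank ℝ U ≤ ∑ t ∈ T, Module.finrank ℝ
      (LinearMap.ker (A t : EuclideanSpace ℝ (Fin n) →ₗ[ℝ] EuclideanSpace ℝ (Fin n))) := by
  let K (t : ℝ) : Submodule ℝ (EuclideanSpace ℝ (Fin n)) :=
    LinearMap.ker (A t : EuclideanSpace ℝ (Fin n) →ₗ[ℝ] EuclideanSpace ℝ (Fin n))
  let Ψ : U →ₗ[ℝ] ((t : T) → Module.Dual ℝ (K t)) := LinearMap.pi fun t =>
    (LinearMap.lcomp ℝ ℝ
      ((B t : EuclideanSpace ℝ (Fin n) →ₗ[ℝ] EuclideanSpace ℝ (Fin n)) ∘ₗ (K t).subtype)) ∘ₗ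
      innerₗ (EuclideanSpace ℝ (Fin n)) ∘ₗ LinearMap.proj (t : ℝ) ∘ₗ U.subtype
  have hΨ : Function.Injective Ψ := by
    refine (injective_iff_map_eq_zero _).2 fun V hV => ?_
    by_contra hne
    refine (hneg V V.2 (fun h0 => hne (Subtype.ext h0))).not_ge
      (indexForm_self_nonneg_of_mem_range h hS hab hP hT (hU V.2) fun t ht => ?_)
    obtain ⟨-, hVa, hVb⟩ := hU V.2
    rcases ht.1.eq_or_lt with rfl | hat
    · exact ⟨_, hW _ hVa⟩
    rcases ht.2.eq_or_lt with rfl | htb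
    · exact ⟨0, by rw [map_zero, hVb]⟩
    by_cases htT : t ∈ T
    · refine (h.mem_range_iff t _).2 fun k hk => ?_
      rw [real_inner_comm]
      exact LinearMap.congr_fun (congrFun hV ⟨t, htT⟩) ⟨k, hk⟩
    · exact (LinearMap.injective_iff_surjective
        (f := (A t : EuclideanSpace ℝ (Fin n) →ₗ[ℝ] EuclideanSpace ℝ (Fin n)))).1
        (hT t ⟨hat, htb⟩ htT) _
  refine (LinearMap.finrank_le_finrank_of_injective hΨ).trans_eq ?_
  rw [Module.finrank_pi_fintype, ← Finset.sum_coe_sort T]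
  exact Finset.sum_congr rfl fun t _ => Subspace.dual_finrank_eq

end UpperBound

section LowerBound

/-- The continuous maps on `[a, b]` which are `C¹` on the closed subintervals whose interior
does not meet `P`. -/
def brokenC1 {F : Type*} [NormedAddCommGroup F] [NormedSpace ℝ F] (P : Finset ℝ) (a b : ℝ) :
    Submodule ℝ (ℝ → F) where
  carrier := {V | ContinuousOn V (Icc a b) ∧
    ∀ c d, c < d → (∀ p ∈ P, p ∉ Ioo c d) → ContDiffOn ℝ 1 V (Icc c d)}
  zero_mem' := ⟨continuousOn_const, fun _ _ _ _ => contDiffOn_const⟩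
  add_mem' := fun hV hU =>
    ⟨hV.1.add hU.1, fun c d hcd hP => (hV.2 c d hcd hP).add (hU.2 c d hcd hP)⟩
  smul_mem' := fun r _ hV => ⟨hV.1.const_smul r, fun c d hcd hP => (hV.2 c d hcd hP).const_smul r⟩

theorem piecewiseC1On_of_mem_brokenC1 {F : Type*} [NormedAddCommGroup F] [NormedSpace ℝ F]
    {P : Finset ℝ} {a b : ℝ} (hab : a < b) (hP : (P : Set ℝ) ⊆ Ioo a b) {V : ℝ → F}
    (hV : V ∈ brokenC1 P a b) : PiecewiseC1On a b V := by
  classical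
  set Q : Finset ℝ := insert a (insert b P) with hQ
  have hQab : ∀ q ∈ Q, q ∈ Icc a b := by
    intro q hq
    rw [hQ, Finset.mem_insert, Finset.mem_insert] at hq
    rcases hq with rfl | rfl | hq
    · exact left_mem_Icc.2 hab.le
    · exact right_mem_Icc.2 hab.le
    · exact Ioo_subset_Icc_self (hP hq)
  have haQ : a ∈ Q := Finset.mem_insert_self _ _
  have hbQ : b ∈ Q := Finset.mem_insert_of_mem (Finset.mem_insert_self _ _)
  obtain ⟨k, hk⟩ : ∃ k, Q.card = k + 1 :=
    Nat.exists_eq_succ_of_ne_zero (Finset.card_ne_zero_of_mem haQ)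
  set s := Q.orderEmbOfFin hk with hs
  have hsmem : ∀ i, s i ∈ Q := fun i => Finset.orderEmbOfFin_mem Q hk i
  have hsurj : ∀ q ∈ Q, ∃ i, s i = q := fun q hq => by
    have : q ∈ range s := by rw [hs, Finset.range_orderEmbOfFin]; exact hq
    exact this
  refine ⟨hV.1, k, s, ?_, ?_, s.strictMono, fun i => ?_⟩
  · obtain ⟨i, hi⟩ := hsurj a haQ
    exact le_antisymm ((s.monotone (Fin.zero_le i)).trans_eq hi) (hQab _ (hsmem 0)).1
  · obtain ⟨i, hi⟩ := hsurj b hbQ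
    exact le_antisymm (hQab _ (hsmem _)).2 (hi.symm.trans_le (s.monotone (Fin.le_last i)))
  · refine hV.2 _ _ (s.strictMono i.castSucc_lt_succ) fun p hp hpI => ?_
    obtain ⟨j, rfl⟩ := hsurj p (Finset.mem_insert_of_mem (Finset.mem_insert_of_mem hp))
    have h1 := s.lt_iff_lt.1 hpI.1
    have h2 := s.lt_iff_lt.1 hpI.2
    rw [Fin.lt_def] at h1 h2
    simp only [Fin.val_castSucc, Fin.val_succ] at h1 h2
    omega

variable {n : ℕ} {S : ℝ → EuclideanSpace ℝ (Fin n) →L[ℝ] EuclideanSpace ℝ (Fin n)}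
  {σ : EuclideanSpace ℝ (Fin n) →ₗ[ℝ] EuclideanSpace ℝ (Fin n) →ₗ[ℝ] ℝ}
  {W : Submodule ℝ (EuclideanSpace ℝ (Fin n))} {a b : ℝ}
  {A B : ℝ → EuclideanSpace ℝ (Fin n) →L[ℝ] EuclideanSpace ℝ (Fin n)}

theorem indexForm_comm
    (hSsa : ∀ (t : ℝ) (x y : EuclideanSpace ℝ (Fin n)),
      (inner ℝ (S t x) y : ℝ) = inner ℝ x (S t y))
    (hσ : ∀ x y, σ x y = σ y x) (V U : ℝ → EuclideanSpace ℝ (Fin n)) :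
    indexForm S σ a b V U = indexForm S σ a b U V := by
  simp only [indexForm]
  rw [hσ]
  congr 2
  ext t
  rw [real_inner_comm, hSsa, real_inner_comm (S t (U t))]

theorem indexForm_add_smul_left (hS : Continuous S) (hab : a ≤ b)
    {V U K : ℝ → EuclideanSpace ℝ (Fin n)} (hV : PiecewiseC1On a b V) (hU : PiecewiseC1On a b U)
    (hK : PiecewiseC1On a b K) (c : ℝ) :
    indexForm S σ a b (V + c • U) K = indexForm S σ a b V K + c * indexForm S σ a b U K := by
  obtain ⟨T₁, C₁, -, h₁⟩ := hV.exists_finset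
  obtain ⟨T₂, C₂, -, h₂⟩ := hU.exists_finset
  have hnull : ∀ᵐ x, x ∉ ((insert b (T₁ ∪ T₂) : Finset ℝ) : Set ℝ) :=
    MeasureTheory.measure_eq_zero_iff_ae_notMem.1 (Finset.finite_toSet _ |>.measure_zero _)
  have hint : ∫ t in a..b, ((inner ℝ (deriv (V + c • U) t) (deriv K t) : ℝ) +
        inner ℝ (S t ((V + c • U) t)) (K t)) =
      ∫ t in a..b, (((inner ℝ (deriv V t) (deriv K t) : ℝ) + inner ℝ (S t (V t)) (K t)) +
        c * ((inner ℝ (deriv U t) (deriv K t) : ℝ) + inner ℝ (S t (U t)) (K t))) := by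
    refine intervalIntegral.integral_congr_ae ?_
    filter_upwards [hnull] with t ht htI
    rw [uIoc_of_le hab] at htI
    simp only [Finset.coe_insert, Finset.coe_union, mem_insert_iff, mem_union, Finset.mem_coe,
      not_or] at ht
    have htab : t ∈ Ioo a b := ⟨htI.1, lt_of_le_of_ne htI.2 ht.1⟩
    have hdV := (h₁ t htab ht.2.1).1.hasDerivAt
    have hdU := (h₂ t htab ht.2.2).1.hasDerivAt
    rw [(hdV.add (hdU.const_smul c)).deriv]
    simp only [Pi.add_apply, Pi.smul_apply, map_add, map_smul, inner_add_left,
      real_inner_smul_left]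
    ring
  simp only [indexForm] at hint ⊢
  rw [hint, intervalIntegral.integral_add (hV.intervalIntegrable_indexForm hS hab hK)
    ((hU.intervalIntegrable_indexForm hS hab hK).const_mul c),
    intervalIntegral.integral_const_mul]
  simp only [Pi.add_apply, Pi.smul_apply, map_add, map_smul, LinearMap.add_apply,
    LinearMap.smul_apply, smul_eq_mul]
  ring

theorem indexForm_zero_left (K : ℝ → EuclideanSpace ℝ (Fin n)) :
    indexForm S σ a b 0 K = 0 := by
  have : deriv (0 : ℝ → EuclideanSpace ℝ (Fin n)) = fun _ => 0 := funext fun t =>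
    deriv_const t (0 : EuclideanSpace ℝ (Fin n))
  simp [indexForm, this]

theorem indexForm_sum_left (hS : Continuous S) (hab : a < b) {P : Finset ℝ}
    (hP : (P : Set ℝ) ⊆ Ioo a b) {ι : Type*} (s : Finset ι)
    {V : ι → ℝ → EuclideanSpace ℝ (Fin n)} (hV : ∀ i, V i ∈ brokenC1 P a b)
    {K : ℝ → EuclideanSpace ℝ (Fin n)} (hK : PiecewiseC1On a b K) :
    indexForm S σ a b (∑ i ∈ s, V i) K = ∑ i ∈ s, indexForm S σ a b (V i) K := by
  classical
  induction s using Finset.induction_on with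
  | empty => simpa using indexForm_zero_left K
  | insert i s hi ih =>
    rw [Finset.sum_insert hi, Finset.sum_insert hi, ← ih, add_comm (V i), add_comm (indexForm ..)]
    simpa using indexForm_add_smul_left (σ := σ) hS hab.le
      (piecewiseC1On_of_mem_brokenC1 hab hP (sum_mem fun i _ => hV i))
      (piecewiseC1On_of_mem_brokenC1 hab hP (hV i)) hK 1

theorem norm_sum_smul_sq_le {ι F : Type*} [Fintype ι] [NormedAddCommGroup F] [NormedSpace ℝ F]
    (c : ι → ℝ) (v : ι → F) :
    ‖∑ i, c i • v i‖ ^ 2 ≤ (∑ i, c i ^ 2) * ∑ i, ‖v i‖ ^ 2 := by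
  have h1 : ‖∑ i, c i • v i‖ ≤ ∑ i, |c i| * ‖v i‖ :=
    (norm_sum_le _ _).trans_eq (Finset.sum_congr rfl fun i _ => by
      rw [norm_smul, Real.norm_eq_abs])
  refine (pow_le_pow_left₀ (norm_nonneg _) h1 2).trans ?_
  simpa using Finset.sum_mul_sq_le_sq_mul_sq Finset.univ (fun i => |c i|) (fun i => ‖v i‖)

theorem exists_indexForm_sum_smul_le (hS : Continuous S) (hab : a ≤ b) {ι : Type*} [Fintype ι]
    {L : ι → ℝ → ℝ} (hL : ∀ i, ContDiff ℝ 1 (L i)) (hLa : ∀ i, L i a = 0) :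
    ∃ C, 0 ≤ C ∧ ∀ v : ι → EuclideanSpace ℝ (Fin n),
      indexForm S σ a b (fun t => ∑ i, L i t • v i) (fun t => ∑ i, L i t • v i) ≤
        C * ∑ i, ‖v i‖ ^ 2 := by
  have hL' : ∀ i, Continuous (deriv (L i)) := fun i => (hL i).continuous_deriv le_rfl
  set g : ℝ → ℝ := fun t => ∑ i, deriv (L i) t ^ 2 + ‖S t‖ * ∑ i, L i t ^ 2 with hg
  have hgc : Continuous g :=
    (continuous_finsetSum _ fun i _ => (hL' i).pow 2).add
      (hS.norm.mul (continuous_finsetSum _ fun i _ => (hL i).continuous.pow 2))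
  refine ⟨|∫ t in a..b, g t|, abs_nonneg _, fun v => ?_⟩
  have hderiv : ∀ t, deriv (fun t => ∑ i, L i t • v i) t = ∑ i, deriv (L i) t • v i := fun t =>
    (HasDerivAt.fun_sum fun i _ =>
      (((hL i).differentiable one_ne_zero) t).hasDerivAt.smul_const (v i)).deriv
  have hUc : Continuous fun t => ∑ i, L i t • v i :=
    continuous_finsetSum _ fun i _ => (hL i).continuous.smul continuous_const
  have hU'c : Continuous fun t => ∑ i, deriv (L i) t • v i :=
    continuous_finsetSum _ fun i _ => (hL' i).smul continuous_const
  simp only [indexForm, hderiv, hLa, zero_smul, Finset.sum_const_zero, map_zero, sub_zero]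
  refine (intervalIntegral.integral_mono_on hab (g := fun t => g t * ∑ i, ‖v i‖ ^ 2)
    (Continuous.intervalIntegrable ?_ a b) (Continuous.intervalIntegrable ?_ a b)
    fun t _ => ?_).trans ?_
  · exact (hU'c.inner hU'c).add ((hS.clm_apply hUc).inner hUc)
  · exact hgc.mul continuous_const
  · have h1 := norm_sum_smul_sq_le (fun i => deriv (L i) t) v
    have h2 := norm_sum_smul_sq_le (fun i => L i t) v
    have h3 : (inner ℝ (S t (∑ i, L i t • v i)) (∑ i, L i t • v i) : ℝ) ≤
        ‖S t‖ * ‖∑ i, L i t • v i‖ ^ 2 := by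
      refine (real_inner_le_norm _ _).trans ?_
      rw [pow_two, ← mul_assoc]
      gcongr
      exact (S t).le_opNorm _
    have h4 := mul_le_mul_of_nonneg_left h2 (norm_nonneg (S t))
    rw [real_inner_self_eq_norm_sq]
    simp only [hg]
    linarith
  · rw [intervalIntegral.integral_mul_const]
    exact mul_le_mul_of_nonneg_right (le_abs_self _) (by positivity)

/-- The Jacobi field `A x` restricted to `t ≤ τ` and extended by zero. -/
noncomputable def truncatedJacobi {F : Type*} [NormedAddCommGroup F] [NormedSpace ℝ F]
    (A : ℝ → F →L[ℝ] F) (τ : ℝ) : F →ₗ[ℝ] (ℝ → F) :=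
  LinearMap.pi fun t => if t ≤ τ then (A t : F →ₗ[ℝ] F) else 0

theorem truncatedJacobi_apply {F : Type*} [NormedAddCommGroup F] [NormedSpace ℝ F]
    (A : ℝ → F →L[ℝ] F) (τ : ℝ) (x : F) (t : ℝ) :
    truncatedJacobi A τ x t = if t ≤ τ then A t x else 0 := by
  simp only [truncatedJacobi, LinearMap.pi_apply]
  split_ifs <;> rfl

theorem IsLagrangianFrame.contDiff_fst_apply (h : IsLagrangianFrame S A B)
    (x : EuclideanSpace ℝ (Fin n)) : ContDiff ℝ 1 fun t => A t x := by
  rw [contDiff_one_iff_deriv]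
  refine ⟨fun t => (h.hasDerivAt_fst_apply x t).differentiableAt, ?_⟩
  rw [show deriv (fun t => A t x) = fun t => B t x from
    funext fun t => (h.hasDerivAt_fst_apply x t).deriv]
  exact continuous_iff_continuousAt.2 fun t => (h.hasDerivAt_snd_apply x t).continuousAt

theorem IsLagrangianFrame.truncatedJacobi_mem_brokenC1 (h : IsLagrangianFrame S A B)
    {P : Finset ℝ} {τ : ℝ} (hτ : τ ∈ P) {x : EuclideanSpace ℝ (Fin n)} (hx : A τ x = 0) :
    truncatedJacobi A τ x ∈ brokenC1 P a b := by
  have hc := h.contDiff_fst_apply x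
  have heq : truncatedJacobi A τ x = fun t => if t ≤ τ then A t x else 0 :=
    funext (truncatedJacobi_apply A τ x)
  refine ⟨?_, fun c d hcd hPcd => ?_⟩
  · rw [heq]
    refine (Continuous.if_le hc.continuous continuous_const continuous_id continuous_const
      fun t ht => ?_).continuousOn
    rw [id] at ht
    rw [ht, hx]
  · rw [heq]
    rcases le_or_gt d τ with hdτ | hτd
    · exact hc.contDiffOn.congr fun t ht => if_pos (ht.2.trans hdτ)
    · have hτc : τ ≤ c := not_lt.1 fun hcτ => hPcd τ hτ ⟨hcτ, hτd⟩
      refine (contDiffOn_const (c := (0 : EuclideanSpace ℝ (Fin n)))).congr fun t ht => ?_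
      split_ifs with htτ
      · rw [le_antisymm htτ (hτc.trans ht.1), hx]
      · rfl

/-- The first variation formula for a truncated `P`-Jacobi field. -/
theorem indexForm_truncatedJacobi (h : IsLagrangianFrame S A B) (hS : Continuous S)
    (hP : ∀ x, IsPJacobiPair S σ W a (fun t => A t x) (fun t => B t x))
    {τ : ℝ} (hτ : τ ∈ Ioo a b) {x : EuclideanSpace ℝ (Fin n)} (hx : A τ x = 0)
    {V : ℝ → EuclideanSpace ℝ (Fin n)} (hV : PiecewiseC1On a b V) (hVa : V a ∈ W) :
    indexForm S σ a b (truncatedJacobi A τ x) V = inner ℝ (B τ x) (V τ) := by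
  have hab := hτ.1.trans hτ.2
  have hJ : PiecewiseC1On a b (truncatedJacobi A τ x) :=
    piecewiseC1On_of_mem_brokenC1 (P := {τ}) hab (by simpa using hτ)
      (h.truncatedJacobi_mem_brokenC1 (Finset.mem_singleton_self τ) hx)
  obtain ⟨T, C, -, hd⟩ := hV.exists_finset
  have hint := hJ.intervalIntegrable_indexForm hS hab.le hV
  have hτu : τ ∈ uIcc a b := by rw [uIcc_of_le hab.le]; exact Ioo_subset_Icc_self hτ
  have hint₁ := hint.mono_set (uIcc_subset_uIcc_left hτu)
  have hint₂ := hint.mono_set (uIcc_subset_uIcc_right hτu)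
  have hleft : ∫ t in a..τ, ((inner ℝ (deriv (truncatedJacobi A τ x) t) (deriv V t) : ℝ) +
      inner ℝ (S t (truncatedJacobi A τ x t)) (V t)) =
      inner ℝ (B τ x) (V τ) - inner ℝ (B a x) (V a) := by
    refine MeasureTheory.integral_eq_of_hasDerivAt_off_countable_of_le
      (fun t => (inner ℝ (B t x) (V t) : ℝ)) _ hτ.1.le T.countable_toSet ?_ (fun t ht => ?_) hint₁
    · exact ContinuousOn.inner
        (fun t _ => (h.hasDerivAt_snd_apply x t).continuousAt.continuousWithinAt)
        (hV.1.mono (Icc_subset_Icc_right hτ.2.le))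
    · have hev : truncatedJacobi A τ x =ᶠ[𝓝 t] fun t => A t x := by
        filter_upwards [Iio_mem_nhds ht.1.2] with s hs
        rw [truncatedJacobi_apply, if_pos (le_of_lt hs)]
      rw [hev.deriv_eq, hev.eq_of_nhds, (h.hasDerivAt_fst_apply x t).deriv]
      exact (h.hasDerivAt_snd_apply x t).inner ℝ
        (hd t ⟨ht.1.1, ht.1.2.trans hτ.2⟩ (fun h => ht.2 h)).1.hasDerivAt
  have hright : ∫ t in τ..b, ((inner ℝ (deriv (truncatedJacobi A τ x) t) (deriv V t) : ℝ) +
      inner ℝ (S t (truncatedJacobi A τ x t)) (V t)) = 0 := by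
    refine intervalIntegral.integral_zero_ae (Eventually.of_forall fun t ht => ?_)
    rw [uIoc_of_le hτ.2.le] at ht
    have hev : truncatedJacobi A τ x =ᶠ[𝓝 t] fun _ => 0 := by
      filter_upwards [Ioi_mem_nhds ht.1] with s hs
      rw [truncatedJacobi_apply, if_neg (not_le.2 hs)]
    rw [hev.deriv_eq, hev.eq_of_nhds, deriv_const]
    simp
  have hPa := (hP x).2.2 (V a) hVa
  rw [indexForm, ← intervalIntegral.integral_add_adjacent_intervals hint₁ hint₂, hleft, hright,
    truncatedJacobi_apply, if_pos hτ.1.le]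
  linarith

end LowerBound

section Assembly

variable {n : ℕ} {S : ℝ → EuclideanSpace ℝ (Fin n) →L[ℝ] EuclideanSpace ℝ (Fin n)}
  {σ : EuclideanSpace ℝ (Fin n) →ₗ[ℝ] EuclideanSpace ℝ (Fin n) →ₗ[ℝ] ℝ}
  {W : Submodule ℝ (EuclideanSpace ℝ (Fin n))} {a b : ℝ}
  {A B : ℝ → EuclideanSpace ℝ (Fin n) →L[ℝ] EuclideanSpace ℝ (Fin n)}

theorem exists_contDiff_interpolation_basis (T : Finset ℝ) (hT : (T : Set ℝ) ⊆ Ioo a b) :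
    ∃ L : ℝ → ℝ → ℝ, (∀ i, ContDiff ℝ 1 (L i)) ∧
      ∀ i ∈ T, L i a = 0 ∧ L i b = 0 ∧ L i i = 1 ∧ ∀ j ∈ T, i ≠ j → L i j = 0 := by
  classical
  set Q : Finset ℝ := insert a (insert b T) with hQ
  have hmem : ∀ i ∈ T, i ∈ Q := fun i hi =>
    Finset.mem_insert_of_mem (Finset.mem_insert_of_mem hi)
  have hzero : ∀ i j, i ≠ j → j ∈ Q → (Lagrange.basis Q id i).eval j = 0 := fun i j hij hj =>
    Lagrange.eval_basis_of_ne (v := id) hij hj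
  refine ⟨fun i t => (Lagrange.basis Q id i).eval t,
    fun i => (Lagrange.basis Q id i).contDiff_aeval 1,
    fun i hi => ⟨hzero i a (hT hi).1.ne' (by simp [hQ]), hzero i b (hT hi).2.ne (by simp [hQ]),
      Lagrange.eval_basis_self (v := id) (injOn_id _) (hmem i hi),
      fun j hj hij => hzero i j hij (hmem j hj)⟩⟩

/-- The total nullity of the frame is at most the index of the index form. -/
theorem sum_finrank_ker_le_indexOn (h : IsLagrangianFrame S A B) (hS : Continuous S)
    (hSsa : ∀ (t : ℝ) (x y : EuclideanSpace ℝ (Fin n)),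
      (inner ℝ (S t x) y : ℝ) = inner ℝ x (S t y))
    (hσ : ∀ x y, σ x y = σ y x) (hab : a < b)
    (hP : ∀ x, IsPJacobiPair S σ W a (fun t => A t x) (fun t => B t x))
    {T : Finset ℝ} (hT : (T : Set ℝ) ⊆ Ioo a b) :
    ((∑ t ∈ T, Module.finrank ℝ (LinearMap.ker
      (A t : EuclideanSpace ℝ (Fin n) →ₗ[ℝ] EuclideanSpace ℝ (Fin n))) : ℕ) : ℕ∞) ≤
      indexOn (indexForm S σ a b) (HP W a b) := by
  let K (t : ℝ) : Submodule ℝ (EuclideanSpace ℝ (Fin n)) :=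
    LinearMap.ker (A t : EuclideanSpace ℝ (Fin n) →ₗ[ℝ] EuclideanSpace ℝ (Fin n))
  obtain ⟨L, hL, hLT⟩ := exists_contDiff_interpolation_basis T hT
  obtain ⟨C, hC, hCU⟩ := exists_indexForm_sum_smul_le (σ := σ) (ι := T) hS hab.le
    (L := fun i => L i) (fun i => hL i) (fun i => (hLT i i.2).1)
  let N : ((i : T) → K i) →ₗ[ℝ] (ℝ → EuclideanSpace ℝ (Fin n)) :=
    ∑ i : T, truncatedJacobi A i ∘ₗ (K i).subtype ∘ₗ LinearMap.proj i
  let U : ((i : T) → K i) →ₗ[ℝ] (ℝ → EuclideanSpace ℝ (Fin n)) :=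
    LinearMap.pi fun t => ∑ i : T, L i t •
      ((B i : EuclideanSpace ℝ (Fin n) →ₗ[ℝ] EuclideanSpace ℝ (Fin n)) ∘ₗ (K i).subtype ∘ₗ
        LinearMap.proj i)
  have hxK : ∀ (x : (i : T) → K i) (i : T), A i (x i) = 0 := fun x i => (x i).2
  have hNx : ∀ x, N x = ∑ i : T, truncatedJacobi A i (x i) := fun x => by simp [N]
  have hNt : ∀ x t, N x t = ∑ i : T, if t ≤ i then A t (x i) else 0 := fun x t => by
    rw [hNx, Finset.sum_apply]
    exact Finset.sum_congr rfl fun i _ => truncatedJacobi_apply ..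
  have hUx : ∀ x, U x = fun t => ∑ i : T, L i t • B i (x i) := fun x => by
    ext1 t
    simp [U]
  have htrunc : ∀ (x : (i : T) → K i) (i : T), truncatedJacobi A i (x i) ∈ brokenC1 T a b :=
    fun x i => h.truncatedJacobi_mem_brokenC1 i.2 (hxK x i)
  have hNmem : ∀ x, N x ∈ brokenC1 T a b := fun x => by
    rw [hNx]
    exact sum_mem fun i _ => htrunc x i
  have hUmem : ∀ x, U x ∈ brokenC1 T a b := fun x => by
    have hcd : ContDiff ℝ 1 (U x) := by
      rw [hUx]
      exact ContDiff.sum fun i _ => (hL i).smul contDiff_const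
    exact ⟨hcd.continuous.continuousOn, fun _ _ _ _ => hcd.contDiffOn⟩
  have hNp := fun x => piecewiseC1On_of_mem_brokenC1 hab hT (hNmem x)
  have hUp := fun x => piecewiseC1On_of_mem_brokenC1 hab hT (hUmem x)
  have hNa : ∀ x, N x a ∈ W := fun x => by
    rw [hNt]
    refine sum_mem fun i _ => ?_
    rw [if_pos (hT i.2).1.le]
    exact (hP (x i)).2.1
  have hNb : ∀ x, N x b = 0 := fun x => by
    rw [hNt]
    exact Finset.sum_eq_zero fun i _ => if_neg (not_le.2 (hT i.2).2)
  have hUa : ∀ x, U x a = 0 := fun x => by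
    rw [hUx]
    exact Finset.sum_eq_zero fun i _ => by rw [(hLT i i.2).1, zero_smul]
  have hUb : ∀ x, U x b = 0 := fun x => by
    rw [hUx]
    exact Finset.sum_eq_zero fun i _ => by rw [(hLT i i.2).2.1, zero_smul]
  have hUi : ∀ x (i : T), U x i = B i (x i) := fun x i => by
    rw [hUx]
    dsimp only
    rw [Finset.sum_eq_single i, (hLT i i.2).2.2.1, one_smul]
    · intro j _ hji
      rw [(hLT j j.2).2.2.2 i i.2 (fun h => hji (Subtype.ext h)), zero_smul]
    · exact fun hi => absurd (Finset.mem_univ i) hi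
  have hfirst : ∀ x V, PiecewiseC1On a b V → V a ∈ W →
      indexForm S σ a b (N x) V = ∑ i : T, inner ℝ (B i (x i)) (V i) := fun x V hV hVa => by
    rw [hNx, indexForm_sum_left hS hab hT _ (htrunc x) hV]
    exact Finset.sum_congr rfl fun i _ =>
      indexForm_truncatedJacobi h hS hP (hT i.2) (hxK x i) hV hVa
  have hNN : ∀ x, indexForm S σ a b (N x) (N x) = 0 := fun x => by
    rw [hfirst x _ (hNp x) (hNa x)]
    refine Finset.sum_eq_zero fun i _ => ?_
    rw [hNt, inner_sum]
    refine Finset.sum_eq_zero fun j _ => ?_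
    split_ifs
    · rw [← h.wronskian, hxK, inner_zero_left]
    · exact inner_zero_right _
  have hNU : ∀ x, indexForm S σ a b (N x) (U x) = ∑ i : T, ‖B i (x i)‖ ^ 2 := fun x => by
    rw [hfirst x _ (hUp x) (by rw [hUa]; exact W.zero_mem)]
    exact Finset.sum_congr rfl fun i _ => by rw [hUi, real_inner_self_eq_norm_sq]
  have hUU : ∀ x, indexForm S σ a b (U x) (U x) ≤ C * ∑ i : T, ‖B i (x i)‖ ^ 2 := fun x => by
    rw [hUx]
    exact hCU fun i => B i (x i)
  set ε : ℝ := -(C + 1)⁻¹ with hε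
  let Φ : ((i : T) → K i) →ₗ[ℝ] (ℝ → EuclideanSpace ℝ (Fin n)) := N + ε • U
  have hΦp : ∀ x, PiecewiseC1On a b (N x + ε • U x) := fun x =>
    piecewiseC1On_of_mem_brokenC1 hab hT
      (Submodule.add_mem _ (hNmem x) (Submodule.smul_mem _ _ (hUmem x)))
  have hΦ : ∀ x, indexForm S σ a b (Φ x) (Φ x) =
      2 * ε * ∑ i : T, ‖B i (x i)‖ ^ 2 + ε ^ 2 * indexForm S σ a b (U x) (U x) := fun x => by
    change indexForm S σ a b (N x + ε • U x) (N x + ε • U x) = _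
    rw [indexForm_add_smul_left hS hab.le (hNp x) (hUp x) (hΦp x), indexForm_comm hSsa hσ (N x),
      indexForm_comm hSsa hσ (U x), indexForm_add_smul_left hS hab.le (hNp x) (hUp x) (hNp x),
      indexForm_add_smul_left hS hab.le (hNp x) (hUp x) (hUp x), hNN,
      indexForm_comm hSsa hσ (U x) (N x), hNU]
    ring
  have hneg : ∀ x, x ≠ 0 → indexForm S σ a b (Φ x) (Φ x) < 0 := fun x hx => by
    have hpos : 0 < ∑ i : T, ‖B i (x i)‖ ^ 2 := by
      obtain ⟨i, hi⟩ := Function.ne_iff.1 hx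
      refine Finset.sum_pos' (fun i _ => by positivity) ⟨i, Finset.mem_univ i, ?_⟩
      have : B i (x i) ≠ 0 := fun h0 => hi (Subtype.ext (h.eq_zero i _ (hxK x i) h0))
      positivity
    have hε2 : ε ^ 2 * (C + 1) = -ε := by
      rw [hε]
      field_simp
    have hεneg : ε < 0 := by
      rw [hε]
      exact neg_neg_of_pos (by positivity)
    have hle := mul_le_mul_of_nonneg_left (hUU x) (sq_nonneg ε)
    rw [hΦ]
    nlinarith [mul_pos_of_neg_of_neg hεneg (neg_neg_of_pos hpos),
      mul_nonneg (sq_nonneg ε) hpos.le]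
  have hinj : Function.Injective Φ := by
    refine (injective_iff_map_eq_zero _).2 fun x hx => ?_
    by_contra hne
    have := hneg x hne
    rw [hx, indexForm_zero_left] at this
    exact this.false
  have hrange : (LinearMap.range Φ : Set (ℝ → EuclideanSpace ℝ (Fin n))) ⊆ HP W a b ∧
      FiniteDimensional ℝ (LinearMap.range Φ) ∧
      ∀ v ∈ LinearMap.range Φ, v ≠ 0 → indexForm S σ a b v v < 0 := by
    refine ⟨?_, inferInstance, ?_⟩
    · rintro _ ⟨x, rfl⟩
      refine ⟨hΦp x, ?_, ?_⟩
      · change N x a + ε • U x a ∈ W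
        rw [hUa, smul_zero, add_zero]
        exact hNa x
      · change N x b + ε • U x b = 0
        rw [hUb, hNb, smul_zero, add_zero]
    · rintro _ ⟨x, rfl⟩ hne
      exact hneg x fun h0 => hne (by rw [h0, map_zero])
  refine le_trans (le_of_eq ?_) (le_iSup₂_of_le (LinearMap.range Φ) hrange le_rfl)
  rw [LinearMap.finrank_range_of_inj hinj, Module.finrank_pi_fintype, ← Finset.sum_coe_sort T]

end Assembly

/-- **The Morse Index Theorem** (ODE model, with variable initial endpoint): the set of
`P`-focal instants in `(a, b]` is finite, and the index of the index form `I^P` on `H^P`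
equals the sum of the multiplicities of the `P`-focal instants in the open interval
`(a, b)`; in particular, this index is finite. -/
theorem morse_index_theorem {n : ℕ}
    (S : ℝ → EuclideanSpace ℝ (Fin n) →L[ℝ] EuclideanSpace ℝ (Fin n))
    (hS : ContDiff ℝ (⊤ : ℕ∞) S)
    (hSsa : ∀ (t : ℝ) (x y : EuclideanSpace ℝ (Fin n)),
      (inner ℝ (S t x) y : ℝ) = inner ℝ x (S t y))
    (σ : EuclideanSpace ℝ (Fin n) →ₗ[ℝ] EuclideanSpace ℝ (Fin n) →ₗ[ℝ] ℝ)
    (hσ : ∀ x y, σ x y = σ y x)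
    (W : Submodule ℝ (EuclideanSpace ℝ (Fin n)))
    (a b : ℝ) (hab : a < b) :
    {t ∈ Ioc a b | ∃ J J' : ℝ → EuclideanSpace ℝ (Fin n),
      IsPJacobiPair S σ W a J J' ∧ J t = 0 ∧ ¬∀ s, J s = 0}.Finite ∧
    ∃ T : Finset ℝ, (T : Set ℝ) ⊆ Ioo a b ∧
      (∀ t ∈ Ioo a b, t ∉ T → focalMultiplicity S σ W a t = 0) ∧
      indexOn (indexForm S σ a b) (HP W a b) =
        ((∑ t ∈ T, focalMultiplicity S σ W a t : ℕ) : ℕ∞) := by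
  classical
  have hSc := hS.continuous
  obtain ⟨A, B, h, hW, hP, hP'⟩ := exists_lagrangianFrame hSc hSsa σ hσ W a
  have hfin := h.finite_not_injective a b
  refine ⟨hfin.subset ?_, ?_⟩
  · rintro t ⟨ht, J, J', hJ, hJt, hne⟩
    refine ⟨Ioc_subset_Icc_self ht, fun hinj => hne fun s => ?_⟩
    obtain ⟨x, hx⟩ := hP' J J' hJ
    have hx0 : x = 0 := hinj (by rw [← (hx t).1, hJt, map_zero])
    rw [(hx s).1, hx0, map_zero]
  · have hmem : ∀ t, t ∈ hfin.toFinset.filter (· ∈ Ioo a b) ↔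
        t ∈ Ioo a b ∧ ¬Function.Injective (A t) := fun t => by
      rw [Finset.mem_filter, Set.Finite.mem_toFinset]
      exact ⟨fun ht => ⟨ht.2, ht.1.2⟩, fun ht => ⟨⟨Ioo_subset_Icc_self ht.1, ht.2⟩, ht.1⟩⟩
    set T := hfin.toFinset.filter (· ∈ Ioo a b)
    have hTsub : (T : Set ℝ) ⊆ Ioo a b := fun t ht => ((hmem t).1 ht).1
    have hTinj : ∀ t ∈ Ioo a b, t ∉ T → Function.Injective (A t) := fun t ht htT => by
      by_contra hinj
      exact htT ((hmem t).2 ⟨ht, hinj⟩)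
    refine ⟨T, hTsub, fun t ht htT => ?_, ?_⟩
    · rw [focalMultiplicity_eq_finrank_ker h hP hP', LinearMap.ker_eq_bot.2 (hTinj t ht htT),
        finrank_bot]
    · simp only [focalMultiplicity_eq_finrank_ker h hP hP']
      refine le_antisymm (iSup₂_le fun U hU => ?_)
        (sum_finrank_ker_le_indexOn h hSc hSsa hσ hab hP hTsub)
      exact_mod_cast finrank_le_sum_finrank_ker h hSc hab.le hW hP hTinj U hU.1 hU.2.2
end
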